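/- Let Γ̃_(n) be the Gelfand–Graev character of G_n = GL(n, F_q) and let K be a conjugacy class of G_n. If K is not unipotent, then Γ̃_(n) vanishes on K. If K is unipotent of type μ ⊢ n, then the value of Γ̃_(n) on K equals Σ_{ν ⊢ n} ((−1)^{n − ℓ(ν)} / z_ν) · |T̃_ν| · Q_ν^μ(q). -/

import Mathlib

/-!
Common framework for a formalization of statements from
"Gelfand–Graev characters of the finite unitary groups" (Thiem–Vinroot).
-/

open scoped Classical

noncomputable section

namespace GGU

/-! ### Partitions -/

/-- A partition, encoded as a weakly decreasing, finitely supported sequence of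
natural numbers; `parts i` is the `i`-th part `λ_i` for `i ≥ 1`, and `parts 0 = 0`
by convention. -/
structure Partn where
  parts : ℕ → ℕ
  parts_zero : parts 0 = 0
  parts_antitone : ∀ ⦃i j : ℕ⦄, 1 ≤ i → i ≤ j → parts j ≤ parts i
  parts_finite : {i : ℕ | parts i ≠ 0}.Finite

/-- The size `|λ|` of a partition. -/
def Partn.size (l : Partn) : ℕ := ∑ᶠ i, l.parts i

/-- The length `ℓ(λ)` (number of nonzero parts) of a partition. -/
def Partn.len (l : Partn) : ℕ := {i : ℕ | l.parts i ≠ 0}.ncard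

/-- The statistic `n(λ) = ∑ (i-1)·λ_i`. -/
def Partn.nstat (l : Partn) : ℕ := ∑ᶠ i, (i - 1) * l.parts i

/-- The multiplicity `m_k(λ)` of the part `k ≥ 1` in `λ`. -/
def Partn.mult (l : Partn) (k : ℕ) : ℕ := {i : ℕ | 1 ≤ i ∧ l.parts i = k}.ncard

/-- `z_λ = ∏_k k^{m_k} m_k!`. -/
def Partn.zee (l : Partn) : ℕ := ∏ᶠ k, k ^ l.mult k * (l.mult k).factorial

/-- The cell `(i,j)` (row `i ≥ 1`, column `j ≥ 1`) lies in the Young diagram of `λ`. -/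
def Partn.cell (l : Partn) (c : ℕ × ℕ) : Prop := 1 ≤ c.1 ∧ 1 ≤ c.2 ∧ c.2 ≤ l.parts c.1

/-- The empty partition. -/
def Partn.empty : Partn where
  parts := fun _ => 0
  parts_zero := rfl
  parts_antitone := fun _ _ _ _ => le_rfl
  parts_finite := by simp

/-- The one-row partition `(m)`. -/
def Partn.ofRow (m : ℕ) : Partn where
  parts := fun i => if i = 1 then m else 0
  parts_zero := by simp
  parts_antitone := by
    intro i j hi hij
    by_cases hj : j = 1
    · have hi1 : i = 1 := by omega
      simp [hj, hi1]
    · simp [hj]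
  parts_finite := Set.Finite.subset (Set.finite_singleton 1) (by
    intro i hi
    by_cases h : i = 1 <;> simp_all)

/-- Partial sums `λ_1 + ⋯ + λ_k`. -/
def Partn.cumul (l : Partn) (k : ℕ) : ℕ := ∑ t ∈ Finset.range k, l.parts (t + 1)

/-- Strict dominance order on partitions of the same size. -/
def DomLt (l m : Partn) : Prop :=
  l.size = m.size ∧ l ≠ m ∧ ∀ k, l.cumul k ≤ m.cumul k

/-- The set `{ν_{≤ 1}, ν_{≤ 2}, …}` of partial sums of a partition `ν`. -/
def cumSet (nu : Partn) : Set ℕ := {m : ℕ | ∃ j, 1 ≤ j ∧ m = nu.cumul j}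

/-- Lexicographic order on weight sequences. -/
def LexLE (f g : ℕ → ℕ) : Prop := f = g ∨ ∃ k, f k < g k ∧ ∀ j < k, f j = g j

/-! ### Dominoes, 2-cores and 2-quotients -/

/-- Two cells are adjacent (horizontally or vertically). -/
def adjCell (c d : ℕ × ℕ) : Prop :=
  (c.1 = d.1 ∧ (c.2 + 1 = d.2 ∨ d.2 + 1 = c.2)) ∨
  (c.2 = d.2 ∧ (c.1 + 1 = d.1 ∨ d.1 + 1 = c.1))

/-- `DomStep μ ρ` : the partition `ρ` is obtained from `μ` by removing one domino. -/
def DomStep (mu rho : Partn) : Prop :=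
  (∀ i, rho.parts i ≤ mu.parts i) ∧
  ∃ c d : ℕ × ℕ, c ≠ d ∧ adjCell c d ∧
    mu.cell c ∧ mu.cell d ∧ ¬ rho.cell c ∧ ¬ rho.cell d ∧
    ∀ e : ℕ × ℕ, mu.cell e → ¬ rho.cell e → e = c ∨ e = d

/-- `γ` is the 2-core of `λ`: it is obtained from `λ` by successively removing
dominoes, and admits no further domino removal. -/
def TwoCore (lam gam : Partn) : Prop :=
  Relation.ReflTransGen DomStep lam gam ∧ ∀ rho, ¬ DomStep gam rho

/-- `core₂(λ) ∈ {∅, (1)}`. -/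
def core2small (lam : Partn) : Prop := ∃ gam, TwoCore lam gam ∧ gam.size ≤ 1

/-- The size `|core₂(λ)|` of the 2-core of `λ`. -/
def core2size (lam : Partn) : ℕ := sInf {s | ∃ gam, TwoCore lam gam ∧ gam.size = s}

/-- The `j`-th part of one member (`ε ∈ {0,1}`) of the 2-quotient of `λ`,
computed from the β-set `{λ_t + N - t : 1 ≤ t ≤ N}` with `N = 2(|λ|+1)`. -/
def quot2part (lam : Partn) (ε : ℕ) (j : ℕ) : ℕ :=
  let N := 2 * (lam.size + 1)
  let B := (Finset.range N).image fun t => lam.parts (t + 1) + (N - (t + 1))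
  let L := (B.filter fun b => b % 2 = ε).sort (· ≤ ·)
  if 1 ≤ j ∧ j ≤ L.length then (L.getD (L.length - j) 0) / 2 - (L.length - j) else 0

/-- `quot₂(λ)_j`, the sum of the `j`-th parts of the two members of the 2-quotient. -/
def quot2sum (lam : Partn) (j : ℕ) : ℕ := quot2part lam 0 j + quot2part lam 1 j

/-! ### Tableaux -/

/-- A semistandard (column-strict) Young tableau of shape `λ` with entries in `{1,2,…}`. -/
structure SSYT (lam : Partn) where
  entry : ℕ × ℕ → ℕ
  entry_pos : ∀ c, lam.cell c → 1 ≤ entry c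
  entry_outside : ∀ c, ¬ lam.cell c → entry c = 0
  row_weak : ∀ i j : ℕ, lam.cell (i, j + 1) → entry (i, j) ≤ entry (i, j + 1)
  col_strict : ∀ i j : ℕ, 1 ≤ i → lam.cell (i + 1, j) → entry (i, j) < entry (i + 1, j)

/-- The number of entries equal to `k` in a semistandard tableau. -/
def SSYT.wt {lam : Partn} (T : SSYT lam) (k : ℕ) : ℕ :=
  {c : ℕ × ℕ | lam.cell c ∧ T.entry c = k}.ncard

/-- A symplectic tableau: a column strict filling of `λ` by the symbols
`0 < 1̄ < 1 < 2̄ < 2 < ⋯`, where the symbol `0` is encoded by `0`, `k̄` by `2k-1`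
and `k` by `2k`. -/
structure SympTab (lam : Partn) where
  entry : ℕ × ℕ → ℕ
  entry_outside : ∀ c, ¬ lam.cell c → entry c = 0
  row_weak : ∀ i j : ℕ, lam.cell (i, j + 1) → entry (i, j) ≤ entry (i, j + 1)
  col_strict : ∀ i j : ℕ, 1 ≤ i → lam.cell (i + 1, j) → entry (i, j) < entry (i + 1, j)

/-- The weight of a symplectic tableau: `wt 0` is the number of `0`'s, and for
`k ≥ 1`, `wt k` is the number of `k̄`'s plus the number of `k`'s. -/
def SympTab.wt {lam : Partn} (T : SympTab lam) (k : ℕ) : ℕ :=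
  if k = 0 then {c : ℕ × ℕ | lam.cell c ∧ T.entry c = 0}.ncard
  else {c : ℕ × ℕ | lam.cell c ∧ (T.entry c = 2 * k - 1 ∨ T.entry c = 2 * k)}.ncard

/-- The cells of `λ/(m₀)`: cells of `λ` other than the `m₀` leftmost cells of the
first row. -/
def Partn.tiled (lam : Partn) (m0 : ℕ) (c : ℕ × ℕ) : Prop :=
  lam.cell c ∧ ¬ (c.1 = 1 ∧ c.2 ≤ m0)

/-- A (semistandard) domino tableau of shape `λ/(m₀)`: a column strict filling of a
tiling of `λ/(m₀)` by dominoes, with `0`'s in the `m₀` non-tiled boxes.  The tiling is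
recorded by the involution `mate` matching each tiled cell with the other cell of its
domino. -/
structure DomTab (lam : Partn) (m0 : ℕ) where
  m0_le : m0 ≤ lam.parts 1
  entry : ℕ × ℕ → ℕ
  mate : ℕ × ℕ → ℕ × ℕ
  entry_pos : ∀ c, lam.tiled m0 c → 1 ≤ entry c
  entry_zero : ∀ c, ¬ lam.tiled m0 c → entry c = 0
  mate_tiled : ∀ c, lam.tiled m0 c → lam.tiled m0 (mate c)
  mate_id : ∀ c, ¬ lam.tiled m0 c → mate c = c
  mate_invol : ∀ c, mate (mate c) = c
  mate_adj : ∀ c, lam.tiled m0 c → adjCell c (mate c)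
  mate_entry : ∀ c, entry (mate c) = entry c
  row_weak : ∀ i j : ℕ, lam.cell (i, j + 1) → entry (i, j) ≤ entry (i, j + 1)
  col_strict : ∀ i j : ℕ, 1 ≤ i → lam.cell (i + 1, j) → mate (i, j) ≠ (i + 1, j) →
    entry (i, j) < entry (i + 1, j)

/-- The weight of a domino tableau: `wt k` is the number of dominoes labelled `k`. -/
def DomTab.wt {lam : Partn} {m0 : ℕ} (T : DomTab lam m0) (k : ℕ) : ℕ :=
  {c : ℕ × ℕ | lam.tiled m0 c ∧ T.entry c = k}.ncard / 2

/-! ### Θ-partitions and battery tableaux -/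

/-- A `Θ`-partition: an assignment of a partition to each element of the index
type `Th` (the set of Frobenius orbits), with finite support. -/
structure TPartn (Th : Type) where
  lam : Th → Partn
  finite : {φ : Th | lam φ ≠ Partn.empty}.Finite

/-- The size `|λ| = ∑_φ |φ|·|λ^{(φ)}|` of a `Θ`-partition, where `deg φ` is the
orbit size `|φ|`. -/
def TPartn.size {Th : Type} (deg : Th → ℕ) (l : TPartn Th) : ℕ :=
  ∑ᶠ φ, deg φ * (l.lam φ).size

/-- `n(λ) = ∑_φ |φ|·n(λ^{(φ)})` for a `Θ`-partition. -/
def TPartn.nstat {Th : Type} (deg : Th → ℕ) (l : TPartn Th) : ℕ :=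
  ∑ᶠ φ, deg φ * (l.lam φ).nstat

/-- A battery `Θ`-tableau of shape `λ/γ` (with `hgt(γ) ≤ 1`, so that `γ^{(φ)}` is the
one-row partition `(γ^{(φ)}_1)`): a domino tableau of shape `λ^{(φ)}/(γ^{(φ)}_1)` for each
`φ` with `|φ|` odd, and a symplectic tableau of shape `λ^{(φ)}/(γ^{(φ)}_1)` for each `φ`
with `|φ|` even. -/
structure BatteryTab {Th : Type} (deg : Th → ℕ) (lam gam : Th → Partn) where
  dom : ∀ φ, Odd (deg φ) → DomTab (lam φ) ((gam φ).parts 1)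
  symp : ∀ φ, ¬ Odd (deg φ) → SympTab (lam φ)
  symp_wt0 : ∀ φ (h : ¬ Odd (deg φ)), (symp φ h).wt 0 = (gam φ).parts 1

/-- The weight of a battery tableau:
`wt(Q)_i = ∑_{|φ| odd} |φ|·wt(Q^{(φ)})_i + ∑_{|φ| even} (|φ|/2)·wt(Q^{(φ)})_i`. -/
def BatteryTab.wt {Th : Type} {deg : Th → ℕ} {lam gam : Th → Partn}
    (T : BatteryTab deg lam gam) (i : ℕ) : ℕ :=
  ∑ᶠ φ : Th, if h : Odd (deg φ) then deg φ * (T.dom φ h).wt i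
    else (deg φ / 2) * (T.symp φ h).wt i

/-- The set `B^λ_{(k,ν)}` of battery tableaux of shape `λ/γ`, for some `Θ`-partition
`γ` of size `k` with `hgt(γ) ≤ 1`, and of weight `ν`. -/
structure Battery {Th : Type} (deg : Th → ℕ) (lam : TPartn Th) (k : ℕ) (nu : Partn) where
  gam : TPartn Th
  gam_size : TPartn.size deg gam = k
  gam_hgt : ∀ φ, (gam.lam φ).len ≤ 1
  gam_le : ∀ φ, (gam.lam φ).parts 1 ≤ (lam.lam φ).parts 1
  tab : BatteryTab deg lam.lam gam.lam
  tab_wt : ∀ i, 1 ≤ i → tab.wt i = nu.parts i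

/-! ### Symmetric functions as formal power series -/

/-- The Schur function `s_λ` in the variables `X_0, X_1, X_2, …`, defined
combinatorially: the coefficient of a monomial is the number of semistandard Young
tableaux of shape `λ` with the corresponding content. -/
def sSchur (lam : Partn) : MvPowerSeries ℕ ℂ :=
  fun d => (Nat.card {T : SSYT lam // ∀ k, 1 ≤ k → T.wt k = d (k - 1)} : ℂ)

/-- The Schur function `s_λ(Y^{(φ)})` in the variable family `Y^{(φ)}`, inside the ring
of symmetric functions in the variables `{Y^{(φ)}_j : φ ∈ Θ, j ∈ ℕ}`. -/
def sSchurAt {Th : Type} (φ : Th) (lam : Partn) : MvPowerSeries (Th × ℕ) ℂ :=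
  fun d => if ∀ x ∈ d.support, x.1 = φ then
    (Nat.card {T : SSYT lam // ∀ k, 1 ≤ k → T.wt k = d (φ, k - 1)} : ℂ) else 0

/-- `s_λ = ∏_φ s_{λ^{(φ)}}(Y^{(φ)})` for a `Θ`-partition `λ`. -/
def sTheta {Th : Type} (l : TPartn Th) : MvPowerSeries (Th × ℕ) ℂ :=
  ∏ᶠ φ, sSchurAt φ (l.lam φ)

/-- The monomial symmetric function `m_λ`. -/
def msym (l : Partn) : MvPowerSeries ℕ ℂ :=
  fun d => if d.support.val.map (fun i => d i) = l.parts_finite.toFinset.val.map l.parts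
    then 1 else 0

/-- The power sum `p_k = ∑_i X_i^k` (with `p_0 = 1` by convention). -/
def ppow (k : ℕ) : MvPowerSeries ℕ ℂ :=
  if k = 0 then 1
  else fun d => if ∃ i : ℕ, d = Finsupp.single i k then 1 else 0

/-- The power sum symmetric function `p_ν = p_{ν_1} p_{ν_2} ⋯`. -/
def psym (l : Partn) : MvPowerSeries ℕ ℂ := ∏ᶠ i, ppow (l.parts i)

/-- Plethysm with the power sum `p_2`: `(f ∘ p_2)(X_0, X_1, …) = f(X_0^2, X_1^2, …)`. -/
def plet2 (F : MvPowerSeries ℕ ℂ) : MvPowerSeries ℕ ℂ :=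
  fun d => if ∀ i, 2 ∣ d i
    then F (Finsupp.mapRange (· / 2) (Nat.zero_div 2) d) else 0



/-! ### The finite groups: `GL(n, F_{p^r})` and `U(n, F_{q²})` inside `GL(n, F̄_p)` -/

/-- An algebraic closure `F̄_p` of the prime field. -/
abbrev Fbar (p : ℕ) [Fact p.Prime] : Type := AlgebraicClosure (ZMod p)

/-- The field endomorphism `x ↦ x^{p^r}` of `F̄_p`. -/
def frobPow (p : ℕ) [Fact p.Prime] (r : ℕ) : Fbar p →+* Fbar p :=
  haveI : CharP (Fbar p) p :=
    charP_of_injective_algebraMap (algebraMap (ZMod p) (Fbar p)).injective p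
  haveI : ExpChar (Fbar p) p := ExpChar.prime Fact.out
  iterateFrobenius (Fbar p) p r

/-- The entrywise Frobenius `(a_{ij}) ↦ (a_{ij}^{p^r})` on `GL(n, F̄_p)`. -/
def entryFrobGL (p : ℕ) [Fact p.Prime] (r n : ℕ) :
    (Matrix (Fin n) (Fin n) (Fbar p))ˣ →* (Matrix (Fin n) (Fin n) (Fbar p))ˣ :=
  Units.map ((frobPow p r).mapMatrix.toMonoidHom)

/-- `GL(n, F_{p^r})`, realized as the fixed points of the entrywise Frobenius
`(a_{ij}) ↦ (a_{ij}^{p^r})` on `GL(n, F̄_p)`. -/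
def GLfix (p : ℕ) [Fact p.Prime] (r n : ℕ) : Subgroup (Matrix (Fin n) (Fin n) (Fbar p))ˣ where
  carrier := {A | entryFrobGL p r n A = A}
  one_mem' := by simp
  mul_mem' := by
    intro a b ha hb
    simp only [Set.mem_setOf_eq, map_mul] at *
    rw [ha, hb]
  inv_mem' := by
    intro a ha
    simp only [Set.mem_setOf_eq, map_inv] at *
    rw [ha]

/-- The anti-transpose `(M^{at})_{ij} = M_{n+1-j, n+1-i}` of a matrix. -/
def atrans {n : ℕ} {K : Type*} (M : Matrix (Fin n) (Fin n) K) : Matrix (Fin n) (Fin n) K :=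
  Matrix.of fun i j => M (Fin.rev j) (Fin.rev i)

lemma atrans_one {n : ℕ} {K : Type*} [NonAssocSemiring K] :
    atrans (1 : Matrix (Fin n) (Fin n) K) = 1 := by
  ext i j
  simp only [atrans, Matrix.of_apply, Matrix.one_apply, Fin.rev_inj]
  by_cases h : i = j
  · simp [h]
  · simp [h, Ne.symm h]

lemma atrans_mul {n : ℕ} {K : Type*} [CommSemiring K] (M N : Matrix (Fin n) (Fin n) K) :
    atrans (M * N) = atrans N * atrans M := by
  ext i j
  simp only [atrans, Matrix.of_apply, Matrix.mul_apply]
  exact Fintype.sum_equiv Fin.revPerm _ _ (fun k => by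
    simp [Fin.rev_rev, mul_comm])

/-- The twisted Frobenius `F'(A) = (ᵃ(A^{p^f}))⁻¹` (entrywise `q = p^f` power, followed by
anti-transpose-inverse) on `GL(n, F̄_p)`, whose fixed point group is the finite unitary
group `U(n, F_{q²})`. -/
def unitaryFrob (p : ℕ) [Fact p.Prime] (fexp n : ℕ) :
    (Matrix (Fin n) (Fin n) (Fbar p))ˣ →* (Matrix (Fin n) (Fin n) (Fbar p))ˣ where
  toFun A :=
    { val := atrans ((frobPow p fexp).mapMatrix A.inv)
      inv := atrans ((frobPow p fexp).mapMatrix A.val)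
      val_inv := by
        rw [← atrans_mul, ← map_mul, A.val_inv, map_one, atrans_one]
      inv_val := by
        rw [← atrans_mul, ← map_mul, A.inv_val, map_one, atrans_one] }
  map_one' := by
    apply Units.ext
    show atrans ((frobPow p fexp).mapMatrix (1 : Matrix (Fin n) (Fin n) (Fbar p))) = _
    rw [map_one, atrans_one]
    rfl
  map_mul' := by
    intro A B
    apply Units.ext
    show atrans ((frobPow p fexp).mapMatrix (B.inv * A.inv)) = _
    rw [map_mul, atrans_mul]
    rfl

/-- The finite unitary group `U(n, F_{q²})` (with `q = p^fexp`), realized as the fixed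
points of the twisted Frobenius `F'` on `GL(n, F̄_p)`. -/
def Uprime (p : ℕ) [Fact p.Prime] (fexp n : ℕ) :
    Subgroup (Matrix (Fin n) (Fin n) (Fbar p))ˣ where
  carrier := {A | unitaryFrob p fexp n A = A}
  one_mem' := by simp
  mul_mem' := by
    intro a b ha hb
    simp only [Set.mem_setOf_eq, map_mul] at *
    rw [ha, hb]
  inv_mem' := by
    intro a ha
    simp only [Set.mem_setOf_eq, map_inv] at *
    rw [ha]

/-- The underlying matrix of an element of a subgroup of `GL(n, F̄_p)`. -/
def matOf {p : ℕ} [Fact p.Prime] {n : ℕ} {H : Subgroup (Matrix (Fin n) (Fin n) (Fbar p))ˣ}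
    (u : ↥H) : Matrix (Fin n) (Fin n) (Fbar p) :=
  ((u : (Matrix (Fin n) (Fin n) (Fbar p))ˣ) : Matrix (Fin n) (Fin n) (Fbar p))

/-- The subgroup (as a subset) of unipotent upper-triangular matrices in `H`. -/
def unitri {p : ℕ} [Fact p.Prime] {n : ℕ} (H : Subgroup (Matrix (Fin n) (Fin n) (Fbar p))ˣ) :
    Set ↥H :=
  {u | (∀ i j : Fin n, j < i → matOf u i j = 0) ∧ ∀ i : Fin n, matOf u i i = 1}

/-! ### Class function machinery -/

/-- The induced class function `Ind_B^G ψ (g) = |B|⁻¹ ∑_{x ∈ G, x⁻¹gx ∈ B} ψ(x⁻¹gx)`,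
for a subset `B` of `G` and `ψ : G → ℂ` (only the values of `ψ` on `B` matter). -/
def indChar {G : Type} [Group G] (B : Set G) (ψ : G → ℂ) : G → ℂ :=
  fun g => (Nat.card B : ℂ)⁻¹ * ∑ᶠ x : G, if x⁻¹ * g * x ∈ B then ψ (x⁻¹ * g * x) else 0

/-- The inner product `⟨f, h⟩ = |G|⁻¹ ∑_g f(g) \overline{h(g)}` of complex class
functions on a finite group. -/
def charInner {G : Type} (f h : G → ℂ) : ℂ :=
  (Nat.card G : ℂ)⁻¹ * ∑ᶠ g : G, f g * (starRingEnd ℂ) (h g)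

/-- `θ : G → ℂ` is the character of an irreducible (complex) representation of `G`. -/
def IsIrredChar (G : Type) [Group G] (θ : G → ℂ) : Prop :=
  ∃ V : FDRep ℂ G, CategoryTheory.Simple V ∧ θ = fun g => V.character g

/-- `M` is a unipotent matrix whose Jordan type is the partition `μ`, expressed through
the ranks of the powers of `M - 1`:  `rank((M-1)^k) = ∑_i max(μ_i - k, 0)` for all `k`. -/
def unipOfType {n : ℕ} {K : Type*} [Field K] (M : Matrix (Fin n) (Fin n) K)
    (mu : Partn) : Prop :=
  ∀ k : ℕ, ((M - 1) ^ k).rank = ∑ᶠ i, (mu.parts i - k)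

/-! ### Gelfand–Graev and degenerate Gelfand–Graev characters -/

/-- The sum of the superdiagonal entries `u_{i,i+1}`, `1 ≤ i ≤ ⌊n/2⌋`, `i ∉ S`,
of an element of the unitary group (in the `F'`-fixed, upper-triangular realization). -/
def sdSumU (p : ℕ) [Fact p.Prime] (fexp n : ℕ) (S : Set ℕ)
    (u : ↥(Uprime p fexp n)) : Fbar p :=
  ∑ i : Fin n, ∑ j : Fin n,
    if (j : ℕ) = (i : ℕ) + 1 ∧ (j : ℕ) ≤ n / 2 ∧ (j : ℕ) ∉ S then matOf u i j else 0

/-- The degenerate Gelfand–Graev character `Γ_{(k,ν)}` of `U(n, F_{q²})` (it depends only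
on `ν`; `k = n - 2|ν|`).  It is induced from the linear character
`u ↦ ψ₀(∑_{i ≤ ⌊n/2⌋, i ∉ ν_≤} u_{i,i+1})` of the unipotent upper-triangular subgroup,
where `ν_≤` is the set of partial sums of `ν`.  Taking `ν = ∅` gives the Gelfand–Graev
character `Γ_{(n)}`. -/
def GammaDGG (p : ℕ) [Fact p.Prime] (fexp n : ℕ) (ψ0 : Fbar p → ℂ) (nu : Partn) :
    ↥(Uprime p fexp n) → ℂ :=
  indChar (unitri (Uprime p fexp n)) (fun u => ψ0 (sdSumU p fexp n (cumSet nu) u))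

/-- The sum of all superdiagonal entries of an element of `GL(n, F_{p^r})`. -/
def sdSumGL (p : ℕ) [Fact p.Prime] (r n : ℕ) (u : ↥(GLfix p r n)) : Fbar p :=
  ∑ i : Fin n, ∑ j : Fin n, if (j : ℕ) = (i : ℕ) + 1 then matOf u i j else 0

/-- The Gelfand–Graev character of `GL(n, F_{p^r})`, induced from the generic linear
character `u ↦ ψ₀(u_{1,2} + u_{2,3} + ⋯ + u_{n-1,n})` of the unipotent upper-triangular
subgroup. -/
def GammaGL (p : ℕ) [Fact p.Prime] (r n : ℕ) (ψ0 : Fbar p → ℂ) : ↥(GLfix p r n) → ℂ :=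
  indChar (unitri (GLfix p r n)) (fun u => ψ0 (sdSumGL p r n u))

/-! ### Harish-Chandra induction from `GL(n, F_{q²})` to `U(2n, F_{q²})` -/

/-- The (maximally split) parabolic subgroup of `U(2n, F_{q²})` with Levi
`GL(n, F_{q²})`: block upper-triangular matrices. -/
def PsetGLU (p : ℕ) [Fact p.Prime] (fexp n : ℕ) : Set ↥(Uprime p fexp (2 * n)) :=
  {g | ∀ i j : Fin (2 * n), (j : ℕ) < n → n ≤ (i : ℕ) → matOf g i j = 0}

/-- Harish-Chandra induction `R_{GL(n,F_{q²})}^{U(2n,F_{q²})}` of a class function `θ` of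
`GL(n, F_{q²})`: inflate `θ` to the parabolic `P` through the Levi projection (upper-left
`n × n` block) and induce to `U(2n, F_{q²})`. -/
def HCIndGLtoU (p : ℕ) [Fact p.Prime] (fexp n : ℕ)
    (θ : ↥(GLfix p (2 * fexp) n) → ℂ) : ↥(Uprime p fexp (2 * n)) → ℂ :=
  fun g =>
    (Nat.card (PsetGLU p fexp n) : ℂ)⁻¹ *
      ∑ᶠ x : ↥(Uprime p fexp (2 * n)), ∑ᶠ l : ↥(GLfix p (2 * fexp) n),
        if x⁻¹ * g * x ∈ PsetGLU p fexp n ∧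
            (∀ i j : Fin n,
              matOf (x⁻¹ * g * x) (Fin.castLE (by omega) i) (Fin.castLE (by omega) j) =
                matOf l i j)
        then θ l else 0

/-! #### Exponential formula -/

def wtm (m : ℕ →₀ ℕ) : ℕ := m.sum fun k e => (k + 1) * e

def zm (m : ℕ →₀ ℕ) : ℂ := m.prod fun k e => ((k : ℂ) + 1) ^ e * (e.factorial : ℂ)

lemma wtm_add (m m' : ℕ →₀ ℕ) : wtm (m + m') = wtm m + wtm m' := by
  unfold wtm
  exact Finsupp.sum_add_index' (by simp) (by intros; ring)

lemma wtm_single (k e : ℕ) : wtm (Finsupp.single k e) = (k + 1) * e := by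
  simp [wtm]

lemma wtm_finite (n : ℕ) : {m : ℕ →₀ ℕ | wtm m = n}.Finite := by
  refine (Set.finite_Iic (∑ k ∈ Finset.range n, Finsupp.single k n)).subset ?_
  intro m hm
  have hm : wtm m = n := hm
  rw [Set.mem_Iic]
  intro k
  by_cases hk : m k = 0
  · simp [hk]
  have h1 : (k + 1) * m k ≤ n := by
    rw [← hm, wtm, Finsupp.sum]
    exact Finset.single_le_sum (f := fun k => (k + 1) * m k) (fun _ _ => Nat.zero_le _)
      (Finsupp.mem_support_iff.2 hk)
  have h2 : m k ≤ n := by nlinarith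
  have h3 : k < n := by
    have : 1 ≤ m k := Nat.one_le_iff_ne_zero.2 hk
    nlinarith
  rw [Finsupp.finsetSum_apply]
  refine le_trans ?_ (Finset.single_le_sum (f := fun i => (Finsupp.single i n) k)
    (fun _ _ => Nat.zero_le _) (Finset.mem_range.2 h3))
  simpa using h2

def PF (n : ℕ) : Finset (ℕ →₀ ℕ) := (wtm_finite n).toFinset

lemma mem_PF {n : ℕ} {m : ℕ →₀ ℕ} : m ∈ PF n ↔ wtm m = n := by
  unfold PF
  rw [Set.Finite.mem_toFinset]
  rfl

lemma zm_ne (m : ℕ →₀ ℕ) : zm m ≠ 0 := by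
  unfold zm
  rw [Finsupp.prod, Finset.prod_ne_zero_iff]
  intro k _
  have : ((k : ℂ) + 1) ≠ 0 := by exact_mod_cast Nat.succ_ne_zero k
  have h2 : ((m k).factorial : ℂ) ≠ 0 := by exact_mod_cast Nat.factorial_ne_zero _
  positivity

section
variable {A : Type*} [CommRing A] [Algebra ℂ A]

def mono (a : ℕ → A) (m : ℕ →₀ ℕ) : A := m.prod fun k e => a k ^ e

def En (a : ℕ → A) (n : ℕ) : A := ∑ m ∈ PF n, (zm m)⁻¹ • mono a m

lemma erase_add_single (m : ℕ →₀ ℕ) (k : ℕ) :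
    (m + Finsupp.single k 1).erase k = m.erase k := by
  ext j
  by_cases h : j = k
  · subst h; simp
  · simp [Finsupp.erase_ne h, Finsupp.single_apply, Ne.symm h]

lemma mono_add_single (a : ℕ → A) (m : ℕ →₀ ℕ) (k : ℕ) :
    mono a (m + Finsupp.single k 1) = a k * mono a m := by
  unfold mono
  rw [Finsupp.prod_add_index' (by simp) (by intros; ring)]
  simp [mul_comm]

lemma zm_add_single (m : ℕ →₀ ℕ) (k : ℕ) :
    zm (m + Finsupp.single k 1) = ((k : ℂ) + 1) * ((m k : ℂ) + 1) * zm m := by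
  unfold zm
  rw [← Finsupp.mul_prod_erase' (m + Finsupp.single k 1) k _ (by simp),
    ← Finsupp.mul_prod_erase' m k _ (by simp), erase_add_single]
  simp only [Finsupp.add_apply, Finsupp.single_eq_same, Nat.factorial_succ]
  push_cast
  ring

lemma En_zero_right (a : ℕ → A) : En a 0 = 1 := by
  have : PF 0 = {0} := by
    ext m
    rw [mem_PF, Finset.mem_singleton]
    constructor
    · intro h
      ext k
      by_contra hk
      have h1 : (k + 1) * m k ≤ wtm m := by
        rw [wtm, Finsupp.sum]
        exact Finset.single_le_sum (f := fun k => (k + 1) * m k) (fun _ _ => Nat.zero_le _)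
          (Finsupp.mem_support_iff.2 hk)
      have h2 : 1 ≤ m k := Nat.one_le_iff_ne_zero.2 hk
      nlinarith
    · rintro rfl; simp [wtm]
  simp [En, this, zm, mono]

lemma En_rec (a : ℕ → A) (n : ℕ) :
    ((n : ℂ) + 1) • En a (n + 1) = ∑ k ∈ Finset.range (n + 1), a k * En a (n - k) := by
  have h1 : ∀ m ∈ PF (n + 1), ((n : ℂ) + 1) • ((zm m)⁻¹ • mono a m) =
      ∑ k ∈ Finset.range (n + 1), (((k : ℂ) + 1) * (m k : ℂ)) • ((zm m)⁻¹ • mono a m) := by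
    intro m hm
    rw [← Finset.sum_smul]
    congr 1
    have hm := mem_PF.1 hm
    have : (n + 1 : ℕ) = ∑ k ∈ Finset.range (n + 1), (k + 1) * m k := by
      refine hm.symm.trans ?_
      rw [wtm]
      refine Finsupp.sum_of_support_subset _ ?_ _ (by simp)
      intro k hk
      have hk' := Finsupp.mem_support_iff.1 hk
      have h1 : (k + 1) * m k ≤ wtm m := by
        rw [wtm, Finsupp.sum]
        exact Finset.single_le_sum (f := fun k => (k + 1) * m k) (fun _ _ => Nat.zero_le _) hk
      have h2 : 1 ≤ m k := Nat.one_le_iff_ne_zero.2 hk'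
      rw [Finset.mem_range]
      nlinarith
    exact_mod_cast this
  rw [En, Finset.smul_sum, Finset.sum_congr rfl h1, Finset.sum_comm]
  refine Finset.sum_congr rfl fun k hk => ?_
  have hk := Finset.mem_range.1 hk
  rw [En, Finset.mul_sum]
  rw [← Finset.sum_filter_of_ne (p := fun m : ℕ →₀ ℕ => m k ≠ 0)]
  swap
  · intro m _ h h0
    apply h
    simp [h0]
  have key : ∀ m : ℕ →₀ ℕ, m k ≠ 0 → (m - Finsupp.single k 1) + Finsupp.single k 1 = m := by
    intro m hm
    ext j
    by_cases h : j = k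
    · subst h; simp; omega
    · simp [Finsupp.single_apply, Ne.symm h]
  refine Finset.sum_nbij' (fun m => m - Finsupp.single k 1) (fun m => m + Finsupp.single k 1)
    ?_ ?_ ?_ ?_ ?_
  · intro m hm
    rw [Finset.mem_filter, mem_PF] at hm
    have := key m hm.2
    rw [mem_PF]
    have h2 := wtm_add (m - Finsupp.single k 1) (Finsupp.single k 1)
    rw [this, wtm_single] at h2
    omega
  · intro m hm
    rw [mem_PF] at hm
    rw [Finset.mem_filter, mem_PF, wtm_add, wtm_single]
    refine ⟨by omega, by simp⟩
  · intro m hm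
    rw [Finset.mem_filter] at hm
    exact key m hm.2
  · intro m hm
    simp
  · intro m hm
    rw [Finset.mem_filter] at hm
    obtain ⟨m', rfl⟩ : ∃ m', m = m' + Finsupp.single k 1 := ⟨_, (key m hm.2).symm⟩
    simp only [add_tsub_cancel_right]
    rw [zm_add_single, mono_add_single, smul_smul, mul_smul_comm]
    congr 1
    have h1 : ((k : ℂ) + 1) ≠ 0 := by exact_mod_cast Nat.succ_ne_zero k
    have h2 : ((m' k : ℂ) + 1) ≠ 0 := by exact_mod_cast Nat.succ_ne_zero (m' k)
    have h3 := zm_ne m'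
    simp only [Finsupp.add_apply, Finsupp.single_eq_same]
    push_cast
    field_simp

lemma En_unique (a : ℕ → A) (Y : ℕ → A) (h0 : Y 0 = 1)
    (h : ∀ n : ℕ, ((n : ℂ) + 1) • Y (n + 1) = ∑ k ∈ Finset.range (n + 1), a k * Y (n - k))
    (n : ℕ) : Y n = En a n := by
  induction n using Nat.strong_induction_on with
  | _ n ih =>
    cases n with
    | zero => rw [h0, En_zero_right]
    | succ n =>
      have h1 : ((n : ℂ) + 1) ≠ 0 := by exact_mod_cast Nat.succ_ne_zero n
      have : ((n : ℂ) + 1) • Y (n + 1) = ((n : ℂ) + 1) • En a (n + 1) := by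
        rw [h, En_rec]
        refine Finset.sum_congr rfl fun k hk => ?_
        rw [ih (n - k) (by omega)]
      have h2 := congrArg (fun x => ((n : ℂ) + 1)⁻¹ • x) this
      simpa [smul_smul, inv_mul_cancel₀ h1] using h2

lemma En_map {B : Type*} [CommRing B] [Algebra ℂ B] (f : A →ₐ[ℂ] B) (a : ℕ → A) (n : ℕ) :
    f (En a n) = En (fun k => f (a k)) n := by
  simp only [En, map_sum, map_smul, mono, Finsupp.prod, map_prod, map_pow]

lemma En_scale (c : ℂ) (a : ℕ → A) (n : ℕ) :
    En (fun k => c ^ (k + 1) • a k) n = c ^ n • En a n := by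
  symm
  refine En_unique _ (fun n => c ^ n • En a n) (by simp [En_zero_right]) (fun n => ?_) n
  rw [smul_comm, En_rec, Finset.smul_sum]
  refine Finset.sum_congr rfl fun k hk => ?_
  have hk := Finset.mem_range.1 hk
  rw [smul_mul_smul_comm, ← pow_add]
  congr 2
  omega

lemma En_zero (n : ℕ) : En (fun _ => (0 : A)) n = if n = 0 then 1 else 0 := by
  symm
  refine En_unique _ (fun n => if n = 0 then (1 : A) else 0) (by simp) (fun n => ?_) n
  simp

lemma En_add (a b : ℕ → A) (n : ℕ) :
    En (fun k => a k + b k) n = ∑ ij ∈ Finset.HasAntidiagonal.antidiagonal n, En a ij.1 * En b ij.2 := by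
  have hG : ∀ a : ℕ → A, PowerSeries.derivative A (PowerSeries.mk (En a)) =
      PowerSeries.mk a * PowerSeries.mk (En a) := by
    intro a
    ext n
    rw [PowerSeries.coeff_derivative, PowerSeries.coeff_mul, PowerSeries.coeff_mk,
      Finset.Nat.sum_antidiagonal_eq_sum_range_succ_mk]
    simp only [PowerSeries.coeff_mk]
    rw [← En_rec, Algebra.smul_def, mul_comm]
    simp
  symm
  refine En_unique _ (fun n => ∑ ij ∈ Finset.HasAntidiagonal.antidiagonal n, En a ij.1 * En b ij.2)
    (by simp [En_zero_right]) (fun n => ?_) n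
  have h2 : ∀ n, PowerSeries.coeff n (PowerSeries.mk (En a) * PowerSeries.mk (En b)) =
      ∑ ij ∈ Finset.HasAntidiagonal.antidiagonal n, En a ij.1 * En b ij.2 := by
    intro n
    rw [PowerSeries.coeff_mul]
    simp
  simp only [← h2]
  have h3 : PowerSeries.derivative A (PowerSeries.mk (En a) * PowerSeries.mk (En b)) =
      PowerSeries.mk (fun k => a k + b k) * (PowerSeries.mk (En a) * PowerSeries.mk (En b)) := by
    rw [Derivation.leibniz, hG, hG, smul_eq_mul, smul_eq_mul]
    have : PowerSeries.mk (fun k => a k + b k) = PowerSeries.mk a + PowerSeries.mk b := by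
      ext; simp
    rw [this]; ring
  have h4 := congrArg (PowerSeries.coeff n) h3
  rw [PowerSeries.coeff_derivative, PowerSeries.coeff_mul n,
      Finset.Nat.sum_antidiagonal_eq_sum_range_succ_mk] at h4
  simp only [PowerSeries.coeff_mk] at h4
  rw [← h4, Algebra.smul_def, mul_comm]
  simp

end

/-! #### Combinatorics of partitions -/

def rk (k : ℕ) (d : ℕ →₀ ℕ) : ℕ := d.sum fun _ e => e - k

lemma Partn.supp_eq (l : Partn) : {i : ℕ | l.parts i ≠ 0} = ↑(Finset.Icc 1 l.len) := by
  have hdown : ∀ i, l.parts i ≠ 0 → ∀ j, 1 ≤ j → j ≤ i → l.parts j ≠ 0 := by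
    intro i hi j hj hji
    have := l.parts_antitone hj hji
    omega
  set S := l.parts_finite.toFinset with hS
  have hlen : l.len = S.card := by
    unfold Partn.len
    rw [hS, Set.ncard_eq_toFinset_card _ l.parts_finite]
  have hmem : ∀ i, i ∈ S ↔ l.parts i ≠ 0 := by
    intro i
    rw [hS, Set.Finite.mem_toFinset]; rfl
  have hpos : ∀ i ∈ S, 1 ≤ i := by
    intro i hi
    rw [hmem] at hi
    by_contra h
    have : i = 0 := by omega
    subst this
    exact hi l.parts_zero
  have h1 : S = Finset.Icc 1 l.len := by
    have hsub : ∀ i ∈ S, Finset.Icc 1 i ⊆ S := by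
      intro i hi j hj
      rw [Finset.mem_Icc] at hj
      rw [hmem] at hi ⊢
      exact hdown i hi j hj.1 hj.2
    have : S ⊆ Finset.Icc 1 l.len := by
      intro i hi
      have h2 := Finset.card_le_card (hsub i hi)
      rw [Nat.card_Icc] at h2
      rw [Finset.mem_Icc, hlen]
      exact ⟨hpos i hi, by omega⟩
    exact Finset.eq_of_subset_of_card_le this (by rw [Nat.card_Icc, hlen]; omega)
  ext i
  rw [← h1]
  exact (hmem i).symm

lemma Partn.parts_ne_iff (l : Partn) (i : ℕ) : l.parts (i + 1) ≠ 0 ↔ i < l.len := by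
  have h : (i + 1) ∈ {i : ℕ | l.parts i ≠ 0} ↔ (i + 1) ∈ (↑(Finset.Icc 1 l.len) : Set ℕ) := by
    rw [l.supp_eq]
  have h2 : (i + 1) ∈ (↑(Finset.Icc 1 l.len) : Set ℕ) ↔ i < l.len := by
    rw [Finset.mem_coe, Finset.mem_Icc]; omega
  rw [← h2, ← h]; rfl

/-- finsum over parts -/
lemma Partn.finsum_parts (l : Partn) {M : Type*} [AddCommMonoid M] (f : ℕ → ℕ → M)
    (hf : ∀ i, f i 0 = 0) :
    ∑ᶠ i, f i (l.parts i) = ∑ i ∈ Finset.range l.len, f (i + 1) (l.parts (i + 1)) := by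
  rw [finsum_eq_sum_of_support_subset (s := Finset.Icc 1 l.len)]
  · rw [Finset.range_eq_Ico, Finset.sum_Ico_add' (fun i => f i (l.parts i)) 0 l.len 1]
    rfl
  · rw [← l.supp_eq]
    intro i hi h
    apply hi
    simp only [h, hf]

lemma Partn.finprod_parts (l : Partn) {M : Type*} [CommMonoid M] (f : ℕ → M)
    (hf : f 0 = 1) :
    ∏ᶠ i, f (l.parts i) = ∏ i ∈ Finset.range l.len, f (l.parts (i + 1)) := by
  rw [finprod_eq_prod_of_mulSupport_subset (s := Finset.Icc 1 l.len)]
  · rw [Finset.range_eq_Ico, Finset.prod_Ico_add' (fun i => f (l.parts i)) 0 l.len 1]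
    rfl
  · rw [← l.supp_eq]
    intro i hi h
    apply hi
    simp only [h, hf]

def dF (l : Partn) : ℕ →₀ ℕ :=
  Finsupp.onFinset (Finset.range l.len) (fun i => l.parts (i + 1))
    (fun i h => Finset.mem_range.2 ((l.parts_ne_iff i).1 h))

lemma dF_apply (l : Partn) (i : ℕ) : dF l i = l.parts (i + 1) := rfl

lemma dF_anti (l : Partn) : Antitone (dF l) := by
  intro i j h
  exact l.parts_antitone (by omega) (by omega)

lemma dF_support (l : Partn) : (dF l).support = Finset.range l.len := by
  ext i
  rw [Finsupp.mem_support_iff, dF_apply, l.parts_ne_iff, Finset.mem_range]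

lemma dF_inj {l m : Partn} (h : dF l = dF m) : l = m := by
  have : l.parts = m.parts := by
    funext i
    cases i with
    | zero => rw [l.parts_zero, m.parts_zero]
    | succ i => exact DFunLike.congr_fun h i
  cases l; cases m; simp at this; subst this; rfl

def pm (l : Partn) : ℕ →₀ ℕ :=
  ∑ i ∈ Finset.range l.len, Finsupp.single (l.parts (i + 1) - 1) 1

lemma prod_parts (l : Partn) {M : Type*} [CommMonoid M] (f : ℕ → M) :
    ∏ i ∈ Finset.range l.len, f (l.parts (i + 1)) = (pm l).prod fun k e => f (k + 1) ^ e := by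
  unfold pm
  rw [← Finsupp.prod_finset_sum_index (by simp) (by intros; rw [pow_add])]
  refine Finset.prod_congr rfl fun i hi => ?_
  have := (l.parts_ne_iff i).2 (Finset.mem_range.1 hi)
  rw [Finsupp.prod_single_index (by simp), pow_one]
  congr 1; omega

lemma sum_parts (l : Partn) (f : ℕ → ℕ) :
    ∑ i ∈ Finset.range l.len, f (l.parts (i + 1)) = (pm l).sum fun k e => f (k + 1) * e := by
  unfold pm
  rw [← Finsupp.sum_finset_sum_index (by simp) (by intros; ring)]
  refine Finset.sum_congr rfl fun i hi => ?_
  have := (l.parts_ne_iff i).2 (Finset.mem_range.1 hi)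
  rw [Finsupp.sum_single_index (by simp), mul_one]
  congr 1; omega

lemma size_eq (l : Partn) : l.size = wtm (pm l) := by
  unfold Partn.size wtm
  rw [l.finsum_parts (fun _ x => x) (by simp), sum_parts l (fun x => x)]

lemma size_eq_rk (l : Partn) : l.size = rk 0 (dF l) := by
  unfold Partn.size rk
  rw [l.finsum_parts (fun _ x => x) (by simp), Finsupp.sum, dF_support]
  rfl

lemma rk_eq_finsum (l : Partn) (k : ℕ) : ∑ᶠ i, (l.parts i - k) = rk k (dF l) := by
  unfold rk
  rw [l.finsum_parts (fun _ x => x - k) (by simp), Finsupp.sum, dF_support]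
  rfl

lemma rk_dF_pm (l : Partn) (k : ℕ) : rk k (dF l) = (pm l).sum fun j e => (j + 1 - k) * e := by
  rw [← sum_parts l (fun x => x - k), rk, Finsupp.sum, dF_support]
  rfl

lemma len_eq (l : Partn) : l.len = (pm l).sum fun _ e => e := by
  have := sum_parts l (fun _ => 1)
  simpa using this

lemma nstat_eq (l : Partn) : l.nstat = (dF l).sum fun i e => i * e := by
  unfold Partn.nstat
  rw [l.finsum_parts (fun i x => (i - 1) * x) (by simp), Finsupp.sum, dF_support]
  rfl

lemma mult_eq (l : Partn) (k : ℕ) : l.mult (k + 1) = pm l k := by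
  have h1 : {i : ℕ | 1 ≤ i ∧ l.parts i = k + 1} =
      ↑(((Finset.range l.len).filter (fun i => l.parts (i + 1) = k + 1)).image (· + 1)) := by
    ext i
    rw [Finset.coe_image, Set.mem_image]
    constructor
    · rintro ⟨h1, h2⟩
      refine ⟨i - 1, ?_, by omega⟩
      rw [Finset.mem_coe, Finset.mem_filter, Finset.mem_range, ← l.parts_ne_iff]
      rw [Nat.sub_add_cancel h1]; omega
    · rintro ⟨j, hj, rfl⟩
      rw [Finset.mem_coe, Finset.mem_filter] at hj
      exact ⟨by simp, hj.2⟩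
  unfold Partn.mult
  rw [h1, Set.ncard_coe_finset, Finset.card_image_of_injective _ (add_left_injective 1), pm,
    Finsupp.finsetSum_apply, Finset.card_filter]
  refine Finset.sum_congr rfl fun i hi => ?_
  have := (l.parts_ne_iff i).2 (Finset.mem_range.1 hi)
  rw [Finsupp.single_apply]
  congr 1
  apply propext
  omega

lemma zee_eq (l : Partn) : (l.zee : ℂ) = zm (pm l) := by
  have h0 : l.mult 0 = 0 := by
    unfold Partn.mult
    apply Set.Infinite.ncard
    apply Set.Infinite.mono (s := Set.Ioi l.len)
    · intro i hi
      have hi : l.len < i := hi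
      refine ⟨by omega, ?_⟩
      by_contra h
      have := (l.parts_ne_iff (i - 1)).1 (by rwa [Nat.sub_add_cancel (by omega)])
      omega
    · exact Set.Ioi_infinite _
  unfold Partn.zee zm
  rw [finprod_eq_prod_of_mulSupport_subset (s := (pm l).support.image (· + 1))]
  · rw [Finset.prod_image (by intro a _ b _ h; simpa using h), Finsupp.prod]
    push_cast
    refine Finset.prod_congr rfl fun k _ => ?_
    rw [mult_eq]
  · intro k hk
    rw [Finset.coe_image, Set.mem_image]
    cases k with
    | zero => exact absurd (by simp [h0]) hk
    | succ k =>
      refine ⟨k, ?_, rfl⟩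
      rw [Finset.mem_coe, Finsupp.mem_support_iff]
      intro h
      apply hk
      simp [mult_eq, h]

lemma psym_eq (l : Partn) : psym l = mono (fun k => ppow (k + 1)) (pm l) := by
  unfold psym mono
  rw [l.finprod_parts ppow (by simp [ppow]), prod_parts l ppow]

lemma rk_succ (k : ℕ) (d : ℕ →₀ ℕ) :
    rk k d = rk (k + 1) d + (d.support.filter (fun i => k < d i)).card := by
  unfold rk Finsupp.sum
  rw [Finset.card_filter, ← Finset.sum_add_distrib]
  refine Finset.sum_congr rfl fun i _ => ?_
  beta_reduce
  split_ifs <;> omega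

lemma filter_range (d : ℕ →₀ ℕ) (hd : Antitone d) (k : ℕ) :
    d.support.filter (fun i => k < d i) =
      Finset.range (d.support.filter (fun i => k < d i)).card := by
  set S := d.support.filter (fun i => k < d i) with hS
  have hmem : ∀ i, i ∈ S ↔ k < d i := by
    intro i
    rw [hS, Finset.mem_filter, Finsupp.mem_support_iff]; omega
  refine Finset.eq_of_subset_of_card_le ?_ (by simp)
  intro i hi
  have : Finset.range (i + 1) ⊆ S := by
    intro j hj
    rw [hmem] at hi ⊢
    have := hd (show j ≤ i by rw [Finset.mem_range] at hj; omega)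
    omega
  have := Finset.card_le_card this
  rw [Finset.card_range] at this
  rw [Finset.mem_range]; omega

lemma rk_anti_inj (d d' : ℕ →₀ ℕ) (hd : Antitone d) (hd' : Antitone d')
    (h : ∀ k, rk k d = rk k d') : d = d' := by
  have h1 : ∀ k i, k < d i ↔ k < d' i := by
    intro k i
    have e1 := rk_succ k d
    have e2 := rk_succ k d'
    have e3 := h k
    have e4 := h (k + 1)
    have hc : (d.support.filter (fun i => k < d i)).card =
      (d'.support.filter (fun i => k < d' i)).card := by omega
    have hs : d.support.filter (fun i => k < d i) = d'.support.filter (fun i => k < d' i) := by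
      rw [filter_range d hd k, filter_range d' hd' k, hc]
    have := Finset.ext_iff.1 hs i
    rw [Finset.mem_filter, Finset.mem_filter, Finsupp.mem_support_iff,
      Finsupp.mem_support_iff] at this
    constructor
    · intro h; exact (this.1 ⟨by omega, h⟩).2
    · intro h; exact (this.2 ⟨by omega, h⟩).2
  ext i
  have a := h1 (d i) i
  have b := h1 (d' i) i
  omega

lemma rk_inj {l m : Partn} (h : ∀ k, rk k (dF l) = rk k (dF m)) : l = m :=
  dF_inj (rk_anti_inj _ _ (dF_anti l) (dF_anti m) h)

lemma pm_inj {l m : Partn} (h : pm l = pm m) : l = m :=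
  rk_inj fun k => by rw [rk_dF_pm, rk_dF_pm, h]

lemma sum_range_sub_le_rk (d : ℕ →₀ ℕ) (c k : ℕ) :
    ∑ i ∈ Finset.range c, (d i - k) ≤ rk k d := by
  unfold rk Finsupp.sum
  rw [← Finset.sum_filter_ne_zero]
  refine Finset.sum_le_sum_of_subset_of_nonneg ?_ (fun _ _ _ => Nat.zero_le _)
  intro i hi
  rw [Finset.mem_filter] at hi
  rw [Finsupp.mem_support_iff]; omega

lemma domLt_rk {l m : Partn} (h : DomLt l m) (k : ℕ) : rk k (dF l) ≤ rk k (dF m) := by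
  obtain ⟨_, _, h3⟩ := h
  set c := ((dF l).support.filter (fun i => k < dF l i)).card with hc
  have hS := filter_range (dF l) (dF_anti l) k
  rw [← hc] at hS
  have e1 : rk k (dF l) = ∑ i ∈ Finset.range c, (dF l i - k) := by
    rw [← hS, rk, Finsupp.sum, Finset.sum_filter]
    refine Finset.sum_congr rfl fun i _ => ?_
    split_ifs <;> omega
  have e2 : ∑ i ∈ Finset.range c, dF l i = rk k (dF l) + c * k := by
    rw [e1]
    have : c * k = ∑ i ∈ Finset.range c, k := by simp
    rw [this, ← Finset.sum_add_distrib]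
    refine Finset.sum_congr rfl fun i hi => ?_
    rw [← hS, Finset.mem_filter] at hi
    omega
  have e3 := h3 c
  have e4 : ∑ i ∈ Finset.range c, dF m i ≤ rk k (dF m) + c * k := by
    have h1 := sum_range_sub_le_rk (dF m) c k
    have : c * k = ∑ i ∈ Finset.range c, k := by simp
    calc _ ≤ ∑ i ∈ Finset.range c, ((dF m i - k) + k) :=
          Finset.sum_le_sum fun i _ => by omega
      _ = ∑ i ∈ Finset.range c, (dF m i - k) + c * k := by
          rw [Finset.sum_add_distrib, this]
      _ ≤ _ := by omega
  have e5 : l.cumul c = ∑ i ∈ Finset.range c, dF l i := rfl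
  have e6 : m.cumul c = ∑ i ∈ Finset.range c, dF m i := rfl
  omega

lemma msym_dF (k l : Partn) : MvPowerSeries.coeff (dF l) (msym k) = if l = k then (1 : ℂ) else 0 := by
  have hval : ∀ k : Partn, k.parts_finite.toFinset.val.map k.parts =
      (Finset.range k.len).val.map (fun i => k.parts (i + 1)) := by
    intro k
    have : k.parts_finite.toFinset = (Finset.range k.len).map ⟨fun i => i + 1, add_left_injective 1⟩ := by
      ext i
      rw [Set.Finite.mem_toFinset, k.supp_eq, Finset.mem_coe, Finset.mem_Icc, Finset.mem_map]
      constructor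
      · intro h; exact ⟨i - 1, Finset.mem_range.2 (by omega), by simp; omega⟩
      · rintro ⟨j, hj, rfl⟩
        have := Finset.mem_range.1 hj
        simp; omega
    rw [this, Finset.map_val, Multiset.map_map]
    rfl
  have hl : (dF l).support.val.map (fun i => dF l i) =
      (Finset.range l.len).val.map (fun i => l.parts (i + 1)) := by
    rw [dF_support]; rfl
  show (if _ then (1 : ℂ) else 0) = _
  rw [hl, hval k]
  congr 1
  apply propext
  constructor
  · intro h
    apply rk_inj
    intro j
    have h2 := congrArg (fun M => (M.map (fun x => x - j)).sum) h
    simp only [Multiset.map_map] at h2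
    unfold rk Finsupp.sum
    rw [dF_support, dF_support]
    exact h2
  · rintro rfl; rfl

lemma pm_surj (m : ℕ →₀ ℕ) : ∃ l : Partn, pm l = m := by
  set M : Multiset ℕ := (Finsupp.toMultiset m).map (· + 1) with hM
  set L := M.sort (· ≥ ·) with hL
  have hLM : (L : Multiset ℕ) = M := Multiset.sort_eq _ _
  have hsorted : L.Pairwise (· ≥ ·) := Multiset.pairwise_sort _ _
  have hpos : ∀ x ∈ L, x ≠ 0 := by
    intro x hx
    rw [hL, Multiset.mem_sort, hM, Multiset.mem_map] at hx
    obtain ⟨y, _, rfl⟩ := hx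
    simp
  have hgd : ∀ i (h : i < L.length), L.getD i 0 = L[i] := fun i h => by simp [h]
  have hgd0 : ∀ i, L.length ≤ i → L.getD i 0 = 0 := fun i h => by simp [h]
  let l : Partn :=
    { parts := fun i => if i = 0 then 0 else L.getD (i - 1) 0
      parts_zero := by simp
      parts_antitone := by
        intro i j hi hij
        have hi0 : i ≠ 0 := by omega
        have hj0 : j ≠ 0 := by omega
        simp only [hi0, hj0, if_false]
        by_cases hj : j - 1 < L.length
        · rw [hgd _ hj, hgd (i - 1) (by omega)]
          rcases Nat.eq_or_lt_of_le hij with h | h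
          · subst h; exact le_rfl
          · exact List.pairwise_iff_getElem.1 hsorted (i - 1) (j - 1) (by omega) hj (by omega)
        · rw [hgd0 _ (by omega)]; exact Nat.zero_le _
      parts_finite := by
        refine (Set.finite_Iic L.length).subset ?_
        intro i hi
        rw [Set.mem_Iic]
        by_contra h
        apply hi
        have : i ≠ 0 := by omega
        simp only [this, if_false]
        exact hgd0 _ (by omega) }
  have hparts : ∀ i, l.parts (i + 1) = L.getD i 0 := fun i => by simp [l]
  have hlen : l.len = L.length := by
    have h1 : ∀ i, i < l.len ↔ i < L.length := by
      intro i
      rw [← l.parts_ne_iff, hparts]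
      constructor
      · intro h; by_contra h'; exact h (hgd0 _ (by omega))
      · intro h; rw [hgd _ h]; exact hpos _ (List.getElem_mem h)
    have a := h1 l.len
    have b := h1 L.length
    omega
  refine ⟨l, ?_⟩
  unfold pm
  rw [hlen]
  have h1 : ∑ i ∈ Finset.range L.length, Finsupp.single (l.parts (i + 1) - 1) 1 =
      (L.map (fun x => Finsupp.single (x - 1) 1)).sum := by
    rw [Finset.sum_range]
    have h2 : L = List.ofFn (fun i : Fin L.length => L[i]) := by simp
    conv_rhs => rw [h2, List.map_ofFn, List.sum_ofFn]
    refine Finset.sum_congr rfl fun i _ => ?_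
    rw [hparts, hgd _ i.2]
    rfl
  rw [h1, ← Multiset.sum_coe, ← Multiset.map_coe, hLM, hM, Multiset.map_map]
  have h3 : ∀ S : Multiset ℕ, (S.map ((fun x => Finsupp.single (x - 1) 1) ∘ (· + 1))).sum =
      Multiset.toFinsupp S := by
    intro S
    induction S using Multiset.induction_on with
    | empty => simp
    | cons a S ih =>
      rw [Multiset.map_cons, Multiset.sum_cons, ih, ← Multiset.singleton_add a S, map_add,
        Multiset.toFinsupp_singleton]
      rfl
  rw [h3]
  simp

/-! #### Cauchy-type identity -/

section cauchy
variable {A : Type*} [CommRing A] [Algebra ℂ A]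

lemma coeff_ppow_mul (k : ℕ) (f : MvPowerSeries ℕ A) (d : ℕ →₀ ℕ) :
    MvPowerSeries.coeff d (MvPowerSeries.map (algebraMap ℂ A) (ppow (k + 1)) * f) =
      ∑ i ∈ d.support, if k < d i then
        MvPowerSeries.coeff (d - Finsupp.single i (k + 1)) f else 0 := by
  rw [MvPowerSeries.coeff_mul, ← Finset.sum_filter]
  have hp : ∀ e : ℕ →₀ ℕ, MvPowerSeries.coeff e (MvPowerSeries.map (algebraMap ℂ A) (ppow (k + 1))) =
      if ∃ i : ℕ, e = Finsupp.single i (k + 1) then 1 else 0 := by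
    intro e
    rw [MvPowerSeries.coeff_map]
    have : MvPowerSeries.coeff e (ppow (k + 1)) =
      if ∃ i : ℕ, e = Finsupp.single i (k + 1) then (1 : ℂ) else 0 := by
      have hh : ppow (k + 1) = fun d => if ∃ i : ℕ, d = Finsupp.single i (k + 1) then 1 else 0 :=
        if_neg (Nat.succ_ne_zero k)
      rw [hh]
      rfl
    rw [this]
    split_ifs <;> simp
  simp only [hp, ite_mul, one_mul, zero_mul]
  rw [← Finset.sum_filter]
  symm
  refine Finset.sum_nbij (fun i => (Finsupp.single i (k + 1), d - Finsupp.single i (k + 1)))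
    ?_ ?_ ?_ ?_
  · intro i hi
    rw [Finset.mem_filter] at hi
    rw [Finset.mem_filter, Finset.HasAntidiagonal.mem_antidiagonal]
    refine ⟨?_, i, rfl⟩
    apply add_tsub_cancel_of_le
    rw [Finsupp.single_le_iff]
    omega
  · intro i _ j _ h
    have := (Prod.ext_iff.1 h).1
    rw [Finsupp.single_left_inj (by omega)] at this
    exact this
  · rintro ⟨a, b⟩ h
    rw [Finset.mem_coe, Finset.mem_filter, Finset.HasAntidiagonal.mem_antidiagonal] at h
    obtain ⟨h1, i, hi⟩ := h
    simp only at h1 hi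
    subst hi
    refine ⟨i, ?_, ?_⟩
    · rw [Finset.mem_coe, Finset.mem_filter, Finsupp.mem_support_iff, ← h1]
      simp
      omega
    · simp only [← h1, add_tsub_cancel_left]
  · intro i _; rfl

def Yn (a : ℕ → A) (n : ℕ) : MvPowerSeries ℕ A :=
  fun d => if (d.sum fun _ e => e) = n then d.prod fun _ e => En a e else 0

lemma coeff_Yn (a : ℕ → A) (n : ℕ) (d : ℕ →₀ ℕ) : MvPowerSeries.coeff d (Yn a n) =
    if (d.sum fun _ e => e) = n then d.prod fun _ e => En a e else 0 := rfl

lemma prod_on (a : ℕ → A) (d : ℕ →₀ ℕ) (T : Finset ℕ) (h : d.support ⊆ T) :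
    (d.prod fun _ e => En a e) = ∏ i ∈ T, En a (d i) :=
  Finsupp.prod_of_support_subset _ h _ (fun i _ => En_zero_right a)

lemma Yn_rec (a : ℕ → A) (n : ℕ) :
    ((n : ℂ) + 1) • Yn a (n + 1) = ∑ k ∈ Finset.range (n + 1),
      (MvPowerSeries.C (a k) * MvPowerSeries.map (algebraMap ℂ A) (ppow (k + 1))) *
        Yn a (n - k) := by
  ext d
  rw [map_sum]
  simp only [mul_assoc, MvPowerSeries.coeff_C_mul, coeff_ppow_mul]
  have hd : ∀ i ∈ d.support, ∀ k, k ≤ n → k < d i →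
      MvPowerSeries.coeff (d - Finsupp.single i (k + 1)) (Yn a (n - k)) =
      if (d.sum fun _ e => e) = n + 1 then
        En a (d i - 1 - k) * ∏ j ∈ d.support.erase i, En a (d j) else 0 := by
    intro i hi k hkn hk
    have h1 : d = (d - Finsupp.single i (k + 1)) + Finsupp.single i (k + 1) := by
      rw [tsub_add_cancel_of_le]
      rw [Finsupp.single_le_iff]; omega
    have h2 : (d.sum fun _ e => e) =
        ((d - Finsupp.single i (k + 1)).sum fun _ e => e) + (k + 1) := by
      conv_lhs => rw [h1]
      rw [Finsupp.sum_add_index' (by simp) (by simp), Finsupp.sum_single_index rfl]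
    rw [coeff_Yn]
    have hle : d i ≤ d.sum fun _ e => e :=
      Finset.single_le_sum (f := fun i => d i) (fun _ _ => Nat.zero_le _) hi
    by_cases hn : (d.sum fun _ e => e) = n + 1
    · rw [if_pos hn, if_pos (by omega)]
      rw [prod_on a _ d.support (Finsupp.support_tsub), ← Finset.mul_prod_erase _ _ hi]
      congr 1
      · simp; congr 1; omega
      · refine Finset.prod_congr rfl fun j hj => ?_
        have : j ≠ i := Finset.ne_of_mem_erase hj
        simp [Finsupp.single_apply, this.symm]
    · rw [if_neg hn, if_neg (by omega)]
  have hL : MvPowerSeries.coeff d (((n : ℂ) + 1) • Yn a (n + 1)) =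
      ((n : ℂ) + 1) • MvPowerSeries.coeff d (Yn a (n + 1)) := rfl
  rw [hL]
  have h3 : ∀ k ∈ Finset.range (n + 1), a k * (∑ i ∈ d.support, if k < d i then
      MvPowerSeries.coeff (d - Finsupp.single i (k + 1)) (Yn a (n - k)) else 0) =
      a k * ∑ i ∈ d.support, if k < d i then
        (if (d.sum fun _ e => e) = n + 1 then
        En a (d i - 1 - k) * ∏ j ∈ d.support.erase i, En a (d j) else 0) else 0 := by
    intro k hk
    have hkn : k ≤ n := by rw [Finset.mem_range] at hk; omega
    congr 1
    refine Finset.sum_congr rfl fun i hi => ?_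
    split_ifs with h h'
    · rw [hd i hi k hkn h, if_pos h']
    · rw [hd i hi k hkn h, if_neg h']
    · rfl
  rw [Finset.sum_congr rfl h3]
  rw [coeff_Yn]
  by_cases hn : (d.sum fun _ e => e) = n + 1
  · simp only [if_pos hn]
    simp only [Finset.mul_sum]
    rw [Finset.sum_comm]
    have h4 : ∀ i ∈ d.support, ∑ k ∈ Finset.range (n + 1), a k * (if k < d i then
        En a (d i - 1 - k) * ∏ j ∈ d.support.erase i, En a (d j) else 0) =
        (d i : ℂ) • d.prod fun _ e => En a e := by
      intro i hi
      have hle : d i ≤ d.sum fun _ e => e :=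
        Finset.single_le_sum (f := fun i => d i) (fun _ _ => Nat.zero_le _) hi
      have hne := Finsupp.mem_support_iff.1 hi
      obtain ⟨e, he⟩ : ∃ e, d i = e + 1 := ⟨d i - 1, by omega⟩
      rw [prod_on a d d.support subset_rfl, ← Finset.mul_prod_erase _ _ hi, ← smul_mul_assoc, he]
      have := En_rec a e
      push_cast
      rw [this, Finset.sum_mul]
      simp only [mul_ite, mul_zero]
      rw [← Finset.sum_filter]
      have : (Finset.range (n + 1)).filter (fun k => k < e + 1) = Finset.range (e + 1) := by
        ext k; simp; omega
      rw [this]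
      refine Finset.sum_congr rfl fun k _ => ?_
      rw [mul_assoc]
    rw [Finset.sum_congr rfl h4, ← Finset.sum_smul]
    congr 1
    have : ((d.sum fun _ e => e : ℕ) : ℂ) = (n : ℂ) + 1 := by rw [hn]; push_cast; rfl
    rw [← this, Finsupp.sum]; push_cast; rfl
  · simp [if_neg hn]

lemma mono_mul (a b : ℕ → A) (m : ℕ →₀ ℕ) :
    mono (fun k => a k * b k) m = mono a m * mono b m := by
  unfold mono
  simp only [mul_pow]
  exact Finsupp.prod_mul

lemma mono_map {B : Type*} [CommRing B] (f : A →+* B) (a : ℕ → A) (m : ℕ →₀ ℕ) :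
    f (mono a m) = mono (fun k => f (a k)) m := by
  unfold mono Finsupp.prod
  simp

lemma cauchy (a : ℕ → A) (n : ℕ) (d : ℕ →₀ ℕ) :
    ∑ m ∈ PF n, ((zm m)⁻¹ * MvPowerSeries.coeff d (mono (fun k => ppow (k + 1)) m)) • mono a m =
      if (d.sum fun _ e => e) = n then d.prod fun _ e => En a e else 0 := by
  have h := En_unique (fun k => MvPowerSeries.C (a k) *
    MvPowerSeries.map (algebraMap ℂ A) (ppow (k + 1))) (Yn a) ?_ (Yn_rec a) n
  · rw [← coeff_Yn, h, En, map_sum]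
    refine Finset.sum_congr rfl fun m _ => ?_
    rw [mono_mul, ← mono_map, ← mono_map]
    have : ∀ (c : ℂ) (f : MvPowerSeries ℕ A), MvPowerSeries.coeff d (c • f) =
      c • MvPowerSeries.coeff d f := fun _ _ => rfl
    rw [this, MvPowerSeries.coeff_C_mul, MvPowerSeries.coeff_map, mul_smul,
      Algebra.smul_def (MvPowerSeries.coeff d _) (mono a m), mul_comm (mono a m)]
  · ext d
    rw [coeff_Yn, MvPowerSeries.coeff_one]
    by_cases hd : d = 0
    · subst hd; simp
    · rw [if_neg hd, if_neg]
      intro h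
      apply hd
      ext i
      by_contra hi
      have := Finset.single_le_sum (f := fun i => d i) (fun _ _ => Nat.zero_le _)
        (Finsupp.mem_support_iff.2 hi)
      rw [Finsupp.sum] at h
      apply hi
      show d i = 0
      omega

end cauchy

/-! #### Gaussian binomials and subspace counts -/

def gs (q : ℂ) : ℕ → ℕ → ℂ
  | _, 0 => 1
  | 0, _ + 1 => 0
  | d + 1, k + 1 => gs q d k + q ^ (k + 1) * gs q d (k + 1)

lemma gs_zero (q : ℂ) (d : ℕ) : gs q d 0 = 1 := by cases d <;> rfl

lemma gs_gt (q : ℂ) : ∀ d k : ℕ, d < k → gs q d k = 0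
  | 0, 0, h => by omega
  | 0, k + 1, h => rfl
  | d + 1, 0, h => by omega
  | d + 1, k + 1, h => by
    rw [gs, gs_gt q d k (by omega), gs_gt q d (k + 1) (by omega)]; simp

lemma gs_self (q : ℂ) : ∀ d : ℕ, gs q d d = 1
  | 0 => rfl
  | d + 1 => by rw [gs, gs_self q d, gs_gt q d (d + 1) (by omega)]; simp

def phq (q : ℂ) (m : ℕ) : ℂ := ∏ i ∈ Finset.range m, (q ^ (i + 1) - 1)

lemma phq_succ (q : ℂ) (m : ℕ) : phq q (m + 1) = phq q m * (q ^ (m + 1) - 1) := by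
  rw [phq, Finset.prod_range_succ]; rfl

lemma gs_phq (q : ℂ) : ∀ s a b : ℕ, a + b = s → gs q (a + b) a * phq q a * phq q b = phq q (a + b)
  | s, 0, b, h => by rw [gs_zero]; simp [phq]
  | s, a + 1, 0, h => by rw [add_zero, gs_self]; simp [phq]
  | 0, a + 1, b + 1, h => by omega
  | s + 1, a + 1, b + 1, h => by
    have e : a + 1 + (b + 1) = (a + 1 + b) + 1 := by omega
    have h1 := gs_phq q s a (b + 1) (by omega)
    have h2 := gs_phq q s (a + 1) b (by omega)
    have e2 : a + (b + 1) = a + 1 + b := by omega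
    rw [e2] at h1
    rw [e, gs, phq_succ q (a + 1 + b)]
    rw [phq_succ q b] at h1 ⊢
    rw [phq_succ q a] at h2 ⊢
    have e3 : q ^ (a + 1 + b + 1) = q ^ (a + 1) * q ^ (b + 1) := by rw [← pow_add]; rfl
    rw [e3]
    linear_combination (q ^ (a + 1) - 1) * h1 + q ^ (a + 1) * (q ^ (b + 1) - 1) * h2

lemma phq_ne (q : ℕ) (hq : 1 < q) (m : ℕ) : phq (q : ℂ) m ≠ 0 := by
  rw [phq, Finset.prod_ne_zero_iff]
  intro i _
  rw [sub_ne_zero]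
  norm_cast
  exact (Nat.one_lt_pow (by omega) hq).ne'

lemma gs_symm (q : ℕ) (hq : 1 < q) (a b : ℕ) : gs (q : ℂ) (a + b) a = gs (q : ℂ) (a + b) b := by
  have h1 := gs_phq (q : ℂ) _ a b rfl
  have h2 := gs_phq (q : ℂ) _ b a rfl
  rw [add_comm b a] at h2
  rw [← h2] at h1
  have := phq_ne q hq a
  have := phq_ne q hq b
  have h3 : (gs (q : ℂ) (a + b) a - gs (q : ℂ) (a + b) b) * (phq q a * phq q b) = 0 := by
    linear_combination h1
  have h4 := (mul_eq_zero.1 h3).resolve_right (by positivity)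
  linear_combination h4

lemma gs_frame (q : ℂ) : ∀ d k : ℕ, gs q d k * ∏ i ∈ Finset.range k, (q ^ k - q ^ i) =
    ∏ i ∈ Finset.range k, (q ^ d - q ^ i)
  | d, 0 => by simp [gs_zero]
  | 0, k + 1 => by
    rw [gs, zero_mul, Finset.prod_range_succ']
    simp
  | d + 1, k + 1 => by
    have h1 := gs_frame q d k
    have h2 := gs_frame q d (k + 1)
    have key : ∀ e : ℕ, ∏ i ∈ Finset.range (k + 1), (q ^ (e + 1) - q ^ i) =
        q ^ k * (q ^ (e + 1) - 1) * ∏ i ∈ Finset.range k, (q ^ e - q ^ i) := by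
      intro e
      rw [Finset.prod_range_succ']
      have : ∏ i ∈ Finset.range k, (q ^ (e + 1) - q ^ (i + 1)) =
          ∏ i ∈ Finset.range k, (q * (q ^ e - q ^ i)) :=
        Finset.prod_congr rfl fun i _ => by ring
      rw [this, Finset.prod_mul_distrib, Finset.prod_const, Finset.card_range]
      ring
    rw [key d, gs, ← h1]
    have h3 : ∏ i ∈ Finset.range (k + 1), (q ^ d - q ^ i) =
      (∏ i ∈ Finset.range k, (q ^ d - q ^ i)) * (q ^ d - q ^ k) := Finset.prod_range_succ _ _
    rw [h3, ← h1] at h2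
    rw [add_mul, mul_assoc (q ^ (k + 1)), h2, key k]
    ring

lemma qbinom (q : ℂ) : ∀ (d : ℕ) (z : ℂ) (M : ℕ), d ≤ M →
    ∑ k ∈ Finset.range (M + 1), (-z) ^ k * q ^ (k.choose 2) * gs q d k =
      ∏ i ∈ Finset.range d, (1 - z * q ^ i)
  | 0, z, M, h => by
    rw [Finset.sum_range_succ']
    simp [gs]
  | d + 1, z, 0, h => by omega
  | d + 1, z, M + 1, h => by
    have h1 := qbinom q d (z * q) (M + 1) (by omega)
    have h2 := qbinom q d (z * q) M (by omega)
    rw [Finset.sum_range_succ', Finset.prod_range_succ']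
    have e : ∏ i ∈ Finset.range d, (1 - z * q ^ (i + 1)) = ∏ i ∈ Finset.range d, (1 - z * q * q ^ i) :=
      Finset.prod_congr rfl fun i _ => by ring
    rw [e]
    have e2 : ∑ k ∈ Finset.range (M + 1), (-z) ^ (k + 1) * q ^ ((k + 1).choose 2) * gs q (d + 1) (k + 1) =
        (-z) * ∑ k ∈ Finset.range (M + 1), (-(z * q)) ^ k * q ^ (k.choose 2) * gs q d k +
        ∑ k ∈ Finset.range (M + 1), (-(z * q)) ^ (k + 1) * q ^ ((k + 1).choose 2) * gs q d (k + 1) := by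
      rw [Finset.mul_sum, ← Finset.sum_add_distrib]
      refine Finset.sum_congr rfl fun k _ => ?_
      have e3 : (k + 1).choose 2 = k + k.choose 2 := by
        rw [Nat.choose_succ_succ' k 1, Nat.choose_one_right]
      rw [gs, e3]
      have e4 : (-(z * q)) = (-z) * q := by ring
      rw [e4, mul_pow, mul_pow]
      ring
    rw [Finset.sum_range_succ'] at h1
    rw [e2, h2]
    simp only [gs_zero] at h1 ⊢
    rw [← h2] at h1 ⊢
    linear_combination h1

def newt {A : Type*} [CommRing A] [Algebra ℂ A] (Y : ℕ → A) : ℕ → A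
  | n => ((n : ℂ) + 1) • Y (n + 1) - ∑ k : Fin n, newt Y k * Y (n - k)
termination_by n => n
decreasing_by exact k.2

lemma En_exists {A : Type*} [CommRing A] [Algebra ℂ A] (Y : ℕ → A) (h0 : Y 0 = 1) :
    ∃ a : ℕ → A, ∀ n, En a n = Y n := by
  refine ⟨newt Y, fun n => (En_unique (newt Y) Y h0 ?_ n).symm⟩
  intro n
  rw [Finset.sum_range_succ, newt, Finset.sum_range, Nat.sub_self, h0, mul_one]
  ring

lemma finrank_map_ker {F : Type*} [Field F] {V W : Type*} [AddCommGroup V] [Module F V] [Module.Finite F V]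
    [AddCommGroup W] [Module F W] (f : V →ₗ[F] W) (D : Submodule F V) :
    Module.finrank F D = Module.finrank F (D.map f) +
      Module.finrank F (D ⊓ LinearMap.ker f : Submodule F V) := by
  have h := LinearMap.finrank_range_add_finrank_ker (f.domRestrict D)
  rw [LinearMap.range_domRestrict, LinearMap.ker_domRestrict] at h
  rw [← h]
  congr 1
  have := (Submodule.equivMapOfInjective D.subtype D.injective_subtype
    (Submodule.comap D.subtype (LinearMap.ker f))).finrank_eq
  rw [Submodule.map_comap_eq, Submodule.range_subtype] at this
  exact this

section count
variable {F : Type*} [Field F] [Fintype F]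

def cnt {V : Type*} [AddCommGroup V] [Module F V] (L U : Submodule F V) (k : ℕ) : ℕ :=
  Nat.card {C : Submodule F V // L ≤ C ∧ C ≤ U ∧ Module.finrank F C = Module.finrank F L + k}

lemma card_sub (V : Type*) [AddCommGroup V] [Module F V] [Finite V] (k : ℕ) :
    (Nat.card {C : Submodule F V // Module.finrank F C = k} : ℂ) =
      gs (Fintype.card F : ℂ) (Module.finrank F V) k := by
  have hfin : Module.Finite F V := Module.Finite.of_finite
  by_cases hk : k ≤ Module.finrank F V
  · have h1 := card_linearIndependent (K := F) (V := V) hk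
    have e : {s : Fin k → V // LinearIndependent F s} ≃
        Σ C : {C : Submodule F V // Module.finrank F C = k},
          {s : Fin k → C.1 // LinearIndependent F s} :=
      { toFun := fun s => ⟨⟨Submodule.span F (Set.range s.1), by
            rw [finrank_span_eq_card s.2]; simp⟩,
            ⟨fun i => ⟨s.1 i, Submodule.subset_span ⟨i, rfl⟩⟩, by
              have := s.2
              exact LinearIndependent.of_comp (Submodule.subtype _) this⟩⟩
        invFun := fun x => ⟨fun i => (x.2.1 i : V), by
          have := x.2.2
          exact this.map' (Submodule.subtype _) (Submodule.ker_subtype _)⟩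
        left_inv := fun s => rfl
        right_inv := by
          rintro ⟨⟨C, hC⟩, ⟨s, hs⟩⟩
          have hsp : Submodule.span F (Set.range fun i => (s i : V)) = C := by
            have h2 : LinearIndependent F fun i => (s i : V) :=
              hs.map' (Submodule.subtype _) (Submodule.ker_subtype _)
            refine Submodule.eq_of_le_of_finrank_eq ?_ ?_
            · rw [Submodule.span_le]; rintro _ ⟨i, rfl⟩; exact (s i).2
            · rw [finrank_span_eq_card h2, hC]; simp
          have gen : ∀ (X Y : {C : Submodule F V // Module.finrank F C = k})
              (s : {s : Fin k → X.1 // LinearIndependent F s})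
              (s' : {s : Fin k → Y.1 // LinearIndependent F s}), X.1 = Y.1 →
              (∀ i, (s.1 i : V) = s'.1 i) →
              (⟨X, s⟩ : Σ C : {C : Submodule F V // Module.finrank F C = k},
                {s : Fin k → C.1 // LinearIndependent F s}) = ⟨Y, s'⟩ := by
            intro X Y s s' h1 h2
            have h1 : X = Y := Subtype.ext h1
            subst h1
            congr 1
            apply Subtype.ext
            funext i
            exact Subtype.ext (h2 i)
          exact gen _ _ _ _ hsp (fun i => rfl) }
    have : Fintype {C : Submodule F V // Module.finrank F C = k} := Fintype.ofFinite _
    have h2 := Nat.card_congr e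
    rw [Nat.card_sigma] at h2
    have h3 : ∀ C : {C : Submodule F V // Module.finrank F C = k},
        Nat.card {s : Fin k → C.1 // LinearIndependent F s} =
          ∏ i : Fin k, (Fintype.card F ^ k - Fintype.card F ^ i.val) := by
      intro C
      have := card_linearIndependent (K := F) (V := C.1) (k := k) (by rw [C.2])
      rw [this, C.2]
    rw [h1, Finset.sum_congr rfl (fun C _ => h3 C), Finset.sum_const, Finset.card_univ,
      ← Nat.card_eq_fintype_card (α := {C : Submodule F V // Module.finrank F C = k}),
      smul_eq_mul] at h2
    have hq : 1 < Fintype.card F := Fintype.one_lt_card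
    have hcast : ∀ d, k ≤ d → ((∏ i : Fin k, (Fintype.card F ^ d - Fintype.card F ^ i.val) : ℕ) : ℂ) =
        ∏ i ∈ Finset.range k, ((Fintype.card F : ℂ) ^ d - (Fintype.card F : ℂ) ^ i) := by
      intro d hd
      rw [Finset.prod_range]
      push_cast
      refine Finset.prod_congr rfl fun i _ => ?_
      rw [Nat.cast_sub (Nat.pow_le_pow_right (by omega) (by omega))]
      push_cast; rfl
    have h4 := congrArg (fun x : ℕ => (x : ℂ)) h2
    simp only [Nat.cast_mul] at h4
    rw [hcast _ hk, hcast _ le_rfl] at h4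
    have h5 := gs_frame (Fintype.card F : ℂ) (Module.finrank F V) k
    rw [h4] at h5
    refine (mul_right_cancel₀ ?_ h5).symm
    rw [Finset.prod_ne_zero_iff]
    intro i hi
    rw [sub_ne_zero]
    norm_cast
    exact (Nat.pow_lt_pow_right hq (Finset.mem_range.1 hi)).ne'
  · rw [gs_gt _ _ _ (by omega)]
    have : IsEmpty {C : Submodule F V // Module.finrank F C = k} := by
      constructor
      rintro ⟨C, hC⟩
      have := Submodule.finrank_le C
      omega
    simp

lemma card_cnt {V : Type*} [AddCommGroup V] [Module F V] [Finite V] (L U : Submodule F V)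
    (h : L ≤ U) (k : ℕ) :
    (cnt L U k : ℂ) = gs (Fintype.card F : ℂ) (Module.finrank F U - Module.finrank F L) k := by
  have hfin : Module.Finite F V := Module.Finite.of_finite
  have hfinU : Finite U := inferInstance
  set L' : Submodule F U := L.comap U.subtype with hL'
  have hmap : L'.map U.subtype = L := by
    rw [hL', Submodule.map_comap_eq, Submodule.range_subtype]; exact inf_eq_right.2 h
  have hfr : ∀ E : Submodule F U, Module.finrank F (E.map U.subtype) = Module.finrank F E := fun E =>
    (Submodule.equivMapOfInjective U.subtype U.injective_subtype E).finrank_eq.symm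
  have hrL : Module.finrank F L' = Module.finrank F L := by rw [← hfr L', hmap]
  have hq := Submodule.finrank_quotient_add_finrank L'
  have hd : Module.finrank F (U ⧸ L') = Module.finrank F U - Module.finrank F L := by omega
  have : Finite (U ⧸ L') := Finite.of_surjective _ (Submodule.mkQ_surjective L')
  rw [← hd, ← card_sub (F := F) (U ⧸ L') k, cnt]
  congr 1
  refine Nat.card_congr ?_
  have hrq : ∀ E : Submodule F (U ⧸ L'), Module.finrank F (E.comap L'.mkQ) =
      Module.finrank F E + Module.finrank F L := by
    intro E
    rw [finrank_map_ker L'.mkQ, Submodule.map_comap_eq_of_surjective (Submodule.mkQ_surjective L'),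
      Submodule.ker_mkQ, ← hrL, inf_eq_right.2]
    intro x hx
    rw [Submodule.mem_comap, (Submodule.Quotient.mk_eq_zero L').2 hx |> fun h => show L'.mkQ x = 0 from h]
    exact zero_mem _
  refine
    { toFun := fun C => ⟨(C.1.comap U.subtype).map L'.mkQ, ?_⟩
      invFun := fun E => ⟨(E.1.comap L'.mkQ).map U.subtype, ?_, ?_, ?_⟩
      left_inv := ?_
      right_inv := ?_ }
  · have h1 := hrq ((C.1.comap U.subtype).map L'.mkQ)
    rw [Submodule.comap_map_mkQ, sup_eq_right.2 (Submodule.comap_mono C.2.1), ← hfr,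
      Submodule.map_comap_eq, Submodule.range_subtype, inf_eq_right.2 C.2.2.1, C.2.2.2] at h1
    omega
  · rw [← hmap]
    apply Submodule.map_mono
    intro x hx
    rw [Submodule.mem_comap, (Submodule.Quotient.mk_eq_zero L').2 hx |> fun h => show L'.mkQ x = 0 from h]
    exact zero_mem _
  · exact Submodule.map_subtype_le U _
  · rw [hfr, hrq, E.2, add_comm]
  · intro C
    apply Subtype.ext
    show ((((C.1.comap U.subtype).map L'.mkQ)).comap L'.mkQ).map U.subtype = C.1
    rw [Submodule.comap_map_mkQ, sup_eq_right.2 (Submodule.comap_mono C.2.1),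
      Submodule.map_comap_eq, Submodule.range_subtype, inf_eq_right.2 C.2.2.1]
  · intro E
    apply Subtype.ext
    show ((((E.1.comap L'.mkQ).map U.subtype)).comap U.subtype).map L'.mkQ = E.1
    rw [Submodule.comap_map_eq_of_injective U.injective_subtype,
      Submodule.map_comap_eq_of_surjective (Submodule.mkQ_surjective L')]

end count

/-! #### Hecke type operators on the lattice of stable subspaces -/

section hecke
variable {F : Type*} [Field F] [Fintype F] {V : Type*} [AddCommGroup V] [Module F V] [Finite V]

abbrev St (N : Module.End F V) : Type _ := {A : Submodule F V // A ≤ A.comap N}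

instance fintypeSt (N : Module.End F V) : Fintype (St N) := Fintype.ofFinite _

abbrev fr (A : Submodule F V) : ℕ := Module.finrank F A

def eps (N : Module.End F V) (k : ℕ) : Matrix (St N) (St N) ℂ := fun A B =>
  if A.1 ≤ B.1 ∧ B.1 ≤ A.1.comap N ∧ fr B.1 = fr A.1 + k then
    (Fintype.card F : ℂ) ^ (k.choose 2) else 0

def zet (N : Module.End F V) (k : ℕ) : Matrix (St N) (St N) ℂ := fun A B =>
  if A.1 ≤ B.1 ∧ fr B.1 = fr A.1 + k then 1 else 0

instance finV : Module.Finite F V := Module.Finite.of_finite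

lemma fr_mono {A B : Submodule F V} (h : A ≤ B) : fr A ≤ fr B := Submodule.finrank_mono h

lemma eq_of_fr {A B : Submodule F V} (h : A ≤ B) (h2 : fr B ≤ fr A) : A = B :=
  Submodule.eq_of_le_of_finrank_le h h2

lemma dimlem (N : Module.End F V) (A B : Submodule F V) :
    fr B + fr A = fr (B.map N ⊔ A) + fr (B ⊓ A.comap N) := by
  have h1 := finrank_map_ker (A.mkQ ∘ₗ N) B
  have h2 := finrank_map_ker A.mkQ (B.map N ⊔ A)
  rw [LinearMap.ker_comp, Submodule.ker_mkQ, Submodule.map_comp] at h1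
  rw [Submodule.ker_mkQ, Submodule.map_sup, inf_eq_right.2 le_sup_right,
    Submodule.mkQ_map_self, sup_bot_eq] at h2
  unfold fr
  rw [h1, h2]
  ring

lemma ite_mul_ite (P Q : Prop) [Decidable P] [Decidable Q] [Decidable (P ∧ Q)] (a b : ℂ) :
    (if P then a else 0) * (if Q then b else 0) = if P ∧ Q then a * b else 0 := by
  by_cases hP : P <;> by_cases hQ : Q <;> simp [hP, hQ]

lemma eps_zero (N : Module.End F V) : eps N 0 = 1 := by
  ext A B
  rw [eps, Matrix.one_apply]
  by_cases h : A = B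
  · subst h
    rw [if_pos rfl, if_pos ⟨le_rfl, A.2, rfl⟩]; simp
  · rw [if_neg h, if_neg]
    rintro ⟨h1, _, h3⟩
    exact h (Subtype.ext (eq_of_fr h1 (by omega)))

lemma zet_zero (N : Module.End F V) : zet N 0 = 1 := by
  ext A B
  rw [zet, Matrix.one_apply]
  by_cases h : A = B
  · subst h
    rw [if_pos rfl, if_pos ⟨le_rfl, rfl⟩]
  · rw [if_neg h, if_neg]
    rintro ⟨h1, h3⟩
    exact h (Subtype.ext (eq_of_fr h1 (by omega)))

lemma sum_St (N : Module.End F V) (p : Submodule F V → Prop) [DecidablePred p] (hp : ∀ C, p C → C ≤ C.comap N) (c : ℂ) :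
    ∑ C : St N, (if p C.1 then c else 0) = c * Nat.card {C : Submodule F V // p C} := by
  rw [← Finset.sum_filter, Finset.sum_const, nsmul_eq_mul, mul_comm]
  congr 2
  rw [← Fintype.card_subtype, ← Nat.card_eq_fintype_card]
  refine Nat.card_congr ?_
  exact
    { toFun := fun C => ⟨C.1.1, C.2⟩
      invFun := fun C => ⟨⟨C.1, hp _ C.2⟩, C.2⟩
      left_inv := fun C => rfl
      right_inv := fun C => rfl }

lemma eps_mul_apply (N : Module.End F V) (j k : ℕ) (A B : St N) :
    (eps N j * eps N k) A B =
      if A.1 ≤ B.1 ∧ fr B.1 = fr A.1 + (j + k) ∧ B.1.map N ⊔ A.1 ≤ B.1 ⊓ A.1.comap N then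
        (Fintype.card F : ℂ) ^ (j.choose 2 + k.choose 2) *
          Nat.card {C : Submodule F V // B.1.map N ⊔ A.1 ≤ C ∧ C ≤ B.1 ⊓ A.1.comap N ∧
            fr C = fr A.1 + j}
      else 0 := by
  rw [Matrix.mul_apply]
  have key : ∀ C : St N, eps N j A C * eps N k C B =
      if (A.1 ≤ C.1 ∧ C.1 ≤ A.1.comap N ∧ fr C.1 = fr A.1 + j) ∧
        (C.1 ≤ B.1 ∧ B.1 ≤ C.1.comap N ∧ fr B.1 = fr C.1 + k) then
        (Fintype.card F : ℂ) ^ (j.choose 2 + k.choose 2) else 0 := by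
    intro C
    rw [eps, eps, ite_mul_ite, pow_add]
  simp only [key]
  rw [sum_St N (fun C => (A.1 ≤ C ∧ C ≤ A.1.comap N ∧ fr C = fr A.1 + j) ∧
        (C ≤ B.1 ∧ B.1 ≤ C.comap N ∧ fr B.1 = fr C + k))]
  · by_cases h : A.1 ≤ B.1 ∧ fr B.1 = fr A.1 + (j + k) ∧ B.1.map N ⊔ A.1 ≤ B.1 ⊓ A.1.comap N
    · rw [if_pos h]
      congr 2
      refine Nat.card_congr (Equiv.subtypeEquivRight fun C => ?_)
      rw [sup_le_iff, le_inf_iff, Submodule.map_le_iff_le_comap]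
      constructor
      · rintro ⟨⟨h1, h2, h3⟩, h4, h5, h6⟩; exact ⟨⟨h5, h1⟩, ⟨h4, h2⟩, h3⟩
      · rintro ⟨⟨h5, h1⟩, ⟨h4, h2⟩, h3⟩
        exact ⟨⟨h1, h2, h3⟩, h4, h5, by omega⟩
    · rw [if_neg h]
      have : IsEmpty {C : Submodule F V // (A.1 ≤ C ∧ C ≤ A.1.comap N ∧ fr C = fr A.1 + j) ∧
        (C ≤ B.1 ∧ B.1 ≤ C.comap N ∧ fr B.1 = fr C + k)} := by
        constructor
        rintro ⟨C, ⟨h1, h2, h3⟩, h4, h5, h6⟩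
        apply h
        refine ⟨h1.trans h4, by omega, ?_⟩
        rw [← Submodule.map_le_iff_le_comap] at h5
        exact (sup_le h5 h1).trans (le_inf h4 h2)
      simp
  · rintro C ⟨⟨h1, h2, h3⟩, h4, h5, h6⟩
    exact h2.trans (Submodule.comap_mono h1)

lemma eps_comm (N : Module.End F V) (j k : ℕ) : eps N j * eps N k = eps N k * eps N j := by
  ext A B
  rw [eps_mul_apply, eps_mul_apply, add_comm k j, add_comm (k.choose 2)]
  by_cases h : A.1 ≤ B.1 ∧ fr B.1 = fr A.1 + (j + k) ∧ B.1.map N ⊔ A.1 ≤ B.1 ⊓ A.1.comap N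
  · rw [if_pos h, if_pos h]
    congr 1
    obtain ⟨h1, h2, h3⟩ := h
    set L := B.1.map N ⊔ A.1
    set U := B.1 ⊓ A.1.comap N
    have hdim : fr B.1 + fr A.1 = fr L + fr U := dimlem N A.1 B.1
    have hLU := fr_mono h3
    have hAL : fr A.1 ≤ fr L := fr_mono le_sup_right
    have c1 : ∀ j, fr A.1 + j < fr L → Nat.card {C : Submodule F V // L ≤ C ∧ C ≤ U ∧
        fr C = fr A.1 + j} = 0 := by
      intro j hj
      have : IsEmpty {C : Submodule F V // L ≤ C ∧ C ≤ U ∧ fr C = fr A.1 + j} := by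
        constructor
        rintro ⟨C, h1, h2, h3⟩
        have := fr_mono h1
        omega
      simp
    have c3 : ∀ j, fr U < fr A.1 + j → Nat.card {C : Submodule F V // L ≤ C ∧ C ≤ U ∧
        fr C = fr A.1 + j} = 0 := by
      intro j hj
      have : IsEmpty {C : Submodule F V // L ≤ C ∧ C ≤ U ∧ fr C = fr A.1 + j} := by
        constructor
        rintro ⟨C, h1, h2, h3⟩
        have := fr_mono h2
        omega
      simp
    have c2 : ∀ j, fr L ≤ fr A.1 + j → (Nat.card {C : Submodule F V // L ≤ C ∧ C ≤ U ∧
        fr C = fr A.1 + j} : ℂ) = gs (Fintype.card F : ℂ) (fr U - fr L) (fr A.1 + j - fr L) := by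
      intro j hj
      rw [← card_cnt L U h3, cnt]
      have e : Module.finrank F L + (fr A.1 + j - fr L) = fr A.1 + j := by
        show fr L + _ = _
        omega
      rw [e]
    by_cases hj : fr L ≤ fr A.1 + j
    · by_cases hk : fr L ≤ fr A.1 + k
      · rw [c2 j hj, c2 k hk]
        have e : fr U - fr L = (fr A.1 + j - fr L) + (fr A.1 + k - fr L) := by omega
        rw [e]
        exact gs_symm _ Fintype.one_lt_card _ _
      · rw [c1 k (by omega), c3 j (by omega)]
    · rw [c1 j (by omega), c3 k (by omega)]
  · rw [if_neg h, if_neg h]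

lemma eps_zet_apply (N : Module.End F V) (j k : ℕ) (A B : St N) :
    (eps N j * zet N k) A B =
      if A.1 ≤ B.1 ∧ fr B.1 = fr A.1 + (j + k) then
        (Fintype.card F : ℂ) ^ (j.choose 2) *
          gs (Fintype.card F : ℂ) (fr (B.1 ⊓ A.1.comap N) - fr A.1) j
      else 0 := by
  rw [Matrix.mul_apply]
  have key : ∀ C : St N, eps N j A C * zet N k C B =
      if (A.1 ≤ C.1 ∧ C.1 ≤ A.1.comap N ∧ fr C.1 = fr A.1 + j) ∧
        (C.1 ≤ B.1 ∧ fr B.1 = fr C.1 + k) then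
        (Fintype.card F : ℂ) ^ (j.choose 2) else 0 := by
    intro C
    rw [eps, zet, ite_mul_ite, mul_one]
  simp only [key]
  rw [sum_St N (fun C => (A.1 ≤ C ∧ C ≤ A.1.comap N ∧ fr C = fr A.1 + j) ∧
        (C ≤ B.1 ∧ fr B.1 = fr C + k))]
  · by_cases h : A.1 ≤ B.1 ∧ fr B.1 = fr A.1 + (j + k)
    · rw [if_pos h]
      have hle : A.1 ≤ B.1 ⊓ A.1.comap N := le_inf h.1 A.2
      have := card_cnt A.1 (B.1 ⊓ A.1.comap N) hle j
      show _ = _ * gs (Fintype.card F : ℂ)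
        (Module.finrank F (B.1 ⊓ A.1.comap N : Submodule F V) - Module.finrank F A.1) j
      rw [← this, cnt]
      congr 2
      refine Nat.card_congr (Equiv.subtypeEquivRight fun C => ?_)
      rw [le_inf_iff]
      constructor
      · rintro ⟨⟨h1, h2, h3⟩, h4, h6⟩; exact ⟨h1, ⟨h4, h2⟩, h3⟩
      · rintro ⟨h1, ⟨h4, h2⟩, h3⟩
        have h3 : fr C = fr A.1 + j := h3
        exact ⟨⟨h1, h2, h3⟩, h4, by omega⟩
    · rw [if_neg h]
      have : IsEmpty {C : Submodule F V // (A.1 ≤ C ∧ C ≤ A.1.comap N ∧ fr C = fr A.1 + j) ∧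
        (C ≤ B.1 ∧ fr B.1 = fr C + k)} := by
        constructor
        rintro ⟨C, ⟨h1, h2, h3⟩, h4, h6⟩
        exact h ⟨h1.trans h4, by omega⟩
      simp
  · rintro C ⟨⟨h1, h2, h3⟩, h4, h6⟩
    exact h2.trans (Submodule.comap_mono h1)

lemma eps_zet_sum (N : Module.End F V) (z : ℂ) (r : ℕ) (A B : St N) :
    (∑ ij ∈ Finset.HasAntidiagonal.antidiagonal r, (-z) ^ ij.1 • (eps N ij.1 * zet N ij.2)) A B =
      if A.1 ≤ B.1 ∧ fr B.1 = fr A.1 + r then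
        ∏ i ∈ Finset.range (fr (B.1 ⊓ A.1.comap N) - fr A.1), (1 - z * (Fintype.card F : ℂ) ^ i)
      else 0 := by
  rw [Matrix.sum_apply]
  have key : ∀ ij ∈ Finset.HasAntidiagonal.antidiagonal r,
      ((-z) ^ ij.1 • (eps N ij.1 * zet N ij.2)) A B =
      if A.1 ≤ B.1 ∧ fr B.1 = fr A.1 + r then
        (-z) ^ ij.1 * (Fintype.card F : ℂ) ^ (ij.1.choose 2) *
          gs (Fintype.card F : ℂ) (fr (B.1 ⊓ A.1.comap N) - fr A.1) ij.1 else 0 := by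
    intro ij hij
    rw [Finset.HasAntidiagonal.mem_antidiagonal] at hij
    rw [Matrix.smul_apply, eps_zet_apply, hij]
    split_ifs
    · rw [smul_eq_mul]; ring
    · simp
  rw [Finset.sum_congr rfl key]
  split_ifs with h
  · rw [Finset.Nat.sum_antidiagonal_eq_sum_range_succ_mk]
    refine qbinom _ _ _ _ ?_
    have := fr_mono (inf_le_left : B.1 ⊓ A.1.comap N ≤ B.1)
    omega
  · simp

lemma ker_pos (N : Module.End F V) (hN : IsNilpotent N) (A B : St N) (h : A.1 ≤ B.1)
    (hne : fr A.1 < fr B.1) : 0 < fr (B.1 ⊓ A.1.comap N) - fr A.1 := by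
  have hle : A.1 ≤ B.1 ⊓ A.1.comap N := le_inf h A.2
  have h1 := fr_mono hle
  by_contra hcon
  have heq : A.1 = B.1 ⊓ A.1.comap N := eq_of_fr hle (by omega)
  obtain ⟨m, hm⟩ := hN
  have hind : ∀ k, B.1 ⊓ A.1.comap (N ^ k) ≤ A.1 := by
    intro k
    induction k with
    | zero => intro x hx; exact hx.2
    | succ k ih =>
      intro x hx
      have hx1 : N x ∈ A.1 := by
        apply ih
        refine ⟨B.2 hx.1, ?_⟩
        have := Submodule.mem_comap.1 hx.2
        rw [pow_succ] at this
        exact this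
      rw [heq]
      exact ⟨hx.1, hx1⟩
  have : B.1 ≤ A.1 := by
    refine le_trans ?_ (hind m)
    refine le_inf le_rfl ?_
    rw [hm]
    intro x _
    simp
  have := fr_mono this
  omega

abbrev Lam : Type := MvPolynomial ℕ ℂ

def eL (r : ℕ) : Lam := En (fun k => (-1 : ℂ) ^ k • (MvPolynomial.X k : Lam)) r
def hL (r : ℕ) : Lam := En (fun k => (MvPolynomial.X k : Lam)) r

lemma eh_sum (z : ℂ) (r : ℕ) : En (fun k => (1 - z ^ (k + 1)) • (MvPolynomial.X k : Lam)) r =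
    ∑ ij ∈ Finset.HasAntidiagonal.antidiagonal r, (-z) ^ ij.1 • (eL ij.1 * hL ij.2) := by
  have h := En_add (fun k => (-z) ^ (k + 1) • ((-1 : ℂ) ^ k • (MvPolynomial.X k : Lam)))
    (fun k => (MvPolynomial.X k : Lam)) r
  have e : (fun k => (1 - z ^ (k + 1)) • (MvPolynomial.X k : Lam)) =
      (fun k => (-z) ^ (k + 1) • ((-1 : ℂ) ^ k • (MvPolynomial.X k : Lam))) +
    (fun k => (MvPolynomial.X k : Lam)) := by
    funext k
    show _ = (-z) ^ (k + 1) • ((-1 : ℂ) ^ k • (MvPolynomial.X k : Lam)) + (MvPolynomial.X k : Lam)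
    rw [smul_smul, sub_smul, one_smul]
    have : (-z) ^ (k + 1) * (-1) ^ k = - z ^ (k + 1) := by
      rw [neg_pow z, mul_assoc, mul_comm (z ^ (k + 1)), ← mul_assoc, ← pow_add]
      have : (-1 : ℂ) ^ (k + 1 + k) = -1 := by
        rw [show k + 1 + k = 2 * k + 1 by ring, pow_succ, pow_mul]; simp
      rw [this]; ring
    rw [this, neg_smul]; ring
  rw [e]
  refine Eq.trans h ?_
  refine Finset.sum_congr rfl fun ij _ => ?_
  rw [En_scale, smul_mul_assoc]
  rfl

lemma exists_rho (N : Module.End F V) : ∃ ρ : Lam →ₐ[ℂ] Matrix (St N) (St N) ℂ,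
    ∀ k, ρ (eL k) = eps N k := by
  let s : Set (Matrix (St N) (St N) ℂ) := Set.range (eps N)
  have hs : ∀ a ∈ s, ∀ b ∈ s, a * b = b * a := by
    rintro _ ⟨j, rfl⟩ _ ⟨k, rfl⟩
    exact eps_comm N j k
  letI := Algebra.adjoinCommRingOfComm ℂ hs
  obtain ⟨a, ha⟩ := En_exists (A := Algebra.adjoin ℂ s)
    (fun k => ⟨eps N k, Algebra.subset_adjoin ⟨k, rfl⟩⟩) (Subtype.ext (eps_zero N))
  refine ⟨(Algebra.adjoin ℂ s).val.comp
    (MvPolynomial.aeval fun k => (-1 : ℂ) ^ k • a k), fun k => ?_⟩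
  rw [AlgHom.comp_apply, eL, En_map]
  have : (fun k => (MvPolynomial.aeval fun k => (-1 : ℂ) ^ k • a k)
      ((-1 : ℂ) ^ k • (MvPolynomial.X k : Lam))) = a := by
    funext k
    rw [map_smul, MvPolynomial.aeval_X, smul_smul, ← mul_pow]; simp
  rw [this, ha]
  rfl

def rho (N : Module.End F V) : Lam →ₐ[ℂ] Matrix (St N) (St N) ℂ := (exists_rho N).choose
lemma rho_e (N : Module.End F V) (k : ℕ) : rho N (eL k) = eps N k := (exists_rho N).choose_spec k

lemma rho_h (N : Module.End F V) (hN : IsNilpotent N) (n : ℕ) : rho N (hL n) = zet N n := by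
  induction n using Nat.strong_induction_on with
  | _ n ih =>
    rcases Nat.eq_zero_or_pos n with h0 | hpos
    · subst h0
      rw [hL, En_zero_right, map_one, zet_zero]
    · have h1 := eh_sum 1 n
      have e : (fun k => (1 - (1 : ℂ) ^ (k + 1)) • (MvPolynomial.X k : Lam)) = fun _ => 0 := by
        funext k; simp
      rw [e, En_zero, if_neg (by omega)] at h1
      have h2 := congrArg (rho N) h1
      rw [map_zero, map_sum] at h2
      have h3 : ∑ ij ∈ Finset.HasAntidiagonal.antidiagonal n,
          (-(1 : ℂ)) ^ ij.1 • (eps N ij.1 * zet N ij.2) = 0 := by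
        ext A B
        rw [eps_zet_sum]
        split_ifs with h
        · have := ker_pos N hN A B h.1 (by omega)
          obtain ⟨c, hc⟩ : ∃ c, fr (B.1 ⊓ A.1.comap N) - fr A.1 = c + 1 :=
            ⟨_, (Nat.succ_pred_eq_of_pos this).symm⟩
          rw [hc, Finset.prod_range_succ']
          simp
        · rfl
      rw [← h3] at h2
      rw [Finset.Nat.sum_antidiagonal_eq_sum_range_succ_mk,
        Finset.Nat.sum_antidiagonal_eq_sum_range_succ_mk, Finset.sum_range_succ',
        Finset.sum_range_succ'] at h2
      have h4 : ∀ k ∈ Finset.range n, rho N ((-(1 : ℂ)) ^ (k + 1) • (eL (k + 1) * hL (n - (k + 1)))) =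
          (-(1 : ℂ)) ^ (k + 1) • (eps N (k + 1) * zet N (n - (k + 1))) := by
        intro k hk
        rw [Finset.mem_range] at hk
        rw [map_smul, map_mul, rho_e, ih _ (by omega)]
      simp only [] at h2
      rw [Finset.sum_congr rfl h4] at h2
      have h5 := add_left_cancel h2
      rw [map_smul, map_mul, rho_e, eps_zero] at h5
      simpa using h5.symm

lemma rho_En (N : Module.End F V) (hN : IsNilpotent N) (z : ℂ) (r : ℕ) (A B : St N) :
    rho N (En (fun k => (1 - z ^ (k + 1)) • (MvPolynomial.X k : Lam)) r) A B =
      if A.1 ≤ B.1 ∧ fr B.1 = fr A.1 + r then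
        ∏ i ∈ Finset.range (fr (B.1 ⊓ A.1.comap N) - fr A.1), (1 - z * (Fintype.card F : ℂ) ^ i)
      else 0 := by
  rw [eh_sum, ← eps_zet_sum, map_sum]
  have : ∀ ij ∈ Finset.HasAntidiagonal.antidiagonal r,
      rho N ((-z) ^ ij.1 • (eL ij.1 * hL ij.2)) = (-z) ^ ij.1 • (eps N ij.1 * zet N ij.2) := by
    intro ij _
    rw [map_smul, map_mul, rho_e, rho_h N hN]
  rw [Finset.sum_congr rfl this]

end hecke

/-! #### Triangularity lemmas -/

def sig : Lam →ₐ[ℂ] MvPowerSeries ℕ ℂ := MvPolynomial.aeval (fun k => ppow (k + 1))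

abbrev mX (m : ℕ →₀ ℕ) : Lam := mono (fun k => (MvPolynomial.X k : Lam)) m

lemma sig_mX (m : ℕ →₀ ℕ) : sig (mX m) = mono (fun k => ppow (k + 1)) m := by
  have := mono_map (sig : Lam →+* MvPowerSeries ℕ ℂ) (fun k => (MvPolynomial.X k : Lam)) m
  refine Eq.trans this ?_
  congr 1
  funext k
  exact MvPolynomial.aeval_X _ _

def HL (n : ℕ) : Submodule ℂ Lam := Submodule.span ℂ (mX '' {m | wtm m = n})

lemma mX_mem (m : ℕ →₀ ℕ) : mX m ∈ HL (wtm m) := Submodule.subset_span ⟨m, rfl, rfl⟩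

lemma mX_add (m m' : ℕ →₀ ℕ) : mX (m + m') = mX m * mX m' :=
  Finsupp.prod_add_index' (fun _ => pow_zero _) (fun _ _ _ => pow_add _ _ _)

lemma HL_mul {a b : ℕ} {f g : Lam} (hf : f ∈ HL a) (hg : g ∈ HL b) : f * g ∈ HL (a + b) := by
  have h := Submodule.mul_mem_mul hf hg
  rw [HL, HL, Submodule.span_mul_span] at h
  refine Submodule.span_mono ?_ h
  rintro _ ⟨_, ⟨m, hm, rfl⟩, _, ⟨m', hm', rfl⟩, rfl⟩
  refine ⟨m + m', ?_, mX_add m m'⟩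
  show wtm _ = _
  rw [wtm_add]
  have h1 : wtm m = a := hm
  have h2 : wtm m' = b := hm'
  omega

lemma mono_smul (c : ℕ → ℂ) (m : ℕ →₀ ℕ) :
    mono (fun k => c k • (MvPolynomial.X k : Lam)) m = mono c m • mX m := by
  have e : (fun k => c k • (MvPolynomial.X k : Lam)) =
      fun k => algebraMap ℂ Lam (c k) * MvPolynomial.X k := by
    funext k; rw [Algebra.smul_def]
  rw [e, mono_mul, ← mono_map, Algebra.smul_def]

lemma En_mem (c : ℕ → ℂ) (n : ℕ) : En (fun k => c k • (MvPolynomial.X k : Lam)) n ∈ HL n := by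
  unfold En
  refine Submodule.sum_mem _ fun m hm => ?_
  rw [mono_smul]
  rw [mem_PF] at hm
  exact Submodule.smul_mem _ _ (Submodule.smul_mem _ _ (hm ▸ mX_mem m))

lemma eL_mem (r : ℕ) : eL r ∈ HL r := En_mem _ _

lemma En_sign (r : ℕ) : En (fun k => (-1 : ℂ) ^ k) r = if r ≤ 1 then 1 else 0 := by
  refine (En_unique (fun k => (-1 : ℂ) ^ k) (fun r => if r ≤ 1 then (1 : ℂ) else 0) ?_ ?_ r).symm
  · simp
  · intro n
    rcases n with _ | n
    · simp
    · rw [if_neg (by omega), Finset.sum_range_succ, Finset.sum_range_succ,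
        if_pos (by omega), if_pos (by omega), Finset.sum_eq_zero]
      · rw [pow_succ]; simp
      · intro k hk
        rw [Finset.mem_range] at hk
        rw [if_neg (by omega), mul_zero]

lemma coeff_smul' (d : ℕ →₀ ℕ) (c : ℂ) (f : MvPowerSeries ℕ ℂ) :
    MvPowerSeries.coeff d (c • f) = c * MvPowerSeries.coeff d f := rfl

lemma coeff_e (r : ℕ) (d : ℕ →₀ ℕ) : MvPowerSeries.coeff d (sig (eL r)) =
    if (d.sum fun _ e => e) = r ∧ ∀ i, d i ≤ 1 then 1 else 0 := by
  have h := cauchy (fun k => (-1 : ℂ) ^ k) r d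
  have e : MvPowerSeries.coeff d (sig (eL r)) =
      ∑ m ∈ PF r, ((zm m)⁻¹ * MvPowerSeries.coeff d (mono (fun k => ppow (k + 1)) m)) •
        mono (fun k => (-1 : ℂ) ^ k) m := by
    rw [eL, En, map_sum, map_sum]
    refine Finset.sum_congr rfl fun m _ => ?_
    rw [mono_smul, map_smul, map_smul, map_smul, map_smul, sig_mX]
    simp only [smul_eq_mul]
    ring
  rw [e, h]
  by_cases hs : (d.sum fun _ e => e) = r
  · rw [if_pos hs]
    by_cases h1 : ∀ i, d i ≤ 1
    · rw [if_pos ⟨hs, h1⟩, Finsupp.prod]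
      refine Finset.prod_eq_one fun i _ => ?_
      rw [En_sign, if_pos (h1 i)]
    · rw [if_neg (by tauto)]
      push Not at h1
      obtain ⟨i, hi⟩ := h1
      refine Finset.prod_eq_zero (Finsupp.mem_support_iff.2 (show d i ≠ 0 by omega)) ?_
      show En (fun k => (-1 : ℂ) ^ k) (d i) = 0
      rw [En_sign, if_neg (by omega)]
  · rw [if_neg hs, if_neg (by tauto)]

section tri
variable {F : Type*} [Field F] [Fintype F] {V : Type*} [AddCommGroup V] [Module F V] [Finite V]

def bS (N : Module.End F V) : St N := ⟨⊥, bot_le⟩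
def tS (N : Module.End F V) : St N := ⟨⊤, by simp⟩

lemma map_pow_succ (N : Module.End F V) (B : Submodule F V) (k : ℕ) :
    B.map (N ^ (k + 1)) = (B.map N).map (N ^ k) := by
  rw [pow_succ, Module.End.mul_eq_comp, Submodule.map_comp]

lemma map_pow_zero (N : Module.End F V) (B : Submodule F V) : B.map (N ^ 0) = B := by
  rw [pow_zero]; exact Submodule.map_id B

def dm (δ : ℕ →₀ ℕ) : ℕ →₀ ℕ := δ.mapRange (fun x => x - 1) rfl

lemma dm_apply (δ : ℕ →₀ ℕ) (i : ℕ) : dm δ i = δ i - 1 := rfl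

lemma rk_on (k : ℕ) (d : ℕ →₀ ℕ) (T : Finset ℕ) (h : d.support ⊆ T) :
    rk k d = ∑ i ∈ T, (d i - k) :=
  Finsupp.sum_of_support_subset _ h _ (fun i _ => Nat.zero_sub k)

lemma dm_supp (δ : ℕ →₀ ℕ) : (dm δ).support ⊆ δ.support := Finsupp.support_mapRange

lemma rk_dm (k : ℕ) (δ : ℕ →₀ ℕ) : rk k (dm δ) = rk (k + 1) δ := by
  rw [rk_on k (dm δ) _ (dm_supp δ), rk_on (k + 1) δ _ subset_rfl]
  refine Finset.sum_congr rfl fun i _ => ?_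
  rw [dm_apply]; omega

lemma rk_zero_one (δ : ℕ →₀ ℕ) : rk 0 δ = rk 1 δ + δ.support.card := by
  have := rk_succ 0 δ
  rw [this]
  congr 2
  refine Finset.filter_true_of_mem fun i hi => ?_
  rw [Finsupp.mem_support_iff] at hi; omega

lemma rk_zero (d : ℕ →₀ ℕ) : rk 0 d = d.sum fun _ e => e := rfl

lemma e_lemma (N : Module.End F V) : ∀ (n : ℕ) (δ : ℕ →₀ ℕ), rk 0 δ = n → Antitone δ →
    ∃ f : Lam, f ∈ HL n ∧
      (∀ d, MvPowerSeries.coeff d (sig f) ≠ 0 → ∀ k, rk k d ≤ rk k δ) ∧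
      MvPowerSeries.coeff δ (sig f) = 1 ∧
      (∀ B : St N, rho N f (bS N) B ≠ 0 → ∀ k, fr (B.1.map (N ^ k)) ≤ rk k δ) ∧
      (∀ B : St N, (∀ k, fr (B.1.map (N ^ k)) = rk k δ) →
        rho N f (bS N) B = (Fintype.card F : ℂ) ^ (δ.sum fun i e => i * e)) := by
  intro n
  induction n using Nat.strong_induction_on with
  | _ n ih =>
  intro δ hn hanti
  by_cases hδ : δ = 0
  · subst hδ
    have hn0 : n = 0 := by rw [← hn]; rfl
    subst hn0
    refine ⟨1, ?_, ?_, ?_, ?_, ?_⟩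
    · have := mX_mem 0
      have h0 : wtm 0 = 0 := rfl
      rw [h0] at this
      exact this
    · intro d hd k
      rw [map_one, MvPowerSeries.coeff_one] at hd
      have : d = 0 := by by_contra h; exact hd (if_neg h)
      rw [this]
    · rw [map_one, MvPowerSeries.coeff_one, if_pos rfl]
    · intro B hB k
      rw [map_one, Matrix.one_apply] at hB
      have : bS N = B := by by_contra h; exact hB (if_neg h)
      rw [← this]
      show fr (Submodule.map (N ^ k) ⊥) ≤ _
      rw [Submodule.map_bot]
      simp [fr]
    · intro B hB
      have h0 := hB 0
      rw [map_pow_zero] at h0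
      have h0 : fr B.1 = 0 := h0
      have : bS N = B := Subtype.ext (eq_of_fr bot_le (by rw [h0]; exact Nat.zero_le _))
      rw [map_one, Matrix.one_apply, if_pos this]
      simp
  · set r := δ.support.card with hr
    have hrpos : 0 < r := Finset.card_pos.2 (Finsupp.support_nonempty_iff.2 hδ)
    have h01 := rk_zero_one δ
    rw [← hr] at h01
    have hdm0 : rk 0 (dm δ) = rk 1 δ := rk_dm 0 δ
    obtain ⟨f, hf0, hf1, hf2, hf3, hf4⟩ := ih (rk 1 δ) (by omega) (dm δ) hdm0
      (fun i j hij => Nat.sub_le_sub_right (hanti hij) 1)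
    refine ⟨f * eL r, ?_, ?_, ?_, ?_, ?_⟩
    · rw [← hn, h01]; exact HL_mul hf0 (eL_mem r)
    · intro d hd k
      rw [map_mul, MvPowerSeries.coeff_mul] at hd
      obtain ⟨⟨d1, d2⟩, hmem, hne⟩ := Finset.exists_ne_zero_of_sum_ne_zero hd
      rw [Finset.HasAntidiagonal.mem_antidiagonal] at hmem
      simp only at hmem hne
      have hA := left_ne_zero_of_mul hne
      have hB := right_ne_zero_of_mul hne
      rw [coeff_e] at hB
      have hB : (d2.sum fun _ e => e) = r ∧ ∀ i, d2 i ≤ 1 := by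
        by_contra h; exact hB (if_neg h)
      have hle := hf1 d1 hA
      rcases k with _ | k
      · have : rk 0 d = rk 0 d1 + rk 0 d2 := by
          rw [← hmem]
          exact Finsupp.sum_add_index' (fun _ => rfl) (fun _ _ _ => rfl)
        have h1 := hle 0
        have h2 : rk 0 d2 = r := hB.1
        omega
      · have h1 := hle k
        rw [rk_dm] at h1
        refine le_trans ?_ h1
        rw [rk_on (k + 1) d (d1.support ∪ d2.support) (hmem ▸ Finsupp.support_add),
          rk_on k d1 _ (Finset.subset_union_left (s₂ := d2.support))]
        refine Finset.sum_le_sum fun i _ => ?_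
        have h2 := hB.2 i
        have h3 : d i = d1 i + d2 i := by rw [← hmem]; rfl
        omega
    · rw [map_mul, MvPowerSeries.coeff_mul]
      set ind : ℕ →₀ ℕ := δ.mapRange (fun x => min x 1) rfl with hind
      have hia : ∀ i, ind i = min (δ i) 1 := fun i => rfl
      have hsum : dm δ + ind = δ := by
        ext i
        rw [Finsupp.add_apply, dm_apply, hia]; omega
      rw [Finset.sum_eq_single (dm δ, ind)]
      · have hi : (ind.sum fun _ e => e) = r ∧ ∀ i, ind i ≤ 1 := by
          constructor
          · rw [← rk_zero, rk_on 0 ind δ.support Finsupp.support_mapRange, hr,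
              Finset.card_eq_sum_ones]
            refine Finset.sum_congr rfl fun i hi => ?_
            rw [Finsupp.mem_support_iff] at hi
            rw [hia]; omega
          · intro i; rw [hia]; omega
        simp only
        rw [hf2, coeff_e, if_pos hi, one_mul]
      · rintro ⟨d1, d2⟩ hmem hne
        rw [Finset.HasAntidiagonal.mem_antidiagonal] at hmem
        simp only at hmem ⊢
        rw [coeff_e, if_neg, mul_zero]
        rintro ⟨hB1, hB2⟩
        apply hne
        have hadd : ∀ i, d1 i + d2 i = δ i := fun i => by rw [← hmem]; rfl
        have hs2 : d2.support ⊆ δ.support := by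
          intro i hi
          rw [Finsupp.mem_support_iff] at hi ⊢
          have := hadd i; omega
        have hcard : d2.support.card = r := by
          rw [← hB1, ← rk_zero, rk_on 0 d2 _ subset_rfl, Finset.card_eq_sum_ones]
          refine Finset.sum_congr rfl fun i hi => ?_
          rw [Finsupp.mem_support_iff] at hi
          have := hB2 i; omega
        have hseq : d2.support = δ.support :=
          Finset.eq_of_subset_of_card_le hs2 (by omega)
        have hd2 : d2 = ind := by
          ext i
          rw [hia]
          by_cases hi : i ∈ δ.support
          · have h1 := hi
            rw [← hseq] at h1
            rw [Finsupp.mem_support_iff] at hi h1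
            have := hB2 i; omega
          · have h1 := hi
            rw [← hseq] at h1
            rw [Finsupp.notMem_support_iff] at hi h1
            omega
        have hd1 : d1 = dm δ := by
          subst hd2
          exact add_right_cancel (hmem.trans hsum.symm)
        rw [hd1, hd2]
      · intro h
        exact absurd (Finset.HasAntidiagonal.mem_antidiagonal.2 hsum) h
    · intro B hB k
      rw [map_mul, Matrix.mul_apply] at hB
      obtain ⟨C, _, hne⟩ := Finset.exists_ne_zero_of_sum_ne_zero hB
      have hA := left_ne_zero_of_mul hne
      have hB := right_ne_zero_of_mul hne
      rw [rho_e, eps] at hB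
      have hB : C.1 ≤ B.1 ∧ B.1 ≤ C.1.comap N ∧ fr B.1 = fr C.1 + r := by
        by_contra h; exact hB (if_neg h)
      have hle := hf3 C hA
      rcases k with _ | k
      · have h1 := hle 0
        rw [map_pow_zero] at h1 ⊢
        omega
      · have h1 := hle k
        rw [rk_dm] at h1
        refine le_trans (fr_mono ?_) h1
        rw [map_pow_succ]
        exact Submodule.map_mono (Submodule.map_le_iff_le_comap.2 hB.2.1)
    · intro B hB
      rw [map_mul, Matrix.mul_apply]
      have hst : B.1.map N ≤ (B.1.map N).comap N := by
        rw [← Submodule.map_le_iff_le_comap]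
        exact Submodule.map_mono (Submodule.map_le_iff_le_comap.2 B.2)
      have hfrN : fr (B.1.map N) = rk 1 δ := by
        have := hB 1
        rw [pow_one] at this
        exact this
      have hfrB : fr B.1 = rk 0 δ := by
        have := hB 0
        rw [map_pow_zero] at this
        exact this
      rw [Finset.sum_eq_single (⟨B.1.map N, hst⟩ : St N)]
      · rw [hf4, rho_e, eps, if_pos, ← pow_add]
        · congr 1
          have hs : δ.support = Finset.range r := by
            have h1 := filter_range δ hanti 0
            have h2 : δ.support.filter (fun i => 0 < δ i) = δ.support :=
              Finset.filter_true_of_mem fun i hi => by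
                rw [Finsupp.mem_support_iff] at hi; omega
            rw [h2] at h1
            exact h1
          rw [Finsupp.sum_of_support_subset _ (dm_supp δ) _ (fun i _ => Nat.mul_zero i),
            Finsupp.sum, hs, Nat.choose_two_right, ← Finset.sum_range_id, ← Finset.sum_add_distrib]
          refine Finset.sum_congr rfl fun i hi => ?_
          rw [← hs, Finsupp.mem_support_iff] at hi
          rw [dm_apply]
          obtain ⟨e, he⟩ : ∃ e, δ i = e + 1 := ⟨δ i - 1, by omega⟩
          rw [he, Nat.add_sub_cancel]
          ring
        · refine ⟨Submodule.map_le_iff_le_comap.2 B.2, Submodule.le_comap_map N B.1, ?_⟩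
          rw [hfrB, hfrN, h01]
        · intro k
          show fr ((B.1.map N).map (N ^ k)) = _
          rw [← map_pow_succ, hB, rk_dm]
      · intro C _ hC
        rw [rho_e, eps, if_neg, mul_zero]
        rintro ⟨h1, h2, h3⟩
        apply hC
        refine Subtype.ext (eq_of_fr (Submodule.map_le_iff_le_comap.2 h2) ?_).symm
        rw [hfrN]; omega
      · intro h; exact absurd (Finset.mem_univ _) h

def kL (q : ℂ) (r : ℕ) : Lam := En (fun k => (1 - q⁻¹ ^ (k + 1)) • (MvPolynomial.X k : Lam)) r

lemma kappa_single (N : Module.End F V) (hN : IsNilpotent N) (r : ℕ) (A C : St N)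
    (h : rho N (kL (Fintype.card F) r) A C ≠ 0) :
    A.1 ≤ C.1 ∧ ∀ k, (r - k) + fr A.1 ≤ fr (C.1.map (N ^ k) ⊔ A.1) := by
  rw [kL, rho_En N hN] at h
  have h1 : A.1 ≤ C.1 ∧ fr C.1 = fr A.1 + r := by
    by_contra hc; exact h (if_neg hc)
  rw [if_pos h1] at h
  have hq : (Fintype.card F : ℂ) ≠ 0 := by
    have : Fintype.card F ≠ 0 := Fintype.card_ne_zero
    exact_mod_cast this
  have hd : fr (C.1 ⊓ A.1.comap N) - fr A.1 ≤ 1 := by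
    by_contra hc
    refine h (Finset.prod_eq_zero (Finset.mem_range.2 (show 1 < _ by omega)) ?_)
    rw [pow_one, inv_mul_cancel₀ hq, sub_self]
  refine ⟨h1.1, fun k => ?_⟩
  suffices hs : r + fr A.1 ≤ fr (C.1.map (N ^ k) ⊔ A.1) + k by
    have := fr_mono (le_sup_right : A.1 ≤ C.1.map (N ^ k) ⊔ A.1)
    omega
  induction k with
  | zero =>
    rw [map_pow_zero, sup_eq_left.2 h1.1]; omega
  | succ k ih =>
    have hX : C.1.map (N ^ k) ⊔ A.1 ≤ C.1 := by
      refine sup_le ?_ h1.1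
      clear ih
      induction k with
      | zero => rw [map_pow_zero]
      | succ k ih =>
        rw [map_pow_succ]
        exact (Submodule.map_mono (Submodule.map_le_iff_le_comap.2 C.2)).trans ih
    have hdl := dimlem N A.1 (C.1.map (N ^ k) ⊔ A.1)
    have e : (C.1.map (N ^ k) ⊔ A.1).map N ⊔ A.1 = C.1.map (N ^ (k + 1)) ⊔ A.1 := by
      rw [Submodule.map_sup, sup_assoc, sup_eq_right.2 (Submodule.map_le_iff_le_comap.2 A.2),
        pow_succ', Module.End.mul_eq_comp, Submodule.map_comp]
    rw [e] at hdl
    have := fr_mono (inf_le_inf_right (A.1.comap N) hX)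
    omega

lemma kappa_lemma (N : Module.End F V) (hN : IsNilpotent N) (d : ℕ → ℕ) (s : Finset ℕ) :
    ∀ A B : St N, rho N (∏ i ∈ s, kL (Fintype.card F) (d i)) A B ≠ 0 →
      A.1 ≤ B.1 ∧ ∀ k, ∑ i ∈ s, (d i - k) + fr A.1 ≤ fr (B.1.map (N ^ k) ⊔ A.1) := by
  induction s using Finset.induction_on with
  | empty =>
    intro A B h
    rw [Finset.prod_empty, map_one, Matrix.one_apply] at h
    have hAB : A = B := by by_contra hc; exact h (if_neg hc)
    subst hAB
    refine ⟨le_rfl, fun k => ?_⟩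
    rw [Finset.sum_empty, zero_add]
    exact fr_mono le_sup_right
  | insert a s ha ih =>
    intro A B h
    rw [Finset.prod_insert ha, map_mul, Matrix.mul_apply] at h
    obtain ⟨C, _, hne⟩ := Finset.exists_ne_zero_of_sum_ne_zero h
    obtain ⟨h1, h2⟩ := kappa_single N hN _ A C (left_ne_zero_of_mul hne)
    obtain ⟨h3, h4⟩ := ih C B (right_ne_zero_of_mul hne)
    refine ⟨h1.trans h3, fun k => ?_⟩
    rw [Finset.sum_insert ha]
    have e2 := h2 k
    have e4 := h4 k
    set X := B.1.map (N ^ k) ⊔ A.1 with hX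
    have hsup : X ⊔ C.1 = B.1.map (N ^ k) ⊔ C.1 := by
      rw [hX, sup_assoc, sup_eq_right.2 h1]
    have hst : C.1.map (N ^ k) ≤ C.1 := by
      clear e2 e4 hX hsup X
      induction k with
      | zero => rw [map_pow_zero]
      | succ k ih =>
        rw [map_pow_succ]
        exact (Submodule.map_mono (Submodule.map_le_iff_le_comap.2 C.2)).trans ih
    have hinf : C.1.map (N ^ k) ⊔ A.1 ≤ X ⊓ C.1 :=
      le_inf (sup_le_sup_right (Submodule.map_mono h3) _) (sup_le hst h1)
    have e5 := fr_mono hinf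
    have e6 : fr (X ⊔ C.1) + fr (X ⊓ C.1) = fr X + fr C.1 :=
      Submodule.finrank_sup_add_finrank_inf_eq X C.1
    rw [hsup] at e6
    omega

end tri

/-! #### Symmetric function endgame -/

lemma FP_fin (n : ℕ) : {l : Partn | l.size = n}.Finite := by
  refine Set.Finite.of_finite_image (f := pm) ?_ (fun a _ b _ h => pm_inj h)
  refine (PF n).finite_toSet.subset ?_
  rintro _ ⟨l, hl, rfl⟩
  have hl : l.size = n := hl
  rw [Finset.mem_coe, mem_PF, ← size_eq, hl]

def FP (n : ℕ) : Finset Partn := (FP_fin n).toFinset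

lemma mem_FP {n : ℕ} {l : Partn} : l ∈ FP n ↔ l.size = n := by
  unfold FP
  rw [Set.Finite.mem_toFinset]
  rfl

lemma sum_FP {M : Type*} [AddCommMonoid M] (n : ℕ) (f : (ℕ →₀ ℕ) → M) :
    ∑ l ∈ FP n, f (pm l) = ∑ m ∈ PF n, f m := by
  refine Finset.sum_bij (fun l _ => pm l) ?_ ?_ ?_ ?_
  · intro l hl
    rw [mem_FP] at hl
    rw [mem_PF, ← size_eq, hl]
  · intro a _ b _ h
    exact pm_inj h
  · intro m hm
    obtain ⟨l, rfl⟩ := pm_surj m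
    rw [mem_PF, ← size_eq] at hm
    exact ⟨l, mem_FP.2 hm, rfl⟩
  · intro _ _
    rfl

lemma finsum_FP {M : Type*} [AddCommMonoid M] (n : ℕ) (f : Partn → M) :
    ∑ᶠ l, (if l.size = n then f l else 0) = ∑ l ∈ FP n, f l := by
  rw [finsum_eq_sum_of_support_subset (s := FP n)]
  · refine Finset.sum_congr rfl fun l hl => ?_
    rw [if_pos (mem_FP.1 hl)]
  · intro l hl
    rw [Function.mem_support] at hl
    rw [Finset.mem_coe, mem_FP]
    by_contra h
    exact hl (if_neg h)

def Rf (l : Partn) : ℕ → ℕ := fun k => rk k (dF l)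

lemma Rf_inj {l m : Partn} (h : Rf l = Rf m) : l = m := rk_inj fun k => congrFun h k

section abs
variable (PHL : Partn → MvPowerSeries ℕ ℂ)
  (h0 : ∀ l : Partn, MvPowerSeries.coeff (dF l) (PHL l) = 1)
  (h1 : ∀ l m : Partn, MvPowerSeries.coeff (dF l) (PHL m) ≠ 0 → Rf l ≤ Rf m)
include h0 h1

lemma tri_coeff (b : Partn → ℂ) (n : ℕ) (l : Partn) (hl : l ∈ FP n)
    (H : ∀ k ∈ FP n, MvPowerSeries.coeff (dF k) (∑ m ∈ FP n, b m • PHL m) ≠ 0 → Rf k ≤ Rf l) :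
    (∀ k ∈ FP n, b k ≠ 0 → Rf k ≤ Rf l) ∧
      b l = MvPowerSeries.coeff (dF l) (∑ m ∈ FP n, b m • PHL m) := by
  have key : ∀ k ∈ FP n, (∀ m ∈ FP n, b m ≠ 0 → Rf k ≤ Rf m → m = k) →
      MvPowerSeries.coeff (dF k) (∑ m ∈ FP n, b m • PHL m) = b k := by
    intro k hk hm
    rw [map_sum, Finset.sum_eq_single k]
    · rw [map_smul, h0, smul_eq_mul, mul_one]
    · intro m hmm hmk
      rw [map_smul, smul_eq_mul]
      by_contra hne
      exact hmk (hm m hmm (left_ne_zero_of_mul hne) (h1 _ _ (right_ne_zero_of_mul hne)))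
    · intro h
      exact absurd hk h
  have A : ∀ k ∈ FP n, b k ≠ 0 → Rf k ≤ Rf l := by
    intro k hk hbk
    obtain ⟨k', hk', hmax⟩ := Finset.exists_maximalFor Rf
      ((FP n).filter fun m => b m ≠ 0 ∧ Rf k ≤ Rf m) ⟨k, Finset.mem_filter.2 ⟨hk, hbk, le_rfl⟩⟩
    obtain ⟨hk'n, hb', hkk'⟩ := Finset.mem_filter.1 hk'
    refine hkk'.trans (H k' hk'n ?_)
    rw [key k' hk'n]
    · exact hb'
    · intro m hm hbm hle
      exact Rf_inj (le_antisymm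
        (hmax (j := m) (Finset.mem_filter.2 ⟨hm, hbm, hkk'.trans hle⟩) hle) hle)
  refine ⟨A, (key l hl fun m hm hbm hle => Rf_inj (le_antisymm (A m hm hbm) hle)).symm⟩

lemma phi_PHL (n : ℕ) (φ : MvPowerSeries ℕ ℂ →ₗ[ℂ] ℂ) (mu : Partn) (hmu : mu ∈ FP n) (Q : ℂ)
    (hup : ∀ l ∈ FP n, φ (PHL l) ≠ 0 → Rf l ≤ Rf mu)
    (hf : ∀ l ∈ FP n, ∃ b : Partn → ℂ,
      (∀ k ∈ FP n, MvPowerSeries.coeff (dF k) (∑ m ∈ FP n, b m • PHL m) ≠ 0 → Rf k ≤ Rf l) ∧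
      MvPowerSeries.coeff (dF l) (∑ m ∈ FP n, b m • PHL m) = 1 ∧
      (φ (∑ m ∈ FP n, b m • PHL m) ≠ 0 → Rf mu ≤ Rf l) ∧
      (l = mu → φ (∑ m ∈ FP n, b m • PHL m) = Q)) :
    ∀ l ∈ FP n, φ (PHL l) = if l = mu then Q else 0 := by
  have key : ∀ l ∈ FP n, (∀ k ∈ FP n, k ≠ l → Rf k ≤ Rf l → φ (PHL k) = 0) →
      (φ (PHL l) ≠ 0 → Rf mu ≤ Rf l) ∧ (l = mu → φ (PHL l) = Q) := by
    intro l hl hk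
    obtain ⟨b, hb1, hb2, hb3, hb4⟩ := hf l hl
    obtain ⟨t1, t2⟩ := tri_coeff PHL h0 h1 b n l hl hb1
    have e : φ (∑ m ∈ FP n, b m • PHL m) = φ (PHL l) := by
      rw [map_sum, Finset.sum_eq_single l]
      · rw [map_smul, t2, hb2, one_smul]
      · intro m hm hml
        rw [map_smul, smul_eq_mul]
        by_cases hbm : b m = 0
        · rw [hbm, zero_mul]
        · rw [hk m hm hml (t1 m hm hbm), mul_zero]
      · intro h
        exact absurd hl h
    rw [e] at hb3 hb4
    exact ⟨hb3, hb4⟩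
  have Z : ∀ l ∈ FP n, l ≠ mu → φ (PHL l) = 0 := by
    by_contra hcon
    push Not at hcon
    obtain ⟨l0, hl0, hl1, hl2⟩ := hcon
    obtain ⟨l, hl, hmin⟩ := Finset.exists_minimalFor Rf
      ((FP n).filter fun m => m ≠ mu ∧ φ (PHL m) ≠ 0) ⟨l0, Finset.mem_filter.2 ⟨hl0, hl1, hl2⟩⟩
    obtain ⟨hln, hlm, hlp⟩ := Finset.mem_filter.1 hl
    have hle := hup l hln hlp
    refine hlm (Rf_inj (le_antisymm hle ((key l hln ?_).1 hlp)))
    intro k hk hkl hkle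
    by_contra hne
    have hkm : k ≠ mu := by
      rintro rfl
      exact hlm (Rf_inj (le_antisymm hle hkle))
    exact hkl (Rf_inj (le_antisymm hkle (hmin (Finset.mem_filter.2 ⟨hk, hkm, hne⟩) hkle)))
  intro l hl
  split_ifs with h
  · refine (key l hl fun k hk hkl _ => Z k hk fun hh => hkl (hh.trans h.symm)).2 h
  · exact Z l hl h
end abs

lemma HLtri_coeff (PHL : Partn → MvPowerSeries ℕ ℂ)
    (hHL_tri : ∀ mu : Partn, ∃ c : Partn → ℂ,
      PHL mu = msym mu + ∑ᶠ l : Partn, (if DomLt l mu then c l else 0) • msym l) :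
    (∀ l : Partn, MvPowerSeries.coeff (dF l) (PHL l) = 1) ∧
    (∀ l m : Partn, MvPowerSeries.coeff (dF l) (PHL m) ≠ 0 → Rf l ≤ Rf m) := by
  have key : ∀ m l : Partn, ∃ c : ℂ, MvPowerSeries.coeff (dF l) (PHL m) =
      (if l = m then 1 else 0) + if DomLt l m then c else 0 := by
    intro m l
    obtain ⟨c, hc⟩ := hHL_tri m
    refine ⟨c l, ?_⟩
    rw [hc, map_add, msym_dF, finsum_eq_sum_of_support_subset (s := FP m.size), map_sum]
    · congr 1
      have : ∀ k ∈ FP m.size, MvPowerSeries.coeff (dF l) ((if DomLt k m then c k else 0) • msym k) =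
          if l = k then (if DomLt k m then c k else 0) else 0 := by
        intro k _
        rw [map_smul, msym_dF, smul_eq_mul, mul_ite, mul_one, mul_zero]
      rw [Finset.sum_congr rfl this, Finset.sum_ite_eq]
      split_ifs with h1 h2
      · rfl
      · rfl
      · rename_i h2
        exact absurd (mem_FP.2 h2.1) h1
      · rfl
    · intro k hk
      rw [Function.mem_support] at hk
      rw [Finset.mem_coe, mem_FP]
      by_contra h
      refine hk ?_
      rw [if_neg (fun hh => h hh.1), zero_smul]
  constructor
  · intro l
    obtain ⟨c, hc⟩ := key l l
    rw [hc, if_pos rfl, if_neg (fun h => h.2.1 rfl), add_zero]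
  · intro l m h
    obtain ⟨c, hc⟩ := key m l
    by_cases hlm : l = m
    · rw [hlm]
    · by_cases hd : DomLt l m
      · exact fun k => domLt_rk hd k
      · rw [hc, if_neg hlm, if_neg hd, add_zero] at h
        exact absurd rfl h

section fin
variable {F : Type*} [Field F] [Fintype F] {V : Type*} [AddCommGroup V] [Module F V] [Finite V]

def evN (N : Module.End F V) : Lam →ₗ[ℂ] ℂ where
  toFun f := rho N f (bS N) (tS N)
  map_add' f g := by rw [map_add]; rfl
  map_smul' c f := by rw [map_smul]; rfl

lemma evN_apply (N : Module.End F V) (f : Lam) : evN N f = rho N f (bS N) (tS N) := rfl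

theorem green_sum (N : Module.End F V) (hN : IsNilpotent N) (n : ℕ)
    (mu : Partn) (hmu : mu.size = n)
    (hrk : ∀ k, fr ((⊤ : Submodule F V).map (N ^ k)) = rk k (dF mu)) (q : ℂ)
    (hq : (Fintype.card F : ℂ) = q)
    (PHL : Partn → MvPowerSeries ℕ ℂ)
    (Bform : MvPowerSeries ℕ ℂ →ₗ[ℂ] MvPowerSeries ℕ ℂ →ₗ[ℂ] ℂ)
    (hHL_tri : ∀ mu : Partn, ∃ c : Partn → ℂ,
      PHL mu = msym mu + ∑ᶠ l : Partn, (if DomLt l mu then c l else 0) • msym l)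
    (hB_pow : ∀ l m : Partn, Bform (psym l) (psym m) =
      if l = m then (l.zee : ℂ) *
        ∏ i ∈ Finset.range l.len, (1 - q⁻¹ ^ l.parts (i + 1))⁻¹
      else 0)
    (hHL_orth : ∀ l m : Partn, l ≠ m → Bform (PHL l) (PHL m) = 0)
    (Qval : Partn → Partn → ℂ)
    (hGreen : ∀ nu : Partn, psym nu = ∑ᶠ mu : Partn,
      if mu.size = nu.size then (Qval nu mu * q⁻¹ ^ mu.nstat) • PHL mu else 0) :
    (∑ᶠ nu : Partn, if nu.size = n then
            ((-1 : ℂ) ^ (n - nu.len) / (nu.zee : ℂ)) *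
              (∏ i ∈ Finset.range nu.len, (q ^ nu.parts (i + 1) - 1)) *
              Qval nu mu
          else 0) = (-1) ^ n * ∏ i ∈ Finset.range (fr (LinearMap.ker N)), (1 - q ^ (i + 1)) := by
  obtain ⟨h0, h1⟩ := HLtri_coeff PHL hHL_tri
  have hq1 : 1 < Fintype.card F := Fintype.one_lt_card
  have hq0 : q ≠ 0 := by
    rw [← hq]; exact_mod_cast (by omega : Fintype.card F ≠ 0)
  have hqp : ∀ k : ℕ, (1 : ℂ) - q⁻¹ ^ (k + 1) ≠ 0 := by
    intro k h
    have h2 : q ^ (k + 1) = 1 := by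
      rw [sub_eq_zero, inv_pow, eq_comm, inv_eq_one] at h
      exact h
    rw [← hq] at h2
    have h3 : (Fintype.card F) ^ (k + 1) = 1 := by exact_mod_cast h2
    have h4 : 1 < (Fintype.card F) ^ (k + 1) := Nat.one_lt_pow (Nat.succ_ne_zero k) hq1
    omega
  set a : ℕ → ℂ := fun k => 1 - q⁻¹ ^ (k + 1) with ha
  have hnorm : ∀ l m : Partn, Bform (psym l) (psym m) =
      if l = m then zm (pm l) * (mono a (pm l))⁻¹ else 0 := by
    intro l m
    rw [hB_pow, zee_eq, prod_parts l (fun x => (1 - q⁻¹ ^ x)⁻¹)]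
    congr 2
    unfold mono Finsupp.prod
    rw [← Finset.prod_inv_distrib]
    refine Finset.prod_congr rfl fun k _ => ?_
    exact inv_pow _ _
  have hmono : ∀ m, mono a m ≠ 0 := by
    intro m
    unfold mono
    rw [Finsupp.prod, Finset.prod_ne_zero_iff]
    intro k _
    exact pow_ne_zero _ (hqp k)
  set ev := evN N with hev
  set Φ : MvPowerSeries ℕ ℂ := ∑ l ∈ FP n, ((zm (pm l))⁻¹ * mono a (pm l) * ev (mX (pm l))) • psym l
    with hΦ
  set φ : MvPowerSeries ℕ ℂ →ₗ[ℂ] ℂ := Bform.flip Φ with hφ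
  have hφp : ∀ l ∈ FP n, φ (psym l) = ev (mX (pm l)) := by
    intro l hl
    rw [hφ, LinearMap.flip_apply, hΦ, map_sum, Finset.sum_eq_single l]
    · rw [map_smul, hnorm, if_pos rfl, smul_eq_mul]
      have := hmono (pm l)
      have := zm_ne (pm l)
      field_simp
    · intro m _ hml
      rw [map_smul, hnorm, if_neg (Ne.symm hml), smul_zero]
    · intro h
      exact absurd hl h
  have hφf : ∀ f ∈ HL n, φ (sig f) = ev f := by
    intro f hf
    refine Submodule.span_induction (p := fun f _ => φ (sig f) = ev f) ?_ ?_ ?_ ?_ hf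
    · rintro _ ⟨m, hm, rfl⟩
      obtain ⟨l, rfl⟩ := pm_surj m
      have hm : wtm (pm l) = n := hm
      rw [sig_mX, ← psym_eq]
      exact hφp l (mem_FP.2 (by rw [size_eq, hm]))
    · simp
    · intro x y _ _ hx hy
      rw [map_add, map_add, map_add, hx, hy]
    · intro c x _ hx
      rw [map_smul, map_smul, map_smul, hx]
  -- expansions in the PHL basis
  have hps : ∀ l ∈ FP n, psym l = ∑ m ∈ FP n, (Qval l m * q⁻¹ ^ m.nstat) • PHL m := by
    intro l hl
    rw [mem_FP] at hl
    have := hGreen l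
    rw [hl, finsum_FP] at this
    exact this
  have hspan : ∀ f : MvPowerSeries ℕ ℂ, f ∈ Submodule.span ℂ (PHL '' (FP n : Set Partn)) →
      ∃ b : Partn → ℂ, f = ∑ m ∈ FP n, b m • PHL m := by
    intro f hf
    refine Submodule.span_induction (p := fun f _ => ∃ b : Partn → ℂ, f = ∑ m ∈ FP n, b m • PHL m)
      ?_ ?_ ?_ ?_ hf
    · rintro _ ⟨m, hm, rfl⟩
      refine ⟨fun k => if k = m then 1 else 0, ?_⟩
      rw [Finset.sum_eq_single m]
      · simp
      · intro k _ hk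
        simp [hk]
      · intro h
        exact absurd hm h
    · exact ⟨0, by simp⟩
    · rintro x y _ _ ⟨b, rfl⟩ ⟨c, rfl⟩
      exact ⟨b + c, by simp [add_smul, Finset.sum_add_distrib]⟩
    · rintro c x _ ⟨b, rfl⟩
      exact ⟨fun k => c * b k, by simp [Finset.smul_sum, mul_smul]⟩
  have hpsm : ∀ l ∈ FP n, psym l ∈ Submodule.span ℂ (PHL '' (FP n : Set Partn)) := by
    intro l hl
    rw [hps l hl]
    exact Submodule.sum_mem _ fun m hm => Submodule.smul_mem _ _
      (Submodule.subset_span ⟨m, hm, rfl⟩)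
  have hsigm : ∀ f ∈ HL n, sig f ∈ Submodule.span ℂ (PHL '' (FP n : Set Partn)) := by
    intro f hf
    refine Submodule.span_induction
      (p := fun f _ => sig f ∈ Submodule.span ℂ (PHL '' (FP n : Set Partn))) ?_ ?_ ?_ ?_ hf
    · rintro _ ⟨m, hm, rfl⟩
      obtain ⟨l, rfl⟩ := pm_surj m
      have hm : wtm (pm l) = n := hm
      rw [sig_mX, ← psym_eq]
      exact hpsm l (mem_FP.2 (by rw [size_eq, hm]))
    · simp
    · intro x y _ _ hx hy
      rw [map_add]
      exact Submodule.add_mem _ hx hy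
    · intro c x _ hx
      rw [map_smul]
      exact Submodule.smul_mem _ _ hx
  -- coefficients of Φ
  have hΦc : ∀ k ∈ FP n, MvPowerSeries.coeff (dF k) Φ ≠ 0 → Rf k ≤ Rf mu := by
    intro k hk hne
    have hc := cauchy (fun k => a k • (MvPolynomial.X k : Lam)) n (dF k)
    rw [if_pos (by rw [← rk_zero, ← size_eq_rk]; exact mem_FP.1 hk)] at hc
    have e : MvPowerSeries.coeff (dF k) Φ = ev ((dF k).prod fun _ e =>
        En (fun k => a k • (MvPolynomial.X k : Lam)) e) := by
      rw [← hc, hΦ, map_sum, map_sum, ← sum_FP]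
      refine Finset.sum_congr rfl fun l _ => ?_
      rw [mono_smul, map_smul, map_smul, map_smul, ← psym_eq, smul_eq_mul, smul_eq_mul, smul_eq_mul]
      ring
    rw [e, hev, evN_apply] at hne
    have hkl := kappa_lemma N hN (dF k) (dF k).support (bS N) (tS N) (by
      intro hz
      apply hne
      rw [← hz, hq]
      rfl)
    intro j
    have h2 := hkl.2 j
    have e1 : fr (bS N).1 = 0 := finrank_bot F V
    have e2 : (tS N).1.map (N ^ j) ⊔ (bS N).1 = (⊤ : Submodule F V).map (N ^ j) := sup_bot_eq _
    rw [e1, e2, hrk] at h2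
    exact h2
  obtain ⟨bΦ, hbΦ⟩ := hspan Φ (by
    rw [hΦ]
    exact Submodule.sum_mem _ fun m hm => Submodule.smul_mem _ _ (hpsm m hm))
  have hmuF : mu ∈ FP n := mem_FP.2 hmu
  have hup : ∀ l ∈ FP n, φ (PHL l) ≠ 0 → Rf l ≤ Rf mu := by
    intro l hl hne
    have hT := tri_coeff PHL h0 h1 bΦ n mu hmuF (by rw [← hbΦ]; exact hΦc)
    refine hT.1 l hl fun hb => hne ?_
    rw [hφ, LinearMap.flip_apply, hbΦ, map_sum]
    refine Finset.sum_eq_zero fun m _ => ?_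
    rw [map_smul]
    by_cases hml : m = l
    · rw [hml, hb, zero_smul]
    · rw [hHL_orth l m (Ne.symm hml), smul_zero]
  have hP := phi_PHL PHL h0 h1 n φ mu hmuF (q ^ mu.nstat) hup (by
    intro l hl
    obtain ⟨f, f1, f2, f3, f4, f5⟩ := e_lemma N n (dF l)
      (by rw [← size_eq_rk]; exact mem_FP.1 hl) (dF_anti l)
    obtain ⟨b, hb⟩ := hspan _ (hsigm f f1)
    refine ⟨b, ?_⟩
    rw [← hb, hφf f f1]
    refine ⟨fun k _ hk => f2 _ hk, f3, ?_, ?_⟩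
    · intro h j
      have := f4 (tS N) h j
      have e2 : fr ((tS N).1.map (N ^ j)) = rk j (dF mu) := hrk j
      rw [e2] at this
      exact this
    · rintro rfl
      have := f5 (tS N) hrk
      rw [hev, evN_apply, this, hq, nstat_eq])
  have hQ : ∀ l ∈ FP n, Qval l mu = ev (mX (pm l)) := by
    intro l hl
    rw [← hφp l hl, hps l hl, map_sum, Finset.sum_eq_single mu]
    · rw [map_smul, hP mu hmuF, if_pos rfl, smul_eq_mul, mul_assoc, ← mul_pow,
        inv_mul_cancel₀ hq0, one_pow, mul_one]
    · intro m hm hne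
      rw [map_smul, hP m hm, if_neg hne, smul_zero]
    · intro h
      exact absurd hmuF h
  rw [finsum_FP]
  have e1 : ∀ l ∈ FP n, ((-1 : ℂ) ^ (n - l.len) / (l.zee : ℂ)) *
              (∏ i ∈ Finset.range l.len, (q ^ l.parts (i + 1) - 1)) * Qval l mu =
      (fun m => (-1) ^ n * ev ((zm m)⁻¹ • mono (fun k => (1 - q ^ (k + 1)) •
        (MvPolynomial.X k : Lam)) m)) (pm l) := by
    intro l hl
    rw [hQ l hl]
    beta_reduce
    rw [mono_smul, map_smul, map_smul, zee_eq, smul_eq_mul, smul_eq_mul]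
    have hm : mono (fun k => 1 - q ^ (k + 1)) (pm l) =
        (-1) ^ l.len * ∏ i ∈ Finset.range l.len, (q ^ l.parts (i + 1) - 1) := by
      have := prod_parts l (fun x => 1 - q ^ x)
      unfold mono
      rw [← this, ← Finset.card_range l.len, ← Finset.prod_const, Finset.card_range,
        ← Finset.prod_mul_distrib]
      refine Finset.prod_congr rfl fun i _ => ?_
      ring
    have hlen : l.len ≤ n := by
      rw [← mem_FP.1 hl, size_eq, len_eq]
      unfold wtm Finsupp.sum
      refine Finset.sum_le_sum fun i _ => ?_
      nlinarith
    have hs : (-1 : ℂ) ^ n * (-1) ^ l.len = (-1) ^ (n - l.len) := by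
      rw [← pow_add, show n + l.len = (n - l.len) + 2 * l.len by omega, pow_add, pow_mul]
      norm_num
    rw [hm, ← hs]
    ring
  rw [Finset.sum_congr rfl e1, sum_FP n (fun m => (-1) ^ n * ev ((zm m)⁻¹ •
    mono (fun k => (1 - q ^ (k + 1)) • (MvPolynomial.X k : Lam)) m)), ← Finset.mul_sum, ← map_sum]
  congr 1
  have := rho_En N hN q n (bS N) (tS N)
  have c1 : fr (bS N).1 = 0 := finrank_bot F V
  have c2 : fr (tS N).1 = n := by
    have := hrk 0
    rw [map_pow_zero, ← size_eq_rk, hmu] at this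
    exact this
  have c3 : (tS N).1 ⊓ (bS N).1.comap N = LinearMap.ker N := by
    show ⊤ ⊓ (⊥ : Submodule F V).comap N = _
    rw [top_inf_eq]
    rfl
  rw [if_pos ⟨bot_le, by rw [c1, c2, zero_add]⟩, c3, c1, hq, Nat.sub_zero] at this
  rw [hev, evN_apply]
  refine Eq.trans this ?_
  refine Finset.prod_congr rfl fun i _ => ?_
  rw [pow_succ']
end fin

/-! #### The Gelfand-Graev sum -/

section gg
variable {F : Type*} [Field F] [Fintype F] {V : Type*} [AddCommGroup V] [Module F V] [Fintype V]

def lc : (m : ℕ) → (Fin m → V) → (V →ₗ[F] F)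
  | 0, _ => 0
  | m + 1, y => if h : ∃ φ : V →ₗ[F] F, (∀ i, φ (y (Fin.castSucc i)) = 0) ∧ φ (y (Fin.last m)) = 1
      then h.choose else 0

def wstep (N : Module.End F V) (χ : F → ℂ) (m : ℕ) (y : Fin m → V) (w : V) : ℂ :=
  if w ∉ Submodule.span F (Set.range y) ∧ N w ∈ Submodule.span F (Set.range y)
    then χ (lc (F := F) m y (N w)) else 0

def Wt (N : Module.End F V) (χ : F → ℂ) : (m : ℕ) → (Fin m → V) → ℂ
  | 0, _ => 1
  | m + 1, y => Wt N χ m (fun i => y (Fin.castSucc i)) *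
      wstep N χ m (fun i => y (Fin.castSucc i)) (y (Fin.last m))

lemma span_castSucc (m : ℕ) (y : Fin (m + 1) → V) : Submodule.span F (Set.range y) =
    Submodule.span F (Set.range fun i => y (Fin.castSucc i)) ⊔ Submodule.span F {y (Fin.last m)} := by
  rw [← Submodule.span_union]
  congr 1
  ext v
  constructor
  · rintro ⟨i, rfl⟩
    induction i using Fin.lastCases with
    | last => exact Or.inr rfl
    | cast i => exact Or.inl ⟨i, rfl⟩
  · rintro (⟨i, rfl⟩ | h)
    · exact ⟨_, rfl⟩
    · exact ⟨Fin.last m, h.symm⟩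

lemma wstep_ne {N : Module.End F V} {χ : F → ℂ} {m : ℕ} {y : Fin m → V} {w : V}
    (h : wstep N χ m y w ≠ 0) : w ∉ Submodule.span F (Set.range y) ∧
      N w ∈ Submodule.span F (Set.range y) := by
  by_contra hc
  exact h (if_neg hc)

lemma Wt_li {N : Module.End F V} {χ : F → ℂ} : ∀ {m : ℕ} {y : Fin m → V},
    Wt N χ m y ≠ 0 → LinearIndependent F y ∧
      Submodule.span F (Set.range y) ≤ (Submodule.span F (Set.range y)).comap N
  | 0, y, _ => by
      refine ⟨linearIndependent_empty_type, ?_⟩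
      rw [Submodule.span_le]
      rintro _ ⟨i, rfl⟩
      exact i.elim0
  | m + 1, y, h => by
      have hh : Wt N χ m (fun i => y (Fin.castSucc i)) *
        wstep N χ m (fun i => y (Fin.castSucc i)) (y (Fin.last m)) ≠ 0 := h
      obtain ⟨h1, h2⟩ := Wt_li (left_ne_zero_of_mul hh)
      obtain ⟨h3, h4⟩ := wstep_ne (right_ne_zero_of_mul hh)
      have hs := span_castSucc (F := F) m y
      constructor
      · rw [linearIndependent_fin_succ']
        exact ⟨h1, h3⟩
      · conv_lhs => rw [hs]
        rw [sup_le_iff]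
        constructor
        · refine h2.trans (Submodule.comap_mono ?_)
          rw [hs]
          exact le_sup_left
        · rw [Submodule.span_singleton_le_iff_mem, Submodule.mem_comap, hs]
          exact Submodule.mem_sup_left h4

lemma Wt_succ {N : Module.End F V} {χ : F → ℂ} {m : ℕ} {y : Fin (m + 1) → V}
    (h : Wt N χ (m + 1) y ≠ 0) : Submodule.span F (Set.range y) ≤
      (Submodule.span F (Set.range fun i => y (Fin.castSucc i))).comap N := by
  have hh : Wt N χ m (fun i => y (Fin.castSucc i)) *
        wstep N χ m (fun i => y (Fin.castSucc i)) (y (Fin.last m)) ≠ 0 := h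
  obtain ⟨h1, h2⟩ := Wt_li (left_ne_zero_of_mul hh)
  obtain ⟨h3, h4⟩ := wstep_ne (right_ne_zero_of_mul hh)
  rw [span_castSucc, sup_le_iff]
  refine ⟨h2, ?_⟩
  rw [Submodule.span_singleton_le_iff_mem, Submodule.mem_comap]
  exact h4

lemma lc_spec {m : ℕ} {y : Fin (m + 1) → V} (h : LinearIndependent F y) :
    (∀ i, lc (F := F) (m + 1) y (y (Fin.castSucc i)) = 0) ∧
      lc (F := F) (m + 1) y (y (Fin.last m)) = 1 := by
  have hex : ∃ φ : V →ₗ[F] F, (∀ i, φ (y (Fin.castSucc i)) = 0) ∧ φ (y (Fin.last m)) = 1 := by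
    rw [linearIndependent_fin_succ'] at h
    obtain ⟨f, hf, hle⟩ := Submodule.exists_le_ker_of_notMem h.2
    refine ⟨(f (y (Fin.last m)))⁻¹ • f, ?_, ?_⟩
    · intro i
      have : f (y (Fin.castSucc i)) = 0 := hle (Submodule.subset_span ⟨i, rfl⟩)
      simp [this]
    · simp [hf]
  show (∀ i, (dite _ _ _ : V →ₗ[F] F) _ = 0) ∧ (dite _ _ _ : V →ₗ[F] F) _ = 1
  rw [dif_pos hex]
  exact hex.choose_spec

lemma lc_ker {m : ℕ} {y : Fin (m + 1) → V} (h : LinearIndependent F y) (u : V)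
    (hu : u ∈ Submodule.span F (Set.range y)) : lc (F := F) (m + 1) y u = 0 ↔
      u ∈ Submodule.span F (Set.range fun i => y (Fin.castSucc i)) := by
  obtain ⟨h1, h2⟩ := lc_spec h
  have hle : Submodule.span F (Set.range fun i => y (Fin.castSucc i)) ≤
      LinearMap.ker (lc (F := F) (m + 1) y) := by
    rw [Submodule.span_le]
    rintro _ ⟨i, rfl⟩
    exact h1 i
  refine ⟨fun h0 => ?_, fun hm => hle hm⟩
  rw [span_castSucc, Submodule.mem_sup] at hu
  obtain ⟨a, ha, b, hb, rfl⟩ := hu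
  rw [Submodule.mem_span_singleton] at hb
  obtain ⟨c, rfl⟩ := hb
  rw [map_add, map_smul, h2, show lc (F := F) (m + 1) y a = 0 from hle ha, zero_add, smul_eq_mul,
    mul_one] at h0
  rw [h0, zero_smul, add_zero]
  exact ha

lemma char_sum (χ : F → ℂ) (h0 : χ 0 = 1) (hadd : ∀ a b, χ (a + b) = χ a * χ b)
    (hnt : ∃ t, χ t ≠ 1) (ℓ : V →ₗ[F] F) (C : Submodule F V) :
    ∑ w : V, (if w ∈ C then χ (ℓ w) else 0) =
      if C ≤ LinearMap.ker ℓ then (Fintype.card F : ℂ) ^ fr C else 0 := by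
  split_ifs with h
  · have : ∀ w : V, (if w ∈ C then χ (ℓ w) else 0) = if w ∈ C then (1 : ℂ) else 0 := by
      intro w
      split_ifs with hw
      · rw [show ℓ w = 0 from h hw, h0]
      · rfl
    rw [Finset.sum_congr rfl fun w _ => this w, Finset.sum_boole]
    have hc := Module.card_eq_pow_finrank (K := F) (V := C)
    rw [← Nat.cast_pow, ← hc, Fintype.card_subtype]
  · obtain ⟨c, hc, hne⟩ := SetLike.not_le_iff_exists.1 h
    obtain ⟨t, ht⟩ := hnt
    have hne : ℓ c ≠ 0 := hne
    set c' := (t * (ℓ c)⁻¹) • c with hc'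
    have hc'C : c' ∈ C := C.smul_mem _ hc
    have hl : ℓ c' = t := by
      rw [hc', map_smul, smul_eq_mul, mul_assoc, inv_mul_cancel₀ hne, mul_one]
    have e : ∑ w : V, (if w ∈ C then χ (ℓ w) else 0) =
        χ t * ∑ w : V, (if w ∈ C then χ (ℓ w) else 0) := by
      rw [Finset.mul_sum, ← Equiv.sum_comp (Equiv.addRight c')]
      refine Finset.sum_congr rfl fun w _ => ?_
      show (if w + c' ∈ C then χ (ℓ (w + c')) else 0) = _
      rw [C.add_mem_iff_left hc'C, map_add, hl, hadd, mul_ite, mul_zero, mul_comm]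
    have : (1 - χ t) * ∑ w : V, (if w ∈ C then χ (ℓ w) else 0) = 0 := by
      rw [sub_mul, one_mul, ← e, sub_self]
    rcases mul_eq_zero.1 this with h1 | h1
    · exact absurd (sub_eq_zero.1 h1).symm ht
    · exact h1

def Dn (N : Module.End F V) (U : Submodule F V) : ℕ := fr (U.comap N) - fr U

def dd (N : Module.End F V) : (m : ℕ) → (Fin m → V) → ℕ
  | 0, _ => Dn N ⊥ + 1
  | m + 1, y => Dn N (Submodule.span F (Set.range fun i => y (Fin.castSucc i)))

lemma wstep_sum (N : Module.End F V) (χ : F → ℂ) (h0 : χ 0 = 1)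
    (hadd : ∀ a b, χ (a + b) = χ a * χ b) (hnt : ∃ t, χ t ≠ 1) (m : ℕ) (y : Fin m → V)
    (hy : Wt N χ m y ≠ 0) :
    (dd N m y = Dn N (Submodule.span F (Set.range y)) + 1 ∧
      ∑ w, wstep N χ m y w = -((Fintype.card F : ℂ) ^ m) *
        (1 - (Fintype.card F : ℂ) ^ (Dn N (Submodule.span F (Set.range y))))) ∨
    (dd N m y = Dn N (Submodule.span F (Set.range y)) ∧
      ∑ w, wstep N χ m y w = -((Fintype.card F : ℂ) ^ m)) := by
  obtain ⟨hli, hst⟩ := Wt_li hy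
  set W := Submodule.span F (Set.range y) with hW
  have hfr : fr W = m := by
    rw [hW]
    have := finrank_span_eq_card hli
    rw [Fintype.card_fin] at this
    exact this
  set C := W.comap N with hC
  have hWC : fr W ≤ fr C := fr_mono hst
  have hWker : W ≤ LinearMap.ker ((lc (F := F) m y).comp N) := by
    intro w hw
    rw [LinearMap.mem_ker, LinearMap.comp_apply]
    cases m with
    | zero => rfl
    | succ m =>
      exact (lc_ker hli _ (hst hw)).2 (Wt_succ hy hw)
  have hsum : ∑ w, wstep N χ m y w =
      (if C ≤ LinearMap.ker ((lc (F := F) m y).comp N) then (Fintype.card F : ℂ) ^ fr C else 0) -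
        (Fintype.card F : ℂ) ^ m := by
    have e1 := char_sum χ h0 hadd hnt ((lc (F := F) m y).comp N) C
    have e2 := char_sum χ h0 hadd hnt ((lc (F := F) m y).comp N) W
    rw [if_pos hWker, hfr] at e2
    rw [← e1, ← e2, ← Finset.sum_sub_distrib]
    refine Finset.sum_congr rfl fun w _ => ?_
    unfold wstep
    by_cases h1 : w ∈ W
    · rw [if_neg (fun h => h.1 h1), if_pos h1, if_pos (hst h1), sub_self]
    · by_cases h2 : w ∈ C
      · rw [if_pos ⟨h1, h2⟩, if_pos h2, if_neg h1, sub_zero]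
        rfl
      · rw [if_neg (fun h => h2 h.2), if_neg h2, if_neg h1, sub_zero]
  have hD : fr C = m + Dn N W := by
    unfold Dn
    rw [← hC]
    omega
  by_cases hk : C ≤ LinearMap.ker ((lc (F := F) m y).comp N)
  · left
    rw [hsum, if_pos hk, hD]
    refine ⟨?_, by ring⟩
    cases m with
    | zero =>
      have : W = ⊥ := by
        rw [hW, Set.range_eq_empty, Submodule.span_empty]
      rw [this]
      rfl
    | succ m =>
      set U := Submodule.span F (Set.range fun i => y (Fin.castSucc i)) with hU
      have hUW : U ≤ W := by
        rw [hW, span_castSucc]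
        exact le_sup_left
      have hCU : U.comap N = C := by
        refine le_antisymm (Submodule.comap_mono hUW) ?_
        intro w hw
        exact (lc_ker hli _ hw).1 (hk hw)
      have hfU : fr U = m := by
        have := finrank_span_eq_card (linearIndependent_fin_succ'.1 hli).1
        rw [Fintype.card_fin] at this
        exact this
      show Dn N U = _
      have : Dn N U = fr C - m := by
        unfold Dn
        rw [hCU, hfU]
      omega
  · right
    rw [hsum, if_neg hk, zero_sub]
    refine ⟨?_, rfl⟩
    cases m with
    | zero =>
      exact absurd (fun w _ => rfl) hk
    | succ m =>
      set U := Submodule.span F (Set.range fun i => y (Fin.castSucc i)) with hU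
      have hUW : U ≤ W := by
        rw [hW, span_castSucc]
        exact le_sup_left
      have hCU : C ⊓ LinearMap.ker ((lc (F := F) (m + 1) y).comp N) = U.comap N := by
        ext w
        constructor
        · rintro ⟨h1, h2⟩
          exact (lc_ker hli _ h1).1 h2
        · intro h
          exact ⟨hUW h, (lc_ker hli _ (hUW h)).2 h⟩
      have hfU : fr U = m := by
        have := finrank_span_eq_card (linearIndependent_fin_succ'.1 hli).1
        rw [Fintype.card_fin] at this
        exact this
      have hmap : C.map ((lc (F := F) (m + 1) y).comp N) = ⊤ := by
        rcases eq_bot_or_eq_top (C.map ((lc (F := F) (m + 1) y).comp N)) with h | h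
        · exact absurd ((LinearMap.le_ker_iff_map ..).2 h) hk
        · exact h
      have hfm := finrank_map_ker ((lc (F := F) (m + 1) y).comp N) C
      rw [hCU, hmap, finrank_top, Module.finrank_self] at hfm
      show Dn N U = _
      have : Dn N U = fr (U.comap N) - m := by
        unfold Dn
        rw [hfU]
      have h3 : fr C = 1 + fr (U.comap N) := hfm
      omega

def Ef (N : Module.End F V) (χ : F → ℂ) (m : ℕ) : ℂ := ∑ y : Fin m → V, Wt N χ m y

def Gf (q : ℂ) (k m d : ℕ) : ℂ :=
  (-1) ^ k * q ^ (∑ i ∈ Finset.range k, (m + i)) * ∏ i ∈ Finset.range (d - 1), (1 - q ^ (i + 1))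

lemma Dn_pos (N : Module.End F V) (hN : IsNilpotent N) (W : Submodule F V)
    (hst : W ≤ W.comap N) (hW : fr W < Module.finrank F V) : 1 ≤ Dn N W := by
  by_contra h
  have h1 : fr (W.comap N) ≤ fr W := by
    unfold Dn at h
    omega
  have h2 : W = W.comap N := eq_of_fr hst h1
  have h3 : ∀ k v, (N ^ k) v ∈ W → v ∈ W := by
    intro k
    induction k with
    | zero => intro v hv; simpa using hv
    | succ k ih =>
      intro v hv
      refine ih v ?_
      rw [h2]
      rw [pow_succ'] at hv
      exact hv
  obtain ⟨k, hk⟩ := hN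
  have : W = ⊤ := by
    rw [eq_top_iff]
    intro v _
    refine h3 k v ?_
    rw [hk]
    exact W.zero_mem
  rw [this] at hW
  simp [fr] at hW

lemma gg_rec (N : Module.End F V) (hN : IsNilpotent N) (χ : F → ℂ) (h0 : χ 0 = 1)
    (hadd : ∀ a b, χ (a + b) = χ a * χ b) (hnt : ∃ t, χ t ≠ 1) : ∀ (k m : ℕ),
    m + k = Module.finrank F V →
      Ef N χ (m + k) = ∑ y : Fin m → V, Wt N χ m y * Gf (Fintype.card F) k m (dd N m y) := by
  intro k
  induction k with
  | zero =>
    intro m hm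
    unfold Ef
    refine Finset.sum_congr rfl fun y _ => ?_
    by_cases hy : Wt N χ m y = 0
    · show Wt N χ m y = _
      rw [hy, zero_mul]
    · have hd : dd N m y - 1 = 0 := by
        have hli := (Wt_li hy).1
        cases m with
        | zero =>
          show Dn N ⊥ + 1 - 1 = 0
          unfold Dn
          have := Submodule.finrank_le ((⊥ : Submodule F V).comap N)
          simp only [fr]
          omega
        | succ m =>
          show Dn N _ - 1 = 0
          have hfU := finrank_span_eq_card (linearIndependent_fin_succ'.1 hli).1
          rw [Fintype.card_fin] at hfU
          unfold Dn
          have := Submodule.finrank_le ((Submodule.span F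
            (Set.range fun i => y (Fin.castSucc i))).comap N)
          simp only [fr]
          have e : Module.finrank F (Submodule.span F (Set.range fun i => y (Fin.castSucc i))) = m :=
            hfU
          omega
      unfold Gf
      rw [hd]
      simp
  | succ k ih =>
    intro m hm
    rw [show m + (k + 1) = m + 1 + k by ring, ih (m + 1) (by omega)]
    rw [← Equiv.sum_comp (Fin.snocEquiv (fun _ => V)), Fintype.sum_prod_type_right]
    refine Finset.sum_congr rfl fun y _ => ?_
    have e : ∀ w : V, Wt N χ (m + 1) (Fin.snocEquiv (fun _ => V) (w, y)) *
        Gf (Fintype.card F) k (m + 1) (dd N (m + 1) (Fin.snocEquiv (fun _ => V) (w, y))) =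
        Wt N χ m y * Gf (Fintype.card F) k (m + 1) (Dn N (Submodule.span F (Set.range y))) *
          wstep N χ m y w := by
      intro w
      have e1 : (fun i : Fin m => (Fin.snocEquiv (fun _ => V) (w, y) : Fin (m + 1) → V)
          (Fin.castSucc i)) = y := by
        funext i
        simp [Fin.snocEquiv]
      have e2 : (Fin.snocEquiv (fun _ => V) (w, y) : Fin (m + 1) → V) (Fin.last m) = w := by
        simp [Fin.snocEquiv]
      simp only [Wt, dd]
      rw [e1, e2]
      ring
    refine (Finset.sum_congr rfl fun w _ => e w).trans ?_
    rw [← Finset.mul_sum]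
    by_cases hy : Wt N χ m y = 0
    · rw [hy]; ring
    · have hD : 1 ≤ Dn N (Submodule.span F (Set.range y)) := by
        refine Dn_pos N hN _ (Wt_li hy).2 ?_
        have hfU := finrank_span_eq_card (Wt_li hy).1
        rw [Fintype.card_fin] at hfU
        have e : fr (Submodule.span F (Set.range y)) = m := hfU
        omega
      have hexp : ∑ i ∈ Finset.range (k + 1), (m + i) = m + ∑ i ∈ Finset.range k, (m + 1 + i) := by
        rw [Finset.sum_range_succ', add_comm]
        congr 1
        exact Finset.sum_congr rfl fun i _ => by ring
      rw [mul_assoc]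
      congr 1
      unfold Gf
      rw [hexp]
      rcases wstep_sum N χ h0 hadd hnt m y hy with ⟨h1, h2⟩ | ⟨h1, h2⟩
      · rw [h2, h1]
        obtain ⟨D, hDD⟩ : ∃ D, Dn N (Submodule.span F (Set.range y)) = D + 1 :=
          ⟨Dn N (Submodule.span F (Set.range y)) - 1, by omega⟩
        rw [hDD]
        simp only [Nat.add_sub_cancel]
        rw [Finset.prod_range_succ, pow_add _ m]
        ring
      · rw [h2, h1, pow_add _ m]
        ring

theorem gg_total (N : Module.End F V) (hN : IsNilpotent N) (χ : F → ℂ) (h0 : χ 0 = 1)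
    (hadd : ∀ a b, χ (a + b) = χ a * χ b) (hnt : ∃ t, χ t ≠ 1) (n : ℕ)
    (hn : Module.finrank F V = n) :
    ∑ y : Fin n → V, Wt N χ n y = (Fintype.card F : ℂ) ^ (∑ i ∈ Finset.range n, i) * ((-1) ^ n *
      ∏ i ∈ Finset.range (fr (LinearMap.ker N)), (1 - (Fintype.card F : ℂ) ^ (i + 1))) := by
  have h := gg_rec N hN χ h0 hadd hnt n 0 (by omega)
  rw [Nat.zero_add] at h
  show Ef N χ n = _
  rw [h, Fintype.sum_unique]
  simp only [Wt, dd, Gf, zero_add, one_mul, Nat.add_sub_cancel]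
  have : Dn N ⊥ = fr (LinearMap.ker N) := by
    unfold Dn
    have e : fr (⊥ : Submodule F V) = 0 := finrank_bot F V
    rw [e]
    rfl
  rw [this]
  ring
end gg

/-! #### Matrices and ranks -/

lemma rank_map_field {K L : Type*} [Field K] [Field L] (f : K →+* L) {n : ℕ}
    (M : Matrix (Fin n) (Fin n) K) : (f.mapMatrix M).rank = M.rank := by
  obtain ⟨L1, L2, D, hM⟩ := Matrix.Pivot.exists_list_transvec_mul_diagonal_mul_list_transvec M
  have key : ∀ P : Matrix (Fin n) (Fin n) K, P.det = 1 → (f.mapMatrix P).det ≠ 0 := by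
    intro P hP
    rw [← RingHom.map_det, hP, map_one]
    exact one_ne_zero
  have d1 := Matrix.TransvectionStruct.det_toMatrix_prod L1
  have d2 := Matrix.TransvectionStruct.det_toMatrix_prod L2
  rw [hM, map_mul, map_mul, Matrix.rank_mul_eq_left_of_det_ne_zero _ _ (key _ d2),
    Matrix.rank_mul_eq_right_of_det_ne_zero _ _ (key _ d1),
    Matrix.rank_mul_eq_left_of_det_ne_zero _ _ (by rw [d2]; exact one_ne_zero),
    Matrix.rank_mul_eq_right_of_det_ne_zero _ _ (by rw [d1]; exact one_ne_zero),
    RingHom.mapMatrix_apply, Matrix.diagonal_map (map_zero f), Matrix.rank_diagonal,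
    Matrix.rank_diagonal]
  refine Fintype.card_congr (Equiv.subtypeEquivRight fun i => ?_)
  simp

lemma exists_mult : ∀ (K : ℕ) (r : ℕ → ℕ), (∀ k, K ≤ k → r k = 0) →
    (∀ k, 2 * r (k + 1) ≤ r k + r (k + 2)) →
    ∃ m : ℕ →₀ ℕ, ∀ k, (m.sum fun j e => (j + 1 - k) * e) = r k := by
  intro K
  induction K with
  | zero =>
    intro r h0 _
    exact ⟨0, fun k => by rw [Finsupp.sum_zero_index, h0 k (Nat.zero_le _)]⟩
  | succ K ih =>
    intro r h0 hc
    obtain ⟨m, hm⟩ := ih (fun k => r (k + 1)) (fun k hk => h0 _ (by omega)) (fun k => hc _)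
    refine ⟨Finsupp.single 0 (r 0 + r 2 - 2 * r 1) + m.mapDomain (· + 1), fun k => ?_⟩
    rw [Finsupp.sum_add_index' (fun _ => mul_zero _) (fun _ _ _ => mul_add _ _ _),
      Finsupp.sum_single_index (mul_zero _),
      Finsupp.sum_mapDomain_index (fun _ => mul_zero _) (fun _ _ _ => mul_add _ _ _)]
    cases k with
    | zero =>
      have e0 := hm 0
      have e1 := hm 1
      have hs : (m.sum fun j e => (j + 1 + 1 - 0) * e) + (m.sum fun j e => (j + 1 - 1) * e) =
          (m.sum fun j e => (j + 1 - 0) * e) + (m.sum fun j e => (j + 1 - 0) * e) := by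
        unfold Finsupp.sum
        rw [← Finset.sum_add_distrib, ← Finset.sum_add_distrib]
        refine Finset.sum_congr rfl fun j _ => ?_
        simp only [Nat.add_sub_cancel, Nat.sub_zero]
        ring
      have h2 := hc 0
      simp only [zero_add] at e0 e1 h2
      rw [e0, e1] at hs
      simp only [zero_add, Nat.sub_zero, one_mul] at hs ⊢
      have : r (1 + 1) = r 2 := rfl
      omega
    | succ k =>
      have : (m.sum fun j e => (j + 1 + 1 - (k + 1)) * e) = r (k + 1) := by
        rw [← hm k]
        refine Finsupp.sum_congr fun j _ => ?_
        rw [Nat.add_sub_add_right]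
      rw [this]
      simp

section gg
variable {F : Type*} [Field F] [Fintype F] {V : Type*} [AddCommGroup V] [Module F V] [Fintype V]

lemma exists_type (N : Module.End F V) (hN : IsNilpotent N) :
    ∃ mu : Partn, ∀ k, fr ((⊤ : Submodule F V).map (N ^ k)) = rk k (dF mu) := by
  obtain ⟨K, hK⟩ := hN
  have hs : ∀ k, (⊤ : Submodule F V).map (N ^ (k + 1)) = ((⊤ : Submodule F V).map (N ^ k)).map N := by
    intro k
    rw [pow_succ', Module.End.mul_eq_comp, Submodule.map_comp]
  have hle : ∀ k, (⊤ : Submodule F V).map (N ^ (k + 1)) ≤ (⊤ : Submodule F V).map (N ^ k) := by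
    intro k
    rw [pow_succ, Module.End.mul_eq_comp, Submodule.map_comp]
    exact Submodule.map_mono le_top
  obtain ⟨m, hm⟩ := exists_mult K (fun k => fr ((⊤ : Submodule F V).map (N ^ k))) (by
    intro k hk
    have : N ^ k = 0 := pow_eq_zero_of_le hk hK
    show fr ((⊤ : Submodule F V).map (N ^ k)) = 0
    rw [this, Submodule.map_zero]
    exact finrank_bot F V) (by
    intro k
    have h1 := finrank_map_ker N ((⊤ : Submodule F V).map (N ^ k))
    have h2 := finrank_map_ker N ((⊤ : Submodule F V).map (N ^ (k + 1)))
    rw [← hs] at h1 h2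
    have h3 : fr ((⊤ : Submodule F V).map (N ^ (k + 1)) ⊓ LinearMap.ker N) ≤
      fr ((⊤ : Submodule F V).map (N ^ k) ⊓ LinearMap.ker N) :=
      fr_mono (inf_le_inf_right _ (hle k))
    simp only [fr] at h3 ⊢
    have e : k + 1 + 1 = k + 2 := rfl
    rw [e] at h2
    omega)
  obtain ⟨l, rfl⟩ := pm_surj m
  refine ⟨l, fun k => ?_⟩
  rw [rk_dF_pm, hm k]

def sdS {m : ℕ} (M : Matrix (Fin m) (Fin m) F) : F :=
  ∑ i : Fin m, ∑ j : Fin m, if (j : ℕ) = (i : ℕ) + 1 then M i j else 0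

lemma Wt_eq (N : Module.End F V) (χ : F → ℂ) (h0 : χ 0 = 1)
    (hadd : ∀ a b, χ (a + b) = χ a * χ b) : ∀ (m : ℕ) (y : Fin m → V)
    (M : Matrix (Fin m) (Fin m) F), LinearIndependent F y → (∀ i j, j ≤ i → M i j = 0) →
    (∀ j, N (y j) = ∑ i, M i j • y i) → Wt N χ m y = χ (sdS M)
  | 0, y, M, _, _, _ => by
      simp [Wt, sdS, h0]
  | m + 1, y, M, hli, hM, hN => by
      have hli' := linearIndependent_fin_succ'.1 hli
      have ih := Wt_eq N χ h0 hadd m (fun i => y (Fin.castSucc i))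
        (fun i j => M (Fin.castSucc i) (Fin.castSucc j)) hli'.1
        (fun i j hij => hM _ _ (by simpa using hij)) (by
          intro j
          rw [hN, Fin.sum_univ_castSucc, hM (Fin.last m) _ (Fin.le_last _), zero_smul, add_zero])
      have hNl : N (y (Fin.last m)) = ∑ i : Fin m, M (Fin.castSucc i) (Fin.last m) •
          y (Fin.castSucc i) := by
        rw [hN, Fin.sum_univ_castSucc, hM (Fin.last m) _ le_rfl, zero_smul, add_zero]
      have hlc : lc (F := F) m (fun i => y (Fin.castSucc i)) (N (y (Fin.last m))) =
          ∑ i : Fin m, if m = (i : ℕ) + 1 then M (Fin.castSucc i) (Fin.last m) else 0 := by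
        rw [hNl, map_sum]
        refine Finset.sum_congr rfl fun i _ => ?_
        rw [map_smul]
        cases m with
        | zero => exact i.elim0
        | succ m =>
          have hz : LinearIndependent F (fun i : Fin (m + 1) => y (Fin.castSucc i)) := hli'.1
          obtain ⟨s1, s2⟩ := lc_spec hz
          beta_reduce at s1 s2
          induction i using Fin.lastCases with
          | last =>
            rw [s2]
            simp
          | cast i =>
            rw [s1, if_neg, smul_zero]
            have := i.2
            simp only [Fin.val_castSucc]
            omega
      have hsd : sdS M = sdS (fun i j => M (Fin.castSucc i) (Fin.castSucc j)) +
          ∑ i : Fin m, if m = (i : ℕ) + 1 then M (Fin.castSucc i) (Fin.last m) else 0 := by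
        unfold sdS
        rw [Fin.sum_univ_castSucc, ← Finset.sum_add_distrib]
        have : ∑ j : Fin (m + 1), (if (j : ℕ) = ((Fin.last m : Fin (m + 1)) : ℕ) + 1 then
            M (Fin.last m) j else 0) = 0 := by
          refine Finset.sum_eq_zero fun j _ => ?_
          rw [if_neg]
          have := j.2
          simp only [Fin.val_last]
          omega
        rw [this, add_zero]
        refine Finset.sum_congr rfl fun i _ => ?_
        rw [Fin.sum_univ_castSucc]
        simp
      have hw : wstep N χ m (fun i => y (Fin.castSucc i)) (y (Fin.last m)) =
          χ (lc (F := F) m (fun i => y (Fin.castSucc i)) (N (y (Fin.last m)))) := by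
        unfold wstep
        rw [if_pos]
        refine ⟨hli'.2, ?_⟩
        rw [hNl]
        exact Submodule.sum_mem _ fun i _ => Submodule.smul_mem _ _ (Submodule.subset_span ⟨i, rfl⟩)
      show Wt N χ m _ * _ = _
      rw [ih, hw, hlc, hsd, hadd]

lemma Wt_mat (N : Module.End F V) (χ : F → ℂ) : ∀ (m : ℕ) (y : Fin m → V), Wt N χ m y ≠ 0 →
    ∃ M : Matrix (Fin m) (Fin m) F, (∀ i j, j ≤ i → M i j = 0) ∧ ∀ j, N (y j) = ∑ i, M i j • y i
  | 0, y, _ => ⟨0, fun i => i.elim0, fun j => j.elim0⟩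
  | m + 1, y, h => by
      have hh : Wt N χ m (fun i => y (Fin.castSucc i)) *
        wstep N χ m (fun i => y (Fin.castSucc i)) (y (Fin.last m)) ≠ 0 := h
      obtain ⟨M, hM1, hM2⟩ := Wt_mat N χ m _ (left_ne_zero_of_mul hh)
      obtain ⟨_, h4⟩ := wstep_ne (right_ne_zero_of_mul hh)
      obtain ⟨c, hc⟩ := (Submodule.mem_span_range_iff_exists_fun F).1 h4
      refine ⟨fun i j => Fin.lastCases (motive := fun _ => F) 0 (fun i' =>
        Fin.lastCases (motive := fun _ => F) (c i') (fun j' => M i' j') j) i, ?_, ?_⟩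
      · intro i j hij
        induction i using Fin.lastCases with
        | last => simp
        | cast i =>
          induction j using Fin.lastCases with
          | last => exact absurd hij (by simp)
          | cast j =>
            simp only [Fin.lastCases_castSucc]
            exact hM1 _ _ (by simpa using hij)
      · intro j
        rw [Fin.sum_univ_castSucc]
        induction j using Fin.lastCases with
        | last => simp [← hc]
        | cast j => simp [hM2]

lemma strict_nilp {n : ℕ} (M : Matrix (Fin n) (Fin n) F) (hM : ∀ i j, j ≤ i → M i j = 0) :
    M ^ n = 0 := by
  have : ∀ k : ℕ, ∀ i j : Fin n, (j : ℕ) < (i : ℕ) + k → (M ^ k) i j = 0 := by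
    intro k
    induction k with
    | zero =>
      intro i j h
      rw [pow_zero, Matrix.one_apply_ne]
      rintro rfl
      omega
    | succ k ih =>
      intro i j h
      rw [pow_succ, Matrix.mul_apply]
      refine Finset.sum_eq_zero fun l _ => ?_
      by_cases hl : (l : ℕ) < (i : ℕ) + k
      · rw [ih i l hl, zero_mul]
      · rw [hM l j (by rw [Fin.le_def]; omega), mul_zero]
  ext i j
  exact this n i j (by have := j.2; omega)

end gg

section ab
variable {F : Type*} [Field F] [Fintype F] {n : ℕ}

def UT (F : Type*) [Field F] (n : ℕ) : Set (Matrix (Fin n) (Fin n) F)ˣ :=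
  {u | (∀ i j : Fin n, j < i → u.val i j = 0) ∧ ∀ i : Fin n, u.val i i = 1}

lemma sdS_sub_one (M : Matrix (Fin n) (Fin n) F) : sdS (M - 1) = sdS M := by
  unfold sdS
  refine Finset.sum_congr rfl fun i _ => Finset.sum_congr rfl fun j _ => ?_
  split_ifs with h
  · rw [Matrix.sub_apply, Matrix.one_apply_ne, sub_zero]
    rintro rfl
    omega
  · rfl

def cols (x : (Matrix (Fin n) (Fin n) F)ˣ) : Fin n → (Fin n → F) := fun j i => x.val i j

lemma cols_inj : Function.Injective (cols : (Matrix (Fin n) (Fin n) F)ˣ → _) := by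
  intro x y h
  apply Units.ext
  ext i j
  exact congrFun (congrFun h j) i

lemma cols_li (x : (Matrix (Fin n) (Fin n) F)ˣ) : LinearIndependent F (cols x) := by
  have := (Matrix.linearIndependent_cols_iff_isUnit (A := x.val)).2 x.isUnit
  exact this

lemma cols_surj (y : Fin n → (Fin n → F)) (h : LinearIndependent F y) : ∃ x, cols x = y := by
  have : IsUnit (Matrix.of fun i j => y j i : Matrix (Fin n) (Fin n) F) :=
    (Matrix.linearIndependent_cols_iff_isUnit (A := (Matrix.of fun i j => y j i : Matrix (Fin n) (Fin n) F))).1 h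
  obtain ⟨x, hx⟩ := this
  refine ⟨x, ?_⟩
  funext j i
  show x.val i j = _
  rw [hx]
  rfl

lemma cols_eq (B : Matrix (Fin n) (Fin n) F) (x : (Matrix (Fin n) (Fin n) F)ˣ)
    (M : Matrix (Fin n) (Fin n) F) :
    (∀ j, Matrix.toLin' B (cols x j) = ∑ i, M i j • cols x i) ↔ B * x.val = x.val * M := by
  constructor
  · intro h
    ext i j
    have := congrFun (h j) i
    rw [Matrix.toLin'_apply, Finset.sum_apply] at this
    simp only [Pi.smul_apply, smul_eq_mul] at this
    rw [Matrix.mul_apply, Matrix.mul_apply]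
    simp only [mul_comm (x.val i _)]
    exact this
  · intro h j
    funext i
    have := congrFun (congrFun h i) j
    rw [Matrix.mul_apply, Matrix.mul_apply] at this
    simp only [mul_comm (x.val i _)] at this
    rw [Matrix.toLin'_apply, Finset.sum_apply]
    exact this

lemma conj_eq (g x : (Matrix (Fin n) (Fin n) F)ˣ) (M : Matrix (Fin n) (Fin n) F) :
    (g.val - 1) * x.val = x.val * M ↔ (x⁻¹ * g * x).val - 1 = M := by
  have e : (x⁻¹ * g * x).val - 1 = x⁻¹.val * ((g.val - 1) * x.val) := by
    rw [sub_mul, mul_sub, one_mul, Units.inv_mul, Units.val_mul, Units.val_mul, mul_assoc]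
  rw [e]
  constructor
  · intro h
    rw [h, ← mul_assoc, Units.inv_mul, one_mul]
  · intro h
    rw [← h, ← mul_assoc x.val, Units.mul_inv, one_mul]

lemma mem_UT (u : (Matrix (Fin n) (Fin n) F)ˣ) :
    u ∈ UT F n ↔ ∀ i j, j ≤ i → (u.val - 1) i j = 0 := by
  constructor
  · rintro ⟨h1, h2⟩ i j hij
    rw [Matrix.sub_apply]
    rcases hij.lt_or_eq with h | rfl
    · rw [h1 i j h, Matrix.one_apply_ne h.ne', sub_zero]
    · rw [h2, Matrix.one_apply_eq, sub_self]
  · intro h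
    refine ⟨fun i j hij => ?_, fun i => ?_⟩
    · have := h i j hij.le
      rwa [Matrix.sub_apply, Matrix.one_apply_ne hij.ne', sub_zero] at this
    · have := h i i le_rfl
      rwa [Matrix.sub_apply, Matrix.one_apply_eq, sub_eq_zero] at this

lemma term_eq (χ : F → ℂ) (h0 : χ 0 = 1) (hadd : ∀ a b, χ (a + b) = χ a * χ b)
    (g x : (Matrix (Fin n) (Fin n) F)ˣ) :
    (if x⁻¹ * g * x ∈ UT F n then χ (sdS (x⁻¹ * g * x).val) else 0) =
      Wt (Matrix.toLin' (g.val - 1)) χ n (cols x) := by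
  split_ifs with h
  · rw [mem_UT] at h
    rw [← sdS_sub_one]
    refine (Wt_eq _ χ h0 hadd n (cols x) _ (cols_li x) h ?_).symm
    exact (cols_eq _ x _).2 ((conj_eq g x _).2 rfl)
  · by_contra hne
    obtain ⟨M, hM, hM2⟩ := Wt_mat (Matrix.toLin' (g.val - 1)) χ n (cols x) (Ne.symm hne)
    apply h
    rw [mem_UT, (conj_eq g x M).1 ((cols_eq _ x _).1 hM2)]
    exact hM

lemma sum_UT (χ : F → ℂ) (h0 : χ 0 = 1) (hadd : ∀ a b, χ (a + b) = χ a * χ b)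
    (g : (Matrix (Fin n) (Fin n) F)ˣ) :
    (∑ᶠ x : (Matrix (Fin n) (Fin n) F)ˣ,
      if x⁻¹ * g * x ∈ UT F n then χ (sdS (x⁻¹ * g * x).val) else 0) =
      ∑ y : Fin n → (Fin n → F), Wt (Matrix.toLin' (g.val - 1)) χ n y := by
  simp only [term_eq χ h0 hadd g]
  rw [← finsum_mem_range (f := fun y : Fin n → Fin n → F => Wt (Matrix.toLin' (g.val - 1) : Module.End F (Fin n → F)) χ n y) cols_inj,
    ← finsum_eq_sum_of_fintype]
  apply finsum_congr
  intro y
  by_cases hy : y ∈ Set.range (cols : (Matrix (Fin n) (Fin n) F)ˣ → _)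
  · rw [finsum_eq_if, if_pos hy]
  · rw [finsum_eq_if, if_neg hy]
    by_contra hne
    exact hy (cols_surj y (Wt_li (Ne.symm hne)).1)

lemma UT_nilp (g x : (Matrix (Fin n) (Fin n) F)ˣ) (h : x⁻¹ * g * x ∈ UT F n) :
    (g.val - 1) ^ n = 0 := by
  have h1 := strict_nilp _ ((mem_UT _).1 h)
  have h2 := (conj_eq g x _).2 rfl
  have : ∀ k, (g.val - 1) ^ k * x.val = x.val * ((x⁻¹ * g * x).val - 1) ^ k := by
    intro k
    induction k with
    | zero => simp
    | succ k ih => rw [pow_succ, mul_assoc, h2, ← mul_assoc, ih, mul_assoc, ← pow_succ]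
  have h3 := this n
  rw [h1, mul_zero] at h3
  calc (g.val - 1) ^ n = (g.val - 1) ^ n * x.val * x⁻¹.val := by
        rw [mul_assoc, Units.mul_inv, mul_one]
    _ = 0 := by rw [h3, zero_mul]

def utMat (c : {p : Fin n × Fin n // p.1 < p.2} → F) : Matrix (Fin n) (Fin n) F :=
  Matrix.of fun i j => if h : i < j then c ⟨(i, j), h⟩ else if i = j then 1 else 0

lemma utMat_unit (c : {p : Fin n × Fin n // p.1 < p.2} → F) : IsUnit (utMat c) := by
  rw [Matrix.isUnit_iff_isUnit_det, Matrix.det_of_isUpperTriangular]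
  · simp [utMat]
  · intro i j hij
    have hij' : j < i := hij
    simp [utMat, hij'.not_gt, hij'.ne']

lemma card_UT : Nat.card (UT F n) = (Fintype.card F) ^ (∑ i ∈ Finset.range n, i) := by
  have e : UT F n ≃ ({p : Fin n × Fin n // p.1 < p.2} → F) :=
    { toFun := fun u p => u.val.val p.1.1 p.1.2
      invFun := fun c => ⟨(utMat_unit c).unit, by
        refine ⟨fun i j hij => ?_, fun i => ?_⟩
        · simp [utMat, hij.not_gt, hij.ne']
        · simp [utMat]⟩
      left_inv := by
        rintro ⟨u, h1, h2⟩
        apply Subtype.ext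
        apply Units.ext
        ext i j
        show utMat (fun p : {p : Fin n × Fin n // p.1 < p.2} => u.val p.1.1 p.1.2) i j = u.val i j
        unfold utMat
        rw [Matrix.of_apply]
        split_ifs with h3 h4
        · rfl
        · rw [h4, h2]
        · rw [h1]
          exact lt_of_le_of_ne (not_lt.1 h3) (Ne.symm h4)
      right_inv := by
        intro c
        funext p
        show utMat c _ _ = _
        unfold utMat
        rw [Matrix.of_apply, dif_pos p.2] }
  rw [Nat.card_congr e, Nat.card_eq_fintype_card, Fintype.card_fun]
  congr 1
  have e2 : {p : Fin n × Fin n // p.1 < p.2} ≃ Σ j : Fin n, {i : Fin n // i < j} :=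
    { toFun := fun p => ⟨p.1.2, ⟨p.1.1, p.2⟩⟩
      invFun := fun s => ⟨(s.2.1, s.1), s.2.2⟩
      left_inv := fun _ => rfl
      right_inv := fun _ => rfl }
  rw [Fintype.card_congr e2, Fintype.card_sigma, ← Fin.sum_univ_eq_sum_range (fun i => i)]
  refine Finset.sum_congr rfl fun j _ => ?_
  rw [Fintype.card_subtype]
  have : (Finset.univ.filter fun i : Fin n => i < j) = Finset.Iio j := by ext; simp
  rw [this, Fin.card_Iio]

lemma rank_fr (B : Matrix (Fin n) (Fin n) F) (k : ℕ) :
    (B ^ k).rank = fr ((⊤ : Submodule F (Fin n → F)).map ((Matrix.toLin' B : Module.End F (Fin n → F)) ^ k)) := by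
  rw [← Matrix.toLin'_pow, Submodule.map_top]
  rfl

end ab

section fq
variable (p : ℕ) [Fact p.Prime] (r n : ℕ)

abbrev Fq : Subfield (Fbar p) := (frobPow p r).eqLocusField (RingHom.id (Fbar p))

lemma frobPow_apply (a : Fbar p) : frobPow p r a = a ^ p ^ r := by
  unfold frobPow
  exact iterateFrobenius_def ..

lemma mem_Fq (a : Fbar p) : a ∈ Fq p r ↔ a ^ p ^ r = a := by
  rw [← frobPow_apply]
  exact RingHom.mem_eqLocusField

lemma fq_card_aux (hr : 0 < r) : Nat.card (Fq p r) = p ^ r := by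
  have hp : 1 < p := (Fact.out : p.Prime).one_lt
  have key : Fintype.card ((Polynomial.X ^ p ^ r - Polynomial.X : Polynomial (ZMod p)).rootSet (Fbar p)) = _ :=
    Polynomial.card_rootSet_eq_natDegree (K := Fbar p)
    (galois_poly_separable (K := ZMod p) p (p ^ r) (dvd_pow_self p hr.ne'))
    (IsAlgClosed.splits _)
  rw [FiniteField.X_pow_card_pow_sub_X_natDegree_eq _ hr.ne' hp] at key
  rw [← key, ← Nat.card_eq_fintype_card]
  refine Nat.card_congr (Equiv.subtypeEquivRight fun a => ?_)
  rw [mem_Fq, Polynomial.mem_rootSet_of_ne (FiniteField.X_pow_card_pow_sub_X_ne_zero _ hr.ne' hp)]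
  simp [sub_eq_zero]

@[reducible] def fqFintype (hr : 0 < r) : Fintype (Fq p r) :=
  haveI : Finite (Fq p r) := Nat.finite_of_card_ne_zero (by
    rw [fq_card_aux p r hr]
    exact pow_ne_zero _ (Fact.out : p.Prime).ne_zero)
  Fintype.ofFinite _

lemma fq_card (hr : 0 < r) : @Fintype.card (Fq p r) (fqFintype p r hr) = p ^ r := by
  rw [← fq_card_aux p r hr]
  exact (@Nat.card_eq_fintype_card _ (fqFintype p r hr)).symm

lemma glfix_entry (u : GLfix p r n) (i j : Fin n) : matOf u i j ∈ Fq p r := by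
  have h : entryFrobGL p r n u.1 = u.1 := u.2
  have h1 : (entryFrobGL p r n u.1).val = u.1.val := by rw [h]
  have h2 := congrFun (congrFun h1 i) j
  exact RingHom.mem_eqLocusField.2 h2

def dMat (u : GLfix p r n) : Matrix (Fin n) (Fin n) (Fq p r) :=
  Matrix.of fun i j => ⟨matOf u i j, glfix_entry p r n u i j⟩

lemma dMat_map (u : GLfix p r n) : (Fq p r).subtype.mapMatrix (dMat p r n u) = matOf u := rfl

lemma map_injF : Function.Injective ((Fq p r).subtype.mapMatrix :
    Matrix (Fin n) (Fin n) (Fq p r) →+* Matrix (Fin n) (Fin n) (Fbar p)) := by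
  intro A B h
  ext i j
  exact congrFun (congrFun h i) j

lemma dMat_mul (u v : GLfix p r n) : dMat p r n (u * v) = dMat p r n u * dMat p r n v := by
  apply map_injF
  rw [map_mul, dMat_map, dMat_map, dMat_map]
  rfl

lemma dMat_one : dMat p r n 1 = 1 := by
  apply map_injF
  rw [map_one, dMat_map]
  rfl

def desc : GLfix p r n ≃* (Matrix (Fin n) (Fin n) (Fq p r))ˣ where
  toFun u := ⟨dMat p r n u, dMat p r n u⁻¹, by rw [← dMat_mul, mul_inv_cancel, dMat_one],
    by rw [← dMat_mul, inv_mul_cancel, dMat_one]⟩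
  invFun x := ⟨Units.map ((Fq p r).subtype.mapMatrix.toMonoidHom) x, by
    show entryFrobGL p r n _ = _
    apply Units.ext
    ext i j
    exact RingHom.mem_eqLocusField.1 (x.val i j).2⟩
  left_inv u := by
    apply Subtype.ext
    apply Units.ext
    rfl
  right_inv x := by
    apply Units.ext
    rfl
  map_mul' u v := by
    apply Units.ext
    exact dMat_mul p r n u v

lemma desc_map (u : GLfix p r n) : (Fq p r).subtype.mapMatrix (desc p r n u).val = matOf u := rfl

lemma desc_UT (u : GLfix p r n) : desc p r n u ∈ UT (Fq p r) n ↔ u ∈ unitri (GLfix p r n) := by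
  refine and_congr (forall_congr' fun i => forall_congr' fun j => imp_congr_right fun _ => ?_)
    (forall_congr' fun i => ?_)
  · exact Subtype.ext_iff
  · exact Subtype.ext_iff

lemma desc_sd (u : GLfix p r n) : ((sdS (desc p r n u).val : Fq p r) : Fbar p) = sdSumGL p r n u := by
  show (Fq p r).subtype _ = _
  unfold sdS sdSumGL
  rw [map_sum]
  refine Finset.sum_congr rfl fun i _ => ?_
  rw [map_sum]
  refine Finset.sum_congr rfl fun j _ => ?_
  rw [apply_ite (Fq p r).subtype, map_zero]
  rfl

end fq

/-- The Gelfand–Graev character `Γ̃_(n)` of `GL(n, F_q)` vanishes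
on non-unipotent classes, and on a unipotent class of type `μ ⊢ n` takes the value
`∑_{ν ⊢ n} ((-1)^{n - ℓ(ν)}/z_ν) |T̃_ν| Q_ν^μ(q)`.  The Green functions `Q_ν^μ(q)`
are abstracted as the coefficients `Qval` of the expansion of the power sums in the
Hall–Littlewood basis at `t = q⁻¹`, the Hall–Littlewood functions being characterized by
unitriangularity with respect to the monomial symmetric functions and orthogonality. -/
theorem gelfandGraev_green_GL
    (p : ℕ) [Fact p.Prime] (fexp : ℕ) (hf : 0 < fexp) (n : ℕ)
    (ψ0 : Fbar p → ℂ)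
    (hψ0_zero : ψ0 0 = 1)
    (hψ0_add : ∀ a b : Fbar p, a ^ p ^ fexp = a → b ^ p ^ fexp = b →
      ψ0 (a + b) = ψ0 a * ψ0 b)
    (hψ0_nt : ∃ t : Fbar p, t ^ p ^ fexp = t ∧ ψ0 t ≠ 1)
    (PHL : Partn → MvPowerSeries ℕ ℂ)
    (Bform : MvPowerSeries ℕ ℂ →ₗ[ℂ] MvPowerSeries ℕ ℂ →ₗ[ℂ] ℂ)
    (hHL_tri : ∀ mu : Partn, ∃ c : Partn → ℂ,
      PHL mu = msym mu + ∑ᶠ l : Partn, (if DomLt l mu then c l else 0) • msym l)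
    (hB_pow : ∀ l m : Partn, Bform (psym l) (psym m) =
      if l = m then (l.zee : ℂ) *
        ∏ i ∈ Finset.range l.len, (1 - ((p : ℂ) ^ fexp)⁻¹ ^ l.parts (i + 1))⁻¹
      else 0)
    (hHL_orth : ∀ l m : Partn, l ≠ m → Bform (PHL l) (PHL m) = 0)
    (Qval : Partn → Partn → ℂ)
    (hGreen : ∀ nu : Partn, psym nu = ∑ᶠ mu : Partn,
      if mu.size = nu.size then (Qval nu mu * ((p : ℂ) ^ fexp)⁻¹ ^ mu.nstat) • PHL mu
      else 0)
    (g : ↥(GLfix p fexp n)) :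
    ((∀ mu : Partn, ¬ unipOfType (matOf g) mu) → GammaGL p fexp n ψ0 g = 0) ∧
      ∀ mu : Partn, unipOfType (matOf g) mu →
        GammaGL p fexp n ψ0 g =
          ∑ᶠ nu : Partn, if nu.size = n then
            ((-1 : ℂ) ^ (n - nu.len) / (nu.zee : ℂ)) *
              (∏ i ∈ Finset.range nu.len, (((p : ℂ) ^ fexp) ^ nu.parts (i + 1) - 1)) *
              Qval nu mu
          else 0 := by
  set q : ℂ := (p : ℂ) ^ fexp with hqdef
  letI := fqFintype p fexp hf
  have hcard : (Fintype.card (Fq p fexp) : ℂ) = q := by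
    rw [fq_card p fexp hf]; push_cast; rfl
  have hq0 : q ≠ 0 := by
    rw [hqdef]; exact pow_ne_zero _ (by exact_mod_cast (Fact.out : p.Prime).ne_zero)
  let χ : Fq p fexp → ℂ := fun a => ψ0 a.val
  have h0 : χ 0 = 1 := hψ0_zero
  have hadd : ∀ a b, χ (a + b) = χ a * χ b := fun a b =>
    hψ0_add _ _ ((mem_Fq p fexp _).1 a.2) ((mem_Fq p fexp _).1 b.2)
  have hnt : ∃ t, χ t ≠ 1 := by
    obtain ⟨t, h1, h2⟩ := hψ0_nt
    exact ⟨⟨t, (mem_Fq p fexp t).2 h1⟩, h2⟩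
  have hG : GammaGL p fexp n ψ0 g = (q ^ (∑ i ∈ Finset.range n, i))⁻¹ *
      ∑ᶠ x : (Matrix (Fin n) (Fin n) (Fq p fexp))ˣ,
        if x⁻¹ * desc p fexp n g * x ∈ UT (Fq p fexp) n then
          χ (sdS (x⁻¹ * desc p fexp n g * x).val) else 0 := by
    unfold GammaGL indChar
    congr 1
    · rw [← hcard, ← Nat.cast_pow, ← card_UT (F := Fq p fexp) (n := n)]
      congr 2
      refine Nat.card_congr ((desc p fexp n).toEquiv.subtypeEquiv fun u => ?_)
      exact (desc_UT p fexp n u).symm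
    · rw [← finsum_comp_equiv (desc p fexp n).toEquiv]
      refine finsum_congr fun x => ?_
      have e : ((desc p fexp n).toEquiv x)⁻¹ * desc p fexp n g * (desc p fexp n).toEquiv x =
          desc p fexp n (x⁻¹ * g * x) := by
        rw [map_mul, map_mul, map_inv]; rfl
      rw [e]
      by_cases h : x⁻¹ * g * x ∈ unitri (GLfix p fexp n)
      · rw [if_pos h, if_pos ((desc_UT p fexp n _).2 h)]
        show ψ0 _ = ψ0 _
        rw [desc_sd]
      · rw [if_neg h, if_neg (fun h' => h ((desc_UT p fexp n _).1 h'))]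
  have hun : ∀ mu : Partn, unipOfType (matOf g) mu ↔ ∀ k,
      fr ((⊤ : Submodule (Fq p fexp) (Fin n → Fq p fexp)).map
        ((Matrix.toLin' ((desc p fexp n g).val - 1) : Module.End (Fq p fexp) (Fin n → Fq p fexp)) ^ k)) =
        rk k (dF mu) := by
    intro mu
    refine forall_congr' fun k => ?_
    rw [← rank_fr, ← rk_eq_finsum, ← rank_map_field (Fq p fexp).subtype, map_pow, map_sub, map_one,
      desc_map]
  constructor
  · intro hno
    rw [hG]
    by_contra hne
    have h1 := right_ne_zero_of_mul hne
    obtain ⟨x, hx⟩ := not_forall.1 (fun hz => h1 (finsum_eq_zero_of_forall_eq_zero hz))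
    have hx' : x⁻¹ * desc p fexp n g * x ∈ UT (Fq p fexp) n := by
      by_contra h
      exact hx (if_neg h)
    have hnil := UT_nilp _ x hx'
    obtain ⟨mu, hmu⟩ := exists_type (Matrix.toLin' ((desc p fexp n g).val - 1) :
      Module.End (Fq p fexp) (Fin n → Fq p fexp)) ⟨n, by rw [← Matrix.toLin'_pow, hnil, map_zero]⟩
    exact hno mu ((hun mu).2 hmu)
  · intro mu hmu
    have hrk := (hun mu).1 hmu
    have hsize : mu.size = n := by
      have := hrk 0
      rw [← size_eq_rk, pow_zero, Module.End.one_eq_id, Submodule.map_id, fr, finrank_top] at this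
      rw [← this, Module.finrank_fin_fun]
    have hnil : IsNilpotent (Matrix.toLin' ((desc p fexp n g).val - 1) :
      Module.End (Fq p fexp) (Fin n → Fq p fexp)) := by
      refine ⟨n, ?_⟩
      have h1 := hrk n
      rw [← rk_eq_finsum] at h1
      have h2 : ∑ᶠ i, (mu.parts i - n) = 0 := by
        rw [finsum_eq_zero_of_forall_eq_zero]
        intro i
        have : mu.parts i ≤ n := by
          rw [← hsize]
          exact single_le_finsum i mu.parts_finite (fun _ => Nat.zero_le _)
        omega
      rw [h2, Submodule.map_top] at h1
      exact LinearMap.range_eq_bot.1 (Submodule.finrank_eq_zero.1 h1)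
    rw [green_sum _ hnil n mu hsize hrk q hcard PHL Bform hHL_tri hB_pow hHL_orth Qval hGreen, hG,
      sum_UT χ h0 hadd, gg_total _ hnil χ h0 hadd hnt n (by rw [Module.finrank_fin_fun]), hcard,
      ← mul_assoc, inv_mul_cancel₀ (pow_ne_zero _ hq0), one_mul]

end GGU
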